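/- arXiv:0903.3189 — 2 statements merged into one kernel-verified Lean document; each statement's English description precedes it below -/
import Mathlib

section
/- Let s₁, s₂, s₃ ∈ ℝ satisfy s₁ + s₂ + s₃ = 1/2, s₁ < 5/8, s₂ < 5/8 and s₁ + s₂ > 0. Then there is a constant c such that for every sign s ∈ {+1,−1} and all Schwartz functions f, g on ℝ², setting u(t) = e^{s·it|D|} f and v(t) = e^{s·it|D|} g (the SAME sign in both factors), one has ‖ |D|^{−s₃} (u(t,·), v(t,·))_{HH→L} ‖_{L²(ℝ_t×ℝ²_x)} ≤ c ‖f‖_{Ḣ^{s₁}} ‖g‖_{Ḣ^{s₂}}. -/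
open MeasureTheory Complex
open scoped RealInnerProductSpace

noncomputable section

/-- ℝ² with the Euclidean norm. -/
abbrev E2 : Type := EuclideanSpace ℝ (Fin 2)

/-- Space-time ℝ × ℝ². -/
abbrev SpaceTime : Type := ℝ × E2

/-- Space–time Fourier transform f̃(τ,ξ). -/
def ftST (f : SpaceTime → ℂ) (τ : ℝ) (ξ : E2) : ℂ :=
  ∫ p : SpaceTime, Complex.exp (-Complex.I * ((p.1 * τ + ⟪p.2, ξ⟫ : ℝ) : ℂ)) * f p

/-- Spatial Fourier transform. -/
def ftX (f : E2 → ℂ) (ξ : E2) : ℂ :=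
  ∫ x : E2, Complex.exp (-Complex.I * ((⟪x, ξ⟫ : ℝ) : ℂ)) * f x

/-- Japanese bracket ⟨x⟩ = (1+x²)^{1/2}. -/
def jap (x : ℝ) : ℝ := Real.sqrt (1 + x ^ 2)

/-- L² norm in the Fourier variables (τ,ξ). -/
def l2F (g : ℝ → E2 → ℂ) : ℝ := Real.sqrt (∫ τ : ℝ, ∫ ξ : E2, ‖g τ ξ‖ ^ 2)

/-- Classical wave-Bourgain norm ‖f‖_{X^{a,b}_s}. -/
def Xnorm (a b s : ℝ) (f : SpaceTime → ℂ) : ℝ :=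
  l2F fun τ ξ => ((jap ‖ξ‖ ^ a * jap (τ + s * ‖ξ‖) ^ b : ℝ) : ℂ) * ftST f τ ξ

/-- The hypotheses on the Littlewood–Paley bump function φ. -/
structure IsLPBump (φ : ℝ → ℝ) : Prop where
  smooth : ContDiff ℝ (⊤ : ℕ∞) φ
  compactSupport : HasCompactSupport φ
  nonneg : ∀ τ, 0 ≤ φ τ
  support_subset : ∀ τ, φ τ ≠ 0 → 1 / 2 ≤ |τ| ∧ |τ| ≤ 2
  pos : ∀ τ, 1 / Real.sqrt 2 ≤ |τ| → |τ| ≤ Real.sqrt 2 → 0 < φ τ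

/-- ∑_{j∈ℤ} φ(2^{−j}τ). -/
def lpSum (φ : ℝ → ℝ) (τ : ℝ) : ℝ := ∑' j : ℤ, φ (τ / 2 ^ j)

/-- The Littlewood–Paley pieces φ̂_k: φ̂_k(τ) = φ(2^{−k}τ)/∑_{j∈ℤ}φ(2^{−j}τ) for k ≥ 1,
    φ̂_0 = 1 − ∑_{k≥1} φ̂_k. -/
def lpPiece (φ : ℝ → ℝ) : ℕ → ℝ → ℝ
  | 0, τ => 1 - ∑' k : ℕ, φ (τ / 2 ^ (k + 1)) / lpSum φ τ
  | k + 1, τ => φ (τ / 2 ^ (k + 1)) / lpSum φ τ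

/-- Bourgain–Besov norm ‖f‖_{X^{a,b,1}_s}. -/
def XnormB (φ : ℝ → ℝ) (a b s : ℝ) (f : SpaceTime → ℂ) : ℝ :=
  ∑' k : ℕ, (2 : ℝ) ^ (b * k) *
    l2F fun τ ξ => ((jap ‖ξ‖ ^ a * lpPiece φ k (τ + s * ‖ξ‖) : ℝ) : ℂ) * ftST f τ ξ

/-- Bourgain–Besov norm ‖f‖_{X^{a,b,∞}_s}. -/
def XnormBinf (φ : ℝ → ℝ) (a b s : ℝ) (f : SpaceTime → ℂ) : ℝ :=
  ⨆ k : ℕ, (2 : ℝ) ^ (b * k) *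
    l2F fun τ ξ => ((jap ‖ξ‖ ^ a * lpPiece φ k (τ + s * ‖ξ‖) : ℝ) : ℂ) * ftST f τ ξ

/-- Mixed norm ‖f‖_{L^q_t L^r_x}. -/
def mixedNorm (q r : ℝ) (f : SpaceTime → ℂ) : ℝ :=
  (∫ t : ℝ, (∫ x : E2, ‖f (t, x)‖ ^ r) ^ (q / r)) ^ (1 / q)

/-- L² norm on the slab [0,T] × ℝ². -/
def l2Slab (T : ℝ) (f : SpaceTime → ℂ) : ℝ :=
  Real.sqrt (∫ t in Set.Icc (0 : ℝ) T, ∫ x : E2, ‖f (t, x)‖ ^ 2)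
/-- The half-wave propagator u(t) = e^{s·it|D|}f, defined via the spatial Fourier
    multiplier with symbol e^{s·it|ξ|}. -/
def halfWave (s : ℝ) (f : E2 → ℂ) (t : ℝ) (x : E2) : ℂ :=
  ((2 * Real.pi) ^ (-2 : ℝ) : ℝ) •
    ∫ ξ : E2, Complex.exp (Complex.I * ((s * t * ‖ξ‖ + ⟪x, ξ⟫ : ℝ) : ℂ)) * ftX f ξ

/-- Spatial Fourier transform of the high-high-to-low interaction (u,v)_{HH→L}. -/
def hhLowX (u v : E2 → ℂ) (ξ : E2) : ℂ :=
  ∫ η : E2, (if 2 * ‖ξ‖ ≤ ‖η‖ + ‖ξ - η‖ then (1 : ℂ) else 0) * ftX u η * ftX v (ξ - η)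

/-- The function |D|^{−s₃}(u(t,·),v(t,·))_{HH→L} of (t,x). -/
def bilinHHL (s₃ : ℝ) (u v : ℝ → E2 → ℂ) (t : ℝ) (x : E2) : ℂ :=
  ((2 * Real.pi) ^ (-2 : ℝ) : ℝ) •
    ∫ ξ : E2, Complex.exp (Complex.I * ((⟪x, ξ⟫ : ℝ) : ℂ)) *
      ((‖ξ‖ ^ (-s₃) : ℝ) : ℂ) * hhLowX (u t) (v t) ξ

/-- Homogeneous Sobolev norm ‖f‖_{Ḣ^σ}. -/
def homSob (σ : ℝ) (f : E2 → ℂ) : ℝ :=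
  Real.sqrt (∫ ξ : E2, (‖ξ‖ ^ σ * ‖ftX f ξ‖) ^ 2)

open scoped ENNReal

theorem volume_le_volume_image_of_expanding {φ : ℝ → ℝ} {S : Set ℝ}
    (h : ∀ x ∈ S, ∀ y ∈ S, |x - y| ≤ |φ x - φ y|) : volume S ≤ volume (φ '' S) := by
  have hinj : Set.InjOn φ S := fun x hx y hy hxy => by
    have := h x hx y hy
    rw [hxy, sub_self, abs_zero] at this
    exact sub_eq_zero.1 (abs_eq_zero.1 (le_antisymm this (abs_nonneg _)))
  have hlip : LipschitzOnWith 1 (Function.invFunOn φ S) (φ '' S) := by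
    refine LipschitzOnWith.of_dist_le_mul ?_
    rintro _ ⟨x, hx, rfl⟩ _ ⟨y, hy, rfl⟩
    rw [hinj.leftInvOn_invFunOn hx, hinj.leftInvOn_invFunOn hy]
    simpa [Real.dist_eq] using h x hx y hy
  have := hlip.hausdorffMeasure_image_le (d := 1) zero_le_one
  rw [hinj.leftInvOn_invFunOn.image_image, hausdorffMeasure_real] at this
  simpa using this

theorem lintegral_comp_le_of_expanding {φ : ℝ → ℝ} {S : Set ℝ} (hφ : Measurable φ)
    (h : ∀ x ∈ S, ∀ y ∈ S, |x - y| ≤ |φ x - φ y|) {k : ℝ → ℝ≥0∞} (hk : Measurable k) :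
    ∫⁻ x in S, k (φ x) ≤ ∫⁻ τ, k τ := by
  rw [← lintegral_map hk hφ]
  refine lintegral_mono' (Measure.le_iff.2 fun A hA => ?_) le_rfl
  rw [Measure.map_apply hφ hA, Measure.restrict_apply (hφ hA)]
  refine (volume_le_volume_image_of_expanding fun x hx y hy => h x hx.2 y hy.2).trans
    (measure_mono ?_)
  rintro _ ⟨x, hx, rfl⟩
  exact hx.1

theorem setLIntegral_prod_comp_le_of_expanding {Φ : ℝ × ℝ → ℝ} (hΦ : Measurable Φ)
    {S : Set (ℝ × ℝ)} (hS : MeasurableSet S) {c ρ : ℝ} (hρ : ∀ p ∈ S, |p.1 - c| ≤ ρ)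
    (h : ∀ x y y', (x, y) ∈ S → (x, y') ∈ S → |y - y'| ≤ |Φ (x, y) - Φ (x, y')|)
    {k : ℝ → ℝ≥0∞} (hk : Measurable k) :
    ∫⁻ p in S, k (Φ p) ≤ ENNReal.ofReal (2 * ρ) * ∫⁻ τ, k τ := by
  have hm : Measurable (S.indicator fun p => k (Φ p)) := (hk.comp hΦ).indicator hS
  rw [← lintegral_indicator hS, Measure.volume_eq_prod, lintegral_prod _ hm.aemeasurable]
  calc ∫⁻ x, ∫⁻ y, S.indicator (fun p => k (Φ p)) (x, y)
      ≤ ∫⁻ x, (Set.Icc (c - ρ) (c + ρ)).indicator (fun _ => ∫⁻ τ, k τ) x := by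
        refine lintegral_mono fun x => ?_
        have hm : MeasurableSet {y | (x, y) ∈ S} := measurable_prodMk_left hS
        have e : ∀ y, S.indicator (fun p => k (Φ p)) (x, y)
            = {y | (x, y) ∈ S}.indicator (fun y => k (Φ (x, y))) y := fun y => rfl
        simp_rw [e]
        rw [lintegral_indicator hm]
        by_cases hx : x ∈ Set.Icc (c - ρ) (c + ρ)
        · rw [Set.indicator_of_mem hx]
          exact lintegral_comp_le_of_expanding (hΦ.comp measurable_prodMk_left)
            (fun y hy y' hy' => h x y y' hy hy') hk
        · have : {y | (x, y) ∈ S} = ∅ := by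
            refine Set.eq_empty_of_forall_notMem fun y hy => hx ?_
            have := abs_le.1 (hρ _ hy)
            constructor <;> simp only at this <;> linarith
          simp [this]
    _ = ENNReal.ofReal (2 * ρ) * ∫⁻ τ, k τ := by
        rw [lintegral_indicator measurableSet_Icc, setLIntegral_const, Real.volume_Icc, mul_comm]
        congr 2; ring

/-- The phase `|η| + |ξ - η|` of the interaction of two waves of the same sign. -/
def phase (ξ η : E2) : ℝ := ‖η‖ + ‖ξ - η‖

/-- The gradient of `phase ξ`. -/
def phaseGrad (ξ η : E2) : E2 := ‖η‖⁻¹ • η + ‖ξ - η‖⁻¹ • (η - ξ)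

theorem inner_inv_norm_smul_le (a b : E2) : ‖a‖ + ⟪‖a‖⁻¹ • a, b - a⟫ ≤ ‖b‖ := by
  rcases eq_or_ne a 0 with rfl | ha
  · simp
  have ha' : 0 < ‖a‖ := norm_pos_iff.2 ha
  rw [inner_sub_right, real_inner_smul_left, real_inner_smul_left, real_inner_self_eq_norm_sq]
  have h1 : ‖a‖⁻¹ * ‖a‖ ^ 2 = ‖a‖ := by field_simp
  have h2 : ‖a‖⁻¹ * ⟪a, b⟫ ≤ ‖b‖ := by
    rw [inv_mul_le_iff₀ ha']
    exact real_inner_le_norm a b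
  linarith

theorem phase_add_inner_le (ξ η η' : E2) :
    phase ξ η + ⟪phaseGrad ξ η, η' - η⟫ ≤ phase ξ η' := by
  have h1 := inner_inv_norm_smul_le η η'
  have h2 := inner_inv_norm_smul_le (η - ξ) (η' - ξ)
  rw [sub_sub_sub_cancel_right, norm_sub_rev η ξ, norm_sub_rev η' ξ] at h2
  rw [phase, phase, phaseGrad, inner_add_left]
  linarith

theorem three_le_norm_phaseGrad_sq {ξ η : E2} (hξ : ξ ≠ 0) (h : 2 * ‖ξ‖ ≤ phase ξ η) :
    3 ≤ ‖phaseGrad ξ η‖ ^ 2 := by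
  have hξ' : 0 < ‖ξ‖ := norm_pos_iff.2 hξ
  unfold phase at h
  have hη : 0 < ‖η‖ := norm_pos_iff.2 fun h0 => by
    rw [h0, norm_zero, sub_zero] at h; linarith
  have hζ : 0 < ‖ξ - η‖ := norm_pos_iff.2 fun h0 => by
    rw [h0, norm_zero, ← sub_eq_zero.1 h0] at h; linarith
  have e : ‖ξ‖ ^ 2 = ‖η‖ ^ 2 - 2 * ⟪η, η - ξ⟫ + ‖ξ - η‖ ^ 2 := by
    have := norm_sub_sq_real η (η - ξ)
    rwa [sub_sub_cancel, norm_sub_rev η ξ] at this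
  have key : ‖η‖ * ‖ξ - η‖ ≤ 2 * ⟪η, η - ξ⟫ := by
    nlinarith [sq_nonneg (‖η‖ - ‖ξ - η‖)]
  have e2 : ‖phaseGrad ξ η‖ ^ 2 = 2 + 2 * ⟪η, η - ξ⟫ / (‖η‖ * ‖ξ - η‖) := by
    rw [phaseGrad, norm_add_sq_real, norm_smul, norm_smul, norm_sub_rev η ξ,
      real_inner_smul_left, real_inner_smul_right, norm_inv, norm_inv, norm_norm, norm_norm]
    field_simp
    ring
  rw [e2]
  have : 1 ≤ 2 * ⟪η, η - ξ⟫ / (‖η‖ * ‖ξ - η‖) := by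
    rw [le_div_iff₀ (by positivity)]; linarith
  linarith

theorem exists_one_le_abs_phaseGrad {ξ η : E2} (hξ : ξ ≠ 0) (h : 2 * ‖ξ‖ ≤ phase ξ η) :
    ∃ i, 1 ≤ |phaseGrad ξ η i| := by
  by_contra! hc
  have h3 := three_le_norm_phaseGrad_sq hξ h
  rw [EuclideanSpace.norm_sq_eq, Fin.sum_univ_two] at h3
  have h0 := hc 0
  have h1 := hc 1
  simp only [Real.norm_eq_abs] at h3
  nlinarith [abs_nonneg (phaseGrad ξ η 0), abs_nonneg (phaseGrad ξ η 1)]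

theorem measurable_phase : Measurable fun p : E2 × E2 => phase p.1 p.2 := by
  unfold phase; fun_prop

theorem measurable_phaseGrad (ξ : E2) : Measurable (phaseGrad ξ) := by
  unfold phaseGrad; fun_prop

/-- Coordinates on the plane in which coordinate `i` comes last. -/
def coordEquiv (i : Fin 2) : ℝ × ℝ ≃ᵐ E2 :=
  if i = 1 then MeasurableEquiv.finTwoArrow.symm.trans (MeasurableEquiv.toLp 2 (Fin 2 → ℝ))
  else MeasurableEquiv.prodComm.trans
    (MeasurableEquiv.finTwoArrow.symm.trans (MeasurableEquiv.toLp 2 (Fin 2 → ℝ)))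

theorem measurePreserving_coordEquiv (i : Fin 2) : MeasurePreserving (coordEquiv i) := by
  have h : MeasurePreserving
      (MeasurableEquiv.finTwoArrow.symm.trans (MeasurableEquiv.toLp 2 (Fin 2 → ℝ))) :=
    (volume_preserving_finTwoArrow ℝ).symm.trans
      (EuclideanSpace.volume_preserving_symm_measurableEquiv_toLp (Fin 2)).symm
  unfold coordEquiv
  split_ifs
  · exact h
  · exact (Measure.measurePreserving_swap (μ := (volume : Measure ℝ))
      (ν := (volume : Measure ℝ))).trans h

theorem coordEquiv_apply_first (i : Fin 2) (p : ℝ × ℝ) : coordEquiv i p (1 - i) = p.1 := by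
  fin_cases i <;> simp [coordEquiv, MeasurableEquiv.finTwoArrow, MeasurableEquiv.prodComm]

theorem inner_coordEquiv_sub (i : Fin 2) (v : E2) (x y y' : ℝ) :
    ⟪v, coordEquiv i (x, y') - coordEquiv i (x, y)⟫ = v i * (y' - y) := by
  fin_cases i <;>
    simp [coordEquiv, MeasurableEquiv.finTwoArrow, MeasurableEquiv.prodComm, PiLp.inner_apply,
      mul_comm]

theorem setLIntegral_phase_le_of_slope {s : ℝ} (hs : |s| = 1) (i : Fin 2) {σ : ℝ} (hσ : |σ| = 1)
    (ξ z : E2) (ρ : ℝ) {k : ℝ → ℝ≥0∞} (hk : Measurable k) :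
    ∫⁻ η in Metric.closedBall z ρ ∩ {η | 1 ≤ σ * phaseGrad ξ η i}, k (s * phase ξ η)
      ≤ ENNReal.ofReal (2 * ρ) * ∫⁻ τ, k τ := by
  have hSm : MeasurableSet (Metric.closedBall z ρ ∩ {η | 1 ≤ σ * phaseGrad ξ η i}) := by
    refine Metric.isClosed_closedBall.measurableSet.inter (measurableSet_le measurable_const ?_)
    have := measurable_phaseGrad ξ
    fun_prop
  rw [← (measurePreserving_coordEquiv i).setLIntegral_comp_preimage_emb
    (coordEquiv i).measurableEmbedding]
  have hm : Measurable fun η => s * phase ξ η := by unfold phase; fun_prop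
  refine setLIntegral_prod_comp_le_of_expanding (Φ := fun p => s * phase ξ (coordEquiv i p))
    (c := z (1 - i))
    (hm.comp (coordEquiv i).measurable) ((coordEquiv i).measurable hSm) ?_ ?_ hk
  · rintro p ⟨hp, -⟩
    rw [Metric.mem_closedBall, dist_eq_norm] at hp
    have := (PiLp.norm_apply_le (coordEquiv i p - z) (1 - i)).trans hp
    rwa [PiLp.sub_apply, coordEquiv_apply_first, Real.norm_eq_abs] at this
  · rintro x y y' ⟨-, h1⟩ ⟨-, h2⟩
    simp only [Set.mem_ofPred_eq] at h1 h2
    rw [← mul_sub, abs_mul, hs, one_mul]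
    have a1 := phase_add_inner_le ξ (coordEquiv i (x, y)) (coordEquiv i (x, y'))
    have a2 := phase_add_inner_le ξ (coordEquiv i (x, y')) (coordEquiv i (x, y))
    rw [inner_coordEquiv_sub] at a1 a2
    rcases (abs_eq zero_le_one).1 hσ with rfl | rfl <;> rcases le_total y y' with hy | hy
    · rw [abs_sub_comm, abs_of_nonneg (by linarith), abs_sub_comm]
      refine le_trans ?_ (le_abs_self _); nlinarith
    · rw [abs_of_nonneg (by linarith)]
      refine le_trans ?_ (le_abs_self _); nlinarith
    · rw [abs_sub_comm, abs_of_nonneg (by linarith)]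
      refine le_trans ?_ (le_abs_self _); nlinarith
    · rw [abs_of_nonneg (by linarith), abs_sub_comm]
      refine le_trans ?_ (le_abs_self _); nlinarith

theorem setLIntegral_phase_le {s : ℝ} (hs : |s| = 1) {ξ : E2} (hξ : ξ ≠ 0) (z : E2) {ρ : ℝ}
    (hρ : 0 ≤ ρ) {k : ℝ → ℝ≥0∞} (hk : Measurable k) :
    ∫⁻ η in Metric.closedBall z ρ ∩ {η | 2 * ‖ξ‖ ≤ phase ξ η}, k (s * phase ξ η)
      ≤ ENNReal.ofReal (8 * ρ) * ∫⁻ τ, k τ := by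
  set S : Fin 2 → ℝ → Set E2 := fun i σ =>
    Metric.closedBall z ρ ∩ {η | 1 ≤ σ * phaseGrad ξ η i} with hS
  have hsub : Metric.closedBall z ρ ∩ {η | 2 * ‖ξ‖ ≤ phase ξ η} ⊆
      (S 0 1 ∪ S 0 (-1)) ∪ (S 1 1 ∪ S 1 (-1)) := by
    rintro η ⟨hη, h⟩
    obtain ⟨i, hi⟩ := exists_one_le_abs_phaseGrad hξ h
    simp only [hS, Set.mem_union, Set.mem_inter_iff, hη, true_and, Set.mem_ofPred_eq, one_mul,
      neg_one_mul]
    fin_cases i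
    · exact Or.inl (le_abs.1 hi)
    · exact Or.inr (le_abs.1 hi)
  have h1 : ∀ i, ∫⁻ η in S i 1, k (s * phase ξ η) ≤ ENNReal.ofReal (2 * ρ) * ∫⁻ τ, k τ :=
    fun i => setLIntegral_phase_le_of_slope hs i (by simp) ξ z ρ hk
  have h2 : ∀ i, ∫⁻ η in S i (-1), k (s * phase ξ η) ≤ ENNReal.ofReal (2 * ρ) * ∫⁻ τ, k τ :=
    fun i => setLIntegral_phase_le_of_slope hs i (by simp) ξ z ρ hk
  calc _ ≤ _ := lintegral_mono_set hsub
    _ ≤ _ := (lintegral_union_le _ _ _).trans (add_le_add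
        ((lintegral_union_le _ _ _).trans (add_le_add (h1 0) (h2 0)))
        ((lintegral_union_le _ _ _).trans (add_le_add (h1 1) (h2 1))))
    _ = _ := by
      rw [← add_mul, ← add_mul, ← ENNReal.ofReal_add (by positivity) (by positivity),
        ← ENNReal.ofReal_add (by positivity) (by positivity)]
      congr 2; ring

theorem lintegral_mul_le_rpow_half {α : Type*} [MeasurableSpace α] (μ : Measure α)
    {f g : α → ℝ≥0∞} (hf : Measurable f) (hg : Measurable g) :
    ∫⁻ x, f x * g x ∂μ ≤ (∫⁻ x, f x ^ 2 ∂μ) ^ (1 / 2 : ℝ) * (∫⁻ x, g x ^ 2 ∂μ) ^ (1 / 2 : ℝ) := by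
  have h := ENNReal.lintegral_mul_le_Lp_mul_Lq μ Real.HolderConjugate.two_two
    hf.aemeasurable hg.aemeasurable
  simpa only [Pi.mul_apply, ENNReal.rpow_two] using h

/-- Weight concentrated where `z` lies within `c * r * ‖η‖` of `e * η`. -/
def bump (c δ e : ℝ) (z η : E2) : ℝ≥0∞ :=
  {p : E2 × E2 | ‖p.1 - e • p.2‖ ≤ c * δ * ‖p.2‖}.indicator
    (fun p => ENNReal.ofReal (δ * ‖p.2‖)⁻¹) (z, η)

theorem measurable_bump (c δ e : ℝ) : Measurable fun p : E2 × E2 => bump c δ e p.1 p.2 := by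
  refine Measurable.indicator (by fun_prop) (measurableSet_le ?_ ?_) <;> fun_prop

theorem measurable_bump_left (c δ e : ℝ) (η : E2) : Measurable fun z => bump c δ e z η :=
  Measurable.of_uncurry_right (f := bump c δ e) (measurable_bump c δ e)

theorem bump_of_le {c δ e : ℝ} {z η : E2} (h : ‖z - e • η‖ ≤ c * δ * ‖η‖) :
    bump c δ e z η = ENNReal.ofReal (δ * ‖η‖)⁻¹ :=
  Set.indicator_of_mem (by exact h) _

theorem bump_of_not_le {c δ e : ℝ} {z η : E2} (h : ¬ ‖z - e • η‖ ≤ c * δ * ‖η‖) :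
    bump c δ e z η = 0 :=
  Set.indicator_of_notMem (by exact h) _

theorem volume_closedBall_E2 (z : E2) {r : ℝ} (hr : 0 ≤ r) :
    volume (Metric.closedBall z r) = ENNReal.ofReal (r ^ 2) * volume (Metric.ball (0 : E2) 1) := by
  rw [Measure.addHaar_closedBall _ _ hr, finrank_euclideanSpace_fin]

theorem lintegral_bump_sq_le {c δ : ℝ} (hc : 0 ≤ c) (hδ : 0 < δ) (e : ℝ) (η : E2) :
    ∫⁻ z, bump c δ e z η ^ 2 ≤ ENNReal.ofReal (c ^ 2) * volume (Metric.ball (0 : E2) 1) := by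
  have e1 : ∀ z, bump c δ e z η ^ 2 = (Metric.closedBall (e • η) (c * δ * ‖η‖)).indicator
      (fun _ => ENNReal.ofReal ((δ * ‖η‖)⁻¹ ^ 2)) z := fun z => by
    by_cases h : ‖z - e • η‖ ≤ c * δ * ‖η‖
    · rw [bump_of_le h, Set.indicator_of_mem (by rwa [Metric.mem_closedBall, dist_eq_norm]),
        ENNReal.ofReal_pow (by positivity)]
    · rw [bump_of_not_le h, Set.indicator_of_notMem (by rwa [Metric.mem_closedBall, dist_eq_norm]),
        zero_pow two_ne_zero]
  simp_rw [e1]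
  rw [lintegral_indicator Metric.isClosed_closedBall.measurableSet, setLIntegral_const,
    volume_closedBall_E2 _ (by positivity), ← mul_assoc, ← ENNReal.ofReal_mul (by positivity)]
  gcongr
  rcases eq_or_ne η 0 with rfl | hη
  · simp; positivity
  · have : 0 < ‖η‖ := norm_pos_iff.2 hη
    apply le_of_eq
    field_simp

/-- The part of the high-high-to-low region where the output frequency is comparable to `δ` times
the input frequency. -/
def ratioRegion (δ : ℝ) : Set (E2 × E2) :=
  {p | p.1 ≠ 0 ∧ 2 * ‖p.1‖ ≤ phase p.1 p.2 ∧ δ * ‖p.2‖ ≤ ‖p.1‖ ∧ ‖p.1‖ ≤ 2 * δ * ‖p.2‖}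

theorem measurableSet_ratioRegion (δ : ℝ) : MeasurableSet (ratioRegion δ) := by
  have := measurable_phase
  have e : ratioRegion δ = (Prod.fst ⁻¹' {(0 : E2)})ᶜ ∩ ({p | 2 * ‖p.1‖ ≤ phase p.1 p.2} ∩
      ({p | δ * ‖p.2‖ ≤ ‖p.1‖} ∩ {p | ‖p.1‖ ≤ 2 * δ * ‖p.2‖})) := rfl
  rw [e]
  refine (measurable_fst (measurableSet_singleton _)).compl.inter
    ((measurableSet_le ?_ ?_).inter ((measurableSet_le ?_ ?_).inter (measurableSet_le ?_ ?_))) <;>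
    fun_prop

theorem norm_le_three_mul {ξ η : E2} (h : 2 * ‖ξ‖ ≤ phase ξ η) :
    ‖η‖ ≤ 3 * ‖ξ - η‖ ∧ ‖ξ - η‖ ≤ 3 * ‖η‖ := by
  unfold phase at h
  have h1 := norm_sub_le ξ (ξ - η)
  rw [sub_sub_cancel] at h1
  have h2 := norm_sub_le ξ η
  constructor <;> linarith

theorem norm_pos_of_phase {ξ η : E2} (hξ : ξ ≠ 0) (h : 2 * ‖ξ‖ ≤ phase ξ η) :
    0 < ‖η‖ ∧ 0 < ‖ξ - η‖ := by
  obtain ⟨h1, h2⟩ := norm_le_three_mul h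
  have hξ' : 0 < ‖ξ‖ := norm_pos_iff.2 hξ
  unfold phase at h
  constructor <;> linarith

theorem mul_le_lintegral_bump {δ : ℝ} (hδ : 0 < δ) {p : E2 × E2} (hp : p ∈ ratioRegion δ) :
    volume (Metric.ball (0 : E2) 1) ≤
      12 * ∫⁻ z, bump (1 / 2) δ 1 z p.2 * bump 8 δ (-1) z (p.1 - p.2) := by
  obtain ⟨ξ, η⟩ := p
  obtain ⟨hξ, hχ, -, h4⟩ := hp
  simp only at hξ hχ h4 ⊢
  obtain ⟨hη, hζ⟩ := norm_pos_of_phase hξ hχ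
  obtain ⟨h5, h6⟩ := norm_le_three_mul hχ
  have key : ∀ z, (Metric.closedBall η (1 / 2 * δ * ‖η‖)).indicator
      (fun _ => ENNReal.ofReal ((δ * ‖η‖)⁻¹ * (δ * ‖ξ - η‖)⁻¹)) z ≤
      bump (1 / 2) δ 1 z η * bump 8 δ (-1) z (ξ - η) := fun z => by
    by_cases hz : z ∈ Metric.closedBall η (1 / 2 * δ * ‖η‖)
    · rw [Set.indicator_of_mem hz]
      rw [Metric.mem_closedBall, dist_eq_norm] at hz
      rw [bump_of_le (by simpa using hz), bump_of_le, ENNReal.ofReal_mul (by positivity)]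
      have e : z - (-1 : ℝ) • (ξ - η) = (z - η) + ξ := by module
      rw [e]
      refine (norm_add_le _ _).trans ?_
      nlinarith
    · rw [Set.indicator_of_notMem hz]; exact zero_le
  refine le_trans ?_ (mul_le_mul_right (lintegral_mono key) _)
  rw [lintegral_indicator Metric.isClosed_closedBall.measurableSet, setLIntegral_const,
    volume_closedBall_E2 _ (by positivity), ← mul_assoc, ← mul_assoc,
    show (12 : ℝ≥0∞) = ENNReal.ofReal 12 by simp, ← ENNReal.ofReal_mul (by positivity),
    ← ENNReal.ofReal_mul (by positivity)]
  refine le_mul_of_one_le_left zero_le ?_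
  rw [ENNReal.one_le_ofReal]
  have : 12 * ((δ * ‖η‖)⁻¹ * (δ * ‖ξ - η‖)⁻¹) * (1 / 2 * δ * ‖η‖) ^ 2
      = 3 * ‖η‖ / ‖ξ - η‖ := by
    field_simp; ring
  rw [this, le_div_iff₀ hζ]
  linarith

theorem lintegral_ratioRegion_sq_le {s : ℝ} (hs : |s| = 1) (δ : ℝ) (z : E2)
    {K : ℝ × E2 → ℝ≥0∞} (hK : Measurable K) :
    ∫⁻ p in ratioRegion δ, ({p : E2 × E2 | ‖z - p.2‖ ≤ 1 / 2 * ‖p.1‖}.indicator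
        (fun p => K (s * phase p.1 p.2, p.1) * ENNReal.ofReal (‖p.1‖ ^ (-1 / 2 : ℝ))) p) ^ 2
      ≤ 4 * ∫⁻ q, K q ^ 2 := by
  set H : E2 × E2 → ℝ≥0∞ := fun p => ENNReal.ofReal ‖p.1‖⁻¹ *
    (Metric.closedBall z (1 / 2 * ‖p.1‖) ∩ {η | 2 * ‖p.1‖ ≤ phase p.1 η}).indicator
      (fun η => K (s * phase p.1 η, p.1) ^ 2) p.2 with hH
  have hmS : ∀ ξ : E2, MeasurableSet
      (Metric.closedBall z (1 / 2 * ‖ξ‖) ∩ {η | 2 * ‖ξ‖ ≤ phase ξ η}) := fun ξ =>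
    Metric.isClosed_closedBall.measurableSet.inter
      (measurableSet_le measurable_const (by unfold phase; fun_prop))
  rw [← lintegral_indicator (measurableSet_ratioRegion δ)]
  calc _ ≤ ∫⁻ p, H p := by
        refine lintegral_mono fun p => ?_
        refine Set.indicator_le (fun p hp => ?_) p
        obtain ⟨hξ, hχ, -, -⟩ := hp
        by_cases hz : ‖z - p.2‖ ≤ 1 / 2 * ‖p.1‖
        · rw [Set.indicator_of_mem (by exact hz), hH]
          simp only
          have hmem : p.2 ∈ Metric.closedBall z (1 / 2 * ‖p.1‖) ∩ {η | 2 * ‖p.1‖ ≤ phase p.1 η} :=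
            ⟨by rwa [Metric.mem_closedBall, dist_eq_norm, norm_sub_rev], hχ⟩
          rw [Set.indicator_of_mem hmem, mul_pow, mul_comm,
            ← ENNReal.ofReal_pow (by positivity), ← Real.rpow_mul_natCast (norm_nonneg _)]
          norm_num [Real.rpow_neg_one]
        · rw [Set.indicator_of_notMem (by exact hz)]; simp
    _ ≤ ∫⁻ ξ, ∫⁻ η, H (ξ, η) := lintegral_prod_le _
    _ ≤ ∫⁻ ξ, 4 * ∫⁻ τ, K (τ, ξ) ^ 2 := by
        refine lintegral_mono fun ξ => ?_
        rw [hH]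
        simp only
        rw [lintegral_const_mul' _ _ ENNReal.ofReal_ne_top, lintegral_indicator (hmS ξ)]
        rcases eq_or_ne ξ 0 with rfl | hξ
        · simp
        have h := setLIntegral_phase_le hs hξ z (ρ := 1 / 2 * ‖ξ‖) (by positivity)
          (k := fun τ => K (τ, ξ) ^ 2) (by fun_prop)
        refine (mul_le_mul_right h _).trans (le_of_eq ?_)
        have : 0 < ‖ξ‖ := norm_pos_iff.2 hξ
        rw [← mul_assoc, ← ENNReal.ofReal_mul (by positivity)]
        congr 1
        rw [show ‖ξ‖⁻¹ * (8 * (1 / 2 * ‖ξ‖)) = 4 by field_simp; norm_num]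
        simp
    _ = _ := by
        rw [lintegral_const_mul _ (by fun_prop), Measure.volume_eq_prod,
          lintegral_prod_symm _ (by fun_prop)]

theorem lintegral_comp_sub_mul {f g : E2 → ℝ≥0∞} (hf : Measurable f) (hg : Measurable g) :
    ∫⁻ p : E2 × E2, f p.2 * g (p.1 - p.2) = (∫⁻ η, f η) * ∫⁻ ζ, g ζ := by
  rw [Measure.volume_eq_prod, lintegral_prod_symm _ (by fun_prop)]
  have : ∀ η, ∫⁻ ξ, f η * g (ξ - η) = f η * ∫⁻ ζ, g ζ := fun η => by
    rw [lintegral_const_mul _ (by fun_prop), lintegral_sub_right_eq_self]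
  simp_rw [this]
  rw [lintegral_mul_const _ hf]

theorem lintegral_bump_mul_sq_le {c δ : ℝ} (hc : 0 ≤ c) (hδ : 0 < δ) (e : ℝ) {F : E2 → ℝ≥0∞}
    (hF : Measurable F) :
    ∫⁻ z, ∫⁻ η, (bump c δ e z η * F η) ^ 2 ≤
      ENNReal.ofReal (c ^ 2) * volume (Metric.ball (0 : E2) 1) * ∫⁻ η, F η ^ 2 := by
  have hb := measurable_bump c δ e
  have hm : Measurable fun x : E2 × E2 => (bump c δ e x.1 x.2 * F x.2) ^ 2 :=
    (hb.mul (hF.comp measurable_snd)).pow_const 2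
  rw [lintegral_lintegral_swap (f := fun z η => (bump c δ e z η * F η) ^ 2) hm.aemeasurable,
    ← lintegral_const_mul _ (hF.pow_const 2)]
  refine lintegral_mono fun η => ?_
  simp_rw [mul_pow]
  rw [lintegral_mul_const _ ((measurable_bump_left c δ e η).pow_const 2)]
  gcongr
  exact lintegral_bump_sq_le hc hδ e η

theorem ENNReal.rpow_half_sq (x : ℝ≥0∞) : (x ^ (1 / 2 : ℝ)) ^ 2 = x := by
  rw [← ENNReal.rpow_mul_natCast]; norm_num

theorem ENNReal.ofReal_sq_rpow_half {a : ℝ} (ha : 0 ≤ a) :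
    ENNReal.ofReal (a ^ 2) ^ (1 / 2 : ℝ) = ENNReal.ofReal a := by
  rw [ENNReal.ofReal_rpow_of_nonneg (by positivity) (by norm_num), ← Real.sqrt_eq_rpow,
    Real.sqrt_sq ha]

/-- The `L²` norm of a nonnegative function. -/
def lnorm {α : Type*} [MeasureSpace α] (f : α → ℝ≥0∞) : ℝ≥0∞ := (∫⁻ x, f x ^ 2) ^ (1 / 2 : ℝ)

theorem lnorm_sq {α : Type*} [MeasureSpace α] (f : α → ℝ≥0∞) : lnorm f ^ 2 = ∫⁻ x, f x ^ 2 :=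
  ENNReal.rpow_half_sq _

theorem setLIntegral_ratioRegion_bump_le {s : ℝ} (hs : |s| = 1) (δ : ℝ) (z : E2)
    {K : ℝ × E2 → ℝ≥0∞} (hK : Measurable K) {f g : E2 → ℝ≥0∞} (hf : Measurable f)
    (hg : Measurable g) (hz : ∀ η, f η ≠ 0 → ‖z - η‖ ≤ 1 / 2 * (δ * ‖η‖)) :
    ∫⁻ p in ratioRegion δ, K (s * phase p.1 p.2, p.1) * ENNReal.ofReal (‖p.1‖ ^ (-1 / 2 : ℝ)) *
        (f p.2 * g (p.1 - p.2)) ≤ 2 * lnorm K * (lnorm f * lnorm g) := by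
  have hphase := measurable_phase
  set W : E2 × E2 → ℝ≥0∞ := {p : E2 × E2 | ‖z - p.2‖ ≤ 1 / 2 * ‖p.1‖}.indicator
    fun p => K (s * phase p.1 p.2, p.1) * ENNReal.ofReal (‖p.1‖ ^ (-1 / 2 : ℝ)) with hW
  have hWm : Measurable W :=
    Measurable.indicator (by fun_prop) (measurableSet_le (by fun_prop) (by fun_prop))
  have h4 : (4 : ℝ≥0∞) ^ (1 / 2 : ℝ) = 2 := by
    have := ENNReal.ofReal_sq_rpow_half (a := 2) (by norm_num)
    norm_num at this
    simpa using this
  calc _ ≤ ∫⁻ p in ratioRegion δ, W p * (f p.2 * g (p.1 - p.2)) := by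
        refine setLIntegral_mono (by fun_prop) fun p hp => ?_
        by_cases h0 : f p.2 = 0
        · simp [h0]
        have hp' := hz _ h0
        have : ‖z - p.2‖ ≤ 1 / 2 * ‖p.1‖ := by
          have := hp.2.2.1
          linarith
        rw [hW, Set.indicator_of_mem (by exact this)]
    _ ≤ (∫⁻ p in ratioRegion δ, W p ^ 2) ^ (1 / 2 : ℝ) *
        (∫⁻ p in ratioRegion δ, (f p.2 * g (p.1 - p.2)) ^ 2) ^ (1 / 2 : ℝ) :=
      lintegral_mul_le_rpow_half _ hWm (by fun_prop)
    _ ≤ _ := by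
      have e : 2 * lnorm K = (4 * ∫⁻ q, K q ^ 2) ^ (1 / 2 : ℝ) := by
        rw [ENNReal.mul_rpow_of_nonneg _ _ (by norm_num), h4, lnorm]
      rw [e, lnorm, lnorm, ← ENNReal.mul_rpow_of_nonneg (∫⁻ η, f η ^ 2) _ (by norm_num : (0 : ℝ) ≤ 1 / 2)]
      refine mul_le_mul' (ENNReal.rpow_le_rpow ?_ (by norm_num))
        (ENNReal.rpow_le_rpow ?_ (by norm_num))
      · exact lintegral_ratioRegion_sq_le hs δ z hK
      · refine (setLIntegral_le_lintegral _ _).trans (le_of_eq ?_)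
        simp_rw [mul_pow]
        exact lintegral_comp_sub_mul (hf.pow_const 2) (hg.pow_const 2)

theorem measurable_lnorm {α β : Type*} [MeasurableSpace α] [MeasureSpace β]
    [SFinite (volume : Measure β)] {f : α × β → ℝ≥0∞} (hf : Measurable f) :
    Measurable fun a => lnorm fun b => f (a, b) :=
  (hf.pow_const 2).lintegral_prod_right'.pow_const _

theorem lintegral_lnorm_bump_mul_le {δ : ℝ} (hδ : 0 < δ) {F G : E2 → ℝ≥0∞}
    (hF : Measurable F) (hG : Measurable G) :
    ∫⁻ z, lnorm (fun η => bump (1 / 2) δ 1 z η * F η) * lnorm (fun η => bump 8 δ (-1) z η * G η) ≤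
      8 * volume (Metric.ball (0 : E2) 1) * (lnorm F * lnorm G) := by
  have h0 : (0 : ℝ) ≤ 1 / 2 := by norm_num
  refine (lintegral_mul_le_rpow_half _
    (measurable_lnorm ((measurable_bump (1 / 2) δ 1).mul (hF.comp measurable_snd)))
    (measurable_lnorm ((measurable_bump 8 δ (-1)).mul (hG.comp measurable_snd)))).trans ?_
  simp_rw [lnorm_sq]
  refine (mul_le_mul'
    (ENNReal.rpow_le_rpow (lintegral_bump_mul_sq_le (c := 1 / 2) h0 hδ 1 hF) h0)
    (ENNReal.rpow_le_rpow (lintegral_bump_mul_sq_le (c := 8) (by norm_num) hδ (-1) hG) h0)).trans ?_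
  rw [ENNReal.mul_rpow_of_nonneg _ _ h0, ENNReal.mul_rpow_of_nonneg _ _ h0,
    ENNReal.mul_rpow_of_nonneg _ _ h0, ENNReal.mul_rpow_of_nonneg _ _ h0,
    ENNReal.ofReal_sq_rpow_half h0, ENNReal.ofReal_sq_rpow_half (by norm_num)]
  change ENNReal.ofReal (1 / 2) * _ * lnorm F * (ENNReal.ofReal 8 * _ * lnorm G) ≤ _
  set v := volume (Metric.ball (0 : E2) 1) ^ (1 / 2 : ℝ) with hv
  have hvv : volume (Metric.ball (0 : E2) 1) = v * v := by
    rw [← sq, ENNReal.rpow_half_sq]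
  have h1 : ENNReal.ofReal (1 / 2) ≤ 1 := by
    rw [ENNReal.ofReal_le_one]; norm_num
  have h8 : ENNReal.ofReal 8 = 8 := by simp
  rw [hvv, h8]
  calc _ = ENNReal.ofReal (1 / 2) * (8 * (v * v) * (lnorm F * lnorm G)) := by ring
    _ ≤ 1 * (8 * (v * v) * (lnorm F * lnorm G)) := by gcongr
    _ = _ := one_mul _

theorem lintegral_ratioRegion_le {s : ℝ} (hs : |s| = 1) {δ : ℝ} (hδ : 0 < δ)
    {K : ℝ × E2 → ℝ≥0∞} (hK : Measurable K) {F G : E2 → ℝ≥0∞} (hF : Measurable F)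
    (hG : Measurable G) :
    ∫⁻ p in ratioRegion δ, K (s * phase p.1 p.2, p.1) * ENNReal.ofReal (‖p.1‖ ^ (-1 / 2 : ℝ)) *
        (F p.2 * G (p.1 - p.2)) ≤ 192 * (lnorm K * (lnorm F * lnorm G)) := by
  set V := volume (Metric.ball (0 : E2) 1) with hV
  have hV0 : V ≠ 0 := (Metric.measure_ball_pos _ _ one_pos).ne'
  have hVt : V ≠ ∞ := measure_ball_lt_top.ne
  set W : E2 × E2 → ℝ≥0∞ := fun p =>
    K (s * phase p.1 p.2, p.1) * ENNReal.ofReal (‖p.1‖ ^ (-1 / 2 : ℝ)) with hW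
  have hWm : Measurable W := by
    have := measurable_phase
    fun_prop
  set f : E2 → E2 → ℝ≥0∞ := fun z η => bump (1 / 2) δ 1 z η * F η with hf
  set g : E2 → E2 → ℝ≥0∞ := fun z η => bump 8 δ (-1) z η * G η with hg
  have hfm : Measurable fun p : E2 × E2 => f p.1 p.2 :=
    (measurable_bump _ _ _).mul (hF.comp measurable_snd)
  have hgm : Measurable fun p : E2 × E2 => g p.1 p.2 :=
    (measurable_bump _ _ _).mul (hG.comp measurable_snd)
  have hfg : Measurable fun x : (E2 × E2) × E2 =>
      W x.1 * (f x.2 x.1.2 * g x.2 (x.1.1 - x.1.2)) :=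
    (hWm.comp measurable_fst).mul
      ((Measurable.comp (g := Function.uncurry f) hfm
        (f := fun x : (E2 × E2) × E2 => (x.2, x.1.2)) (by fun_prop)).mul
      (Measurable.comp (g := Function.uncurry g) hgm
        (f := fun x : (E2 × E2) × E2 => (x.2, x.1.1 - x.1.2)) (by fun_prop)))
  refine (ENNReal.mul_le_mul_iff_right hV0 hVt).1 ?_
  calc V * ∫⁻ p in ratioRegion δ, W p * (F p.2 * G (p.1 - p.2))
      = ∫⁻ p in ratioRegion δ, V * (W p * (F p.2 * G (p.1 - p.2))) := by
        rw [lintegral_const_mul _ (by fun_prop)]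
    _ ≤ ∫⁻ p in ratioRegion δ, 12 * ∫⁻ z, W p * (f z p.2 * g z (p.1 - p.2)) := by
        refine setLIntegral_mono' (measurableSet_ratioRegion δ) fun p hp => ?_
        refine (mul_le_mul_left (mul_le_lintegral_bump hδ hp) _).trans (le_of_eq ?_)
        rw [mul_assoc, mul_comm (∫⁻ z, _), ← lintegral_const_mul]
        · simp only [hf, hg]
          congr 2 with z
          ring
        · exact (measurable_bump_left _ _ _ _).mul (measurable_bump_left _ _ _ _)
    _ = 12 * ∫⁻ z, ∫⁻ p in ratioRegion δ, W p * (f z p.2 * g z (p.1 - p.2)) := by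
        have hswap := lintegral_lintegral_swap (μ := volume.restrict (ratioRegion δ))
          (ν := (volume : Measure E2))
          (f := fun p z => W p * (f z p.2 * g z (p.1 - p.2))) hfg.aemeasurable
        rw [lintegral_const_mul _ hfg.lintegral_prod_right', hswap]
    _ ≤ 12 * ∫⁻ z, 2 * lnorm K * (lnorm (f z) * lnorm (g z)) := by
        gcongr with z
        refine setLIntegral_ratioRegion_bump_le hs δ z hK (Measurable.of_uncurry_left (f := f) hfm)
          (Measurable.of_uncurry_left (f := g) hgm) fun η hη => ?_
        by_contra h
        refine hη ?_
        rw [hf]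
        simp only
        rw [bump_of_not_le (by rwa [one_smul, mul_assoc]), zero_mul]
    _ = 12 * (2 * lnorm K * ∫⁻ z, lnorm (f z) * lnorm (g z)) := by
        have hm : Measurable fun z => lnorm (f z) * lnorm (g z) :=
          (measurable_lnorm hfm).mul (measurable_lnorm hgm)
        rw [lintegral_const_mul _ hm]
    _ ≤ 12 * (2 * lnorm K * (8 * V * (lnorm F * lnorm G))) := by
        gcongr
        exact lintegral_lnorm_bump_mul_le hδ hF hG
    _ = _ := by ring

theorem exists_mem_ratioRegion {p : E2 × E2} (hp : p.1 ≠ 0) (h : 2 * ‖p.1‖ ≤ phase p.1 p.2) :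
    ∃ j : ℕ, p ∈ ratioRegion ((1 / 2) ^ j) := by
  obtain ⟨ξ, η⟩ := p
  simp only at hp h
  obtain ⟨hη, -⟩ := norm_pos_of_phase hp h
  have h3 := norm_sub_le ξ η
  have hξ : 0 < ‖ξ‖ := norm_pos_iff.2 hp
  obtain ⟨j, h1, h2⟩ := exists_nat_pow_near_of_lt_one (x := ‖ξ‖ / (2 * ‖η‖)) (y := (1 / 2 : ℝ))
    (by positivity) (by rw [div_le_one (by positivity)]; unfold phase at h; linarith)
    (by norm_num) (by norm_num)
  refine ⟨j, hp, h, ?_, ?_⟩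
  · rw [pow_succ, lt_div_iff₀ (by positivity)] at h1
    simp only
    linarith
  · rw [div_le_iff₀ (by positivity)] at h2
    simp only
    linarith

theorem rpow_weight_le {s₁ s₂ s₃ : ℝ} (hsum : s₁ + s₂ + s₃ = 1 / 2) (h₁₂ : 0 < s₁ + s₂) {δ : ℝ}
    (hδ : 0 < δ) {p : E2 × E2} (hp : p ∈ ratioRegion δ) :
    ‖p.1‖ ^ (-s₃) ≤ 3 ^ |s₂| * (2 * δ) ^ (s₁ + s₂) * ‖p.1‖ ^ (-1 / 2 : ℝ) *
      (‖p.2‖ ^ s₁ * ‖p.1 - p.2‖ ^ s₂) := by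
  obtain ⟨ξ, η⟩ := p
  obtain ⟨hξ, hχ, -, h4⟩ := hp
  simp only at hξ hχ h4 ⊢
  obtain ⟨hη, hζ⟩ := norm_pos_of_phase hξ hχ
  obtain ⟨h5, h6⟩ := norm_le_three_mul hχ
  have hξ : 0 < ‖ξ‖ := norm_pos_iff.2 hξ
  have a1 : ‖ξ‖ ^ (-s₃) = ‖ξ‖ ^ (-1 / 2 : ℝ) * ‖ξ‖ ^ (s₁ + s₂) := by
    rw [← Real.rpow_add hξ]; congr 1; linarith
  have a2 : ‖ξ‖ ^ (s₁ + s₂) ≤ (2 * δ) ^ (s₁ + s₂) * ‖η‖ ^ (s₁ + s₂) := by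
    rw [← Real.mul_rpow (by positivity) hη.le]
    exact Real.rpow_le_rpow hξ.le h4 h₁₂.le
  have a3 : ‖η‖ ^ s₂ ≤ 3 ^ |s₂| * ‖ξ - η‖ ^ s₂ := by
    rcases le_total 0 s₂ with h | h
    · rw [abs_of_nonneg h, ← Real.mul_rpow (by norm_num) hζ.le]
      exact Real.rpow_le_rpow hη.le h5 h
    · rw [abs_of_nonpos h]
      have : (3 * ‖η‖) ^ s₂ ≤ ‖ξ - η‖ ^ s₂ := Real.rpow_le_rpow_of_nonpos hζ h6 h
      rw [Real.mul_rpow (by norm_num) hη.le] at this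
      rw [Real.rpow_neg (by norm_num), ← div_eq_inv_mul, le_div_iff₀ (by positivity)]
      linarith
  rw [a1]
  calc _ ≤ ‖ξ‖ ^ (-1 / 2 : ℝ) * ((2 * δ) ^ (s₁ + s₂) * (‖η‖ ^ s₁ * (3 ^ |s₂| * ‖ξ - η‖ ^ s₂))) := by
        refine mul_le_mul_of_nonneg_left (a2.trans ?_) (by positivity)
        rw [Real.rpow_add hη]
        gcongr
    _ = _ := by ring

/-- The high-high-to-low region. -/
def hhlRegion : Set (E2 × E2) := {p | 2 * ‖p.1‖ ≤ phase p.1 p.2}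

theorem measurableSet_hhlRegion : MeasurableSet hhlRegion := by
  have := measurable_phase
  exact measurableSet_le (by fun_prop) (by fun_prop)

theorem exists_trilinear_bound {s₁ s₂ s₃ : ℝ} (hsum : s₁ + s₂ + s₃ = 1 / 2) (h₁₂ : 0 < s₁ + s₂) :
    ∃ C : ℝ≥0∞, C ≠ ∞ ∧ ∀ s : ℝ, |s| = 1 → ∀ (K : ℝ × E2 → ℝ≥0∞) (F G : E2 → ℝ≥0∞),
      Measurable K → Measurable F → Measurable G →
      ∫⁻ p in hhlRegion, K (s * phase p.1 p.2, p.1) * ENNReal.ofReal (‖p.1‖ ^ (-s₃)) *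
        (F p.2 * G (p.1 - p.2)) ≤
      C * (lnorm K * (lnorm (fun η => ENNReal.ofReal (‖η‖ ^ s₁) * F η) *
        lnorm (fun η => ENNReal.ofReal (‖η‖ ^ s₂) * G η))) := by
  have hr0 : (0 : ℝ) ≤ (1 / 2) ^ (s₁ + s₂) := by positivity
  have hr1 : ((1 / 2 : ℝ)) ^ (s₁ + s₂) < 1 := Real.rpow_lt_one (by norm_num) (by norm_num) h₁₂
  set D : ℕ → ℝ := fun j => 3 ^ |s₂| * (2 * (1 / 2) ^ j) ^ (s₁ + s₂) with hD
  have hD0 : ∀ j, 0 ≤ D j := fun j => by positivity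
  have hDs : Summable D := by
    have : D = fun j => 3 ^ |s₂| * 2 ^ (s₁ + s₂) * ((1 / 2 : ℝ) ^ (s₁ + s₂)) ^ j := by
      ext j
      rw [hD]
      simp only
      rw [Real.mul_rpow (by norm_num) (by positivity), ← Real.rpow_natCast, ← Real.rpow_natCast,
        ← Real.rpow_mul (by norm_num), ← Real.rpow_mul (by norm_num), mul_comm (j : ℝ), mul_assoc]
    rw [this]
    exact (summable_geometric_of_lt_one hr0 hr1).mul_left _
  refine ⟨(∑' j, ENNReal.ofReal (D j)) * 192, ENNReal.mul_ne_top ?_ (by simp), ?_⟩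
  · rw [← ENNReal.ofReal_tsum_of_nonneg hD0 hDs]
    exact ENNReal.ofReal_ne_top
  intro s hs K F G hK hF hG
  have hphase := measurable_phase
  set F' : E2 → ℝ≥0∞ := fun η => ENNReal.ofReal (‖η‖ ^ s₁) * F η with hF'
  set G' : E2 → ℝ≥0∞ := fun η => ENNReal.ofReal (‖η‖ ^ s₂) * G η with hG'
  have hF'm : Measurable F' := by fun_prop
  have hG'm : Measurable G' := by fun_prop
  set Φ : E2 × E2 → ℝ≥0∞ := fun p => K (s * phase p.1 p.2, p.1) *
    ENNReal.ofReal (‖p.1‖ ^ (-s₃)) * (F p.2 * G (p.1 - p.2)) with hΦ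
  have hae : ∀ᵐ p : E2 × E2, p.1 ≠ 0 := by
    have : ∀ᵐ x : E2, x ≠ 0 := by simp [ae_iff]
    exact Measure.quasiMeasurePreserving_fst.ae this
  calc _ ≤ ∫⁻ p in ⋃ j : ℕ, ratioRegion ((1 / 2) ^ j), Φ p := by
        refine lintegral_mono' (Measure.restrict_mono_ae ?_) le_rfl
        filter_upwards [hae] with p hp hmem
        exact Set.mem_iUnion.2 (exists_mem_ratioRegion hp hmem)
    _ ≤ ∑' j : ℕ, ∫⁻ p in ratioRegion ((1 / 2) ^ j), Φ p := lintegral_iUnion_le _ _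
    _ ≤ ∑' j : ℕ, ENNReal.ofReal (D j) * (192 * (lnorm K * (lnorm F' * lnorm G'))) := by
        refine ENNReal.tsum_le_tsum fun j => ?_
        refine le_trans ?_ (mul_le_mul_right (lintegral_ratioRegion_le hs
          (δ := (1 / 2) ^ j) (by positivity) hK hF'm hG'm) _)
        rw [← lintegral_const_mul' _ _ ENNReal.ofReal_ne_top]
        refine setLIntegral_mono' (measurableSet_ratioRegion _) fun p hp => ?_
        have h : ENNReal.ofReal (‖p.1‖ ^ (-s₃)) ≤ ENNReal.ofReal (D j) *
            ENNReal.ofReal (‖p.1‖ ^ (-1 / 2 : ℝ)) *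
            (ENNReal.ofReal (‖p.2‖ ^ s₁) * ENNReal.ofReal (‖p.1 - p.2‖ ^ s₂)) := by
          rw [← ENNReal.ofReal_mul (hD0 j), ← ENNReal.ofReal_mul (by positivity),
            ← ENNReal.ofReal_mul (mul_nonneg (hD0 j) (by positivity))]
          exact ENNReal.ofReal_le_ofReal (rpow_weight_le hsum h₁₂ (by positivity) hp)
        rw [hΦ, hF', hG']
        simp only
        refine (mul_le_mul_left (mul_le_mul_right h _) _).trans (le_of_eq ?_)
        ring
    _ = _ := by rw [ENNReal.tsum_mul_right, mul_assoc]

theorem isAddHaarMeasure_volume_spaceTime : (volume : Measure SpaceTime).IsAddHaarMeasure :=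
  Measure.prod.instIsAddHaarMeasure volume volume

theorem lnorm_convolution_le {K Γ : SpaceTime → ℝ≥0∞} (hK : Measurable K) (hΓ : Measurable Γ) :
    lnorm (fun y => ∫⁻ z, K z * Γ (z - y)) ≤ (∫⁻ z, Γ z) * lnorm K := by
  set M := ∫⁻ z, Γ z with hM
  have := isAddHaarMeasure_volume_spaceTime
  have hsub : ∀ y : SpaceTime, ∫⁻ z, Γ (z - y) = M := fun y => lintegral_sub_right_eq_self Γ y
  have hsub' : ∀ z : SpaceTime, ∫⁻ y, Γ (z - y) = M := fun z => lintegral_sub_left_eq_self Γ z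
  have key : ∫⁻ y, (∫⁻ z, K z * Γ (z - y)) ^ 2 ≤ M ^ 2 * ∫⁻ z, K z ^ 2 := by
    calc ∫⁻ y, (∫⁻ z, K z * Γ (z - y)) ^ 2
        ≤ ∫⁻ y, M * ∫⁻ z, K z ^ 2 * Γ (z - y) := by
          refine lintegral_mono fun y => ?_
          have h := lintegral_mul_le_rpow_half (μ := volume)
            (f := fun z => K z * Γ (z - y) ^ (1 / 2 : ℝ)) (g := fun z => Γ (z - y) ^ (1 / 2 : ℝ))
            (by fun_prop) (by fun_prop)
          have e : ∀ x : ℝ≥0∞, x ^ (1 / 2 : ℝ) * x ^ (1 / 2 : ℝ) = x := fun x => by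
            rw [← sq, ENNReal.rpow_half_sq]
          simp only [mul_assoc, e, mul_pow, ENNReal.rpow_half_sq, hsub] at h
          calc _ ≤ ((∫⁻ z, K z ^ 2 * Γ (z - y)) ^ (1 / 2 : ℝ) * M ^ (1 / 2 : ℝ)) ^ 2 := by gcongr
            _ = _ := by rw [mul_pow, ENNReal.rpow_half_sq, ENNReal.rpow_half_sq, mul_comm]
      _ = M * ∫⁻ y, ∫⁻ z, K z ^ 2 * Γ (z - y) := by
          rw [lintegral_const_mul]
          exact Measurable.lintegral_prod_right' (f := fun p : SpaceTime × SpaceTime =>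
            K p.2 ^ 2 * Γ (p.2 - p.1)) (by fun_prop)
      _ = M * ∫⁻ z, ∫⁻ y, K z ^ 2 * Γ (z - y) := by
          rw [lintegral_lintegral_swap (f := fun y z => K z ^ 2 * Γ (z - y))]
          exact Measurable.aemeasurable (f := fun p : SpaceTime × SpaceTime =>
            K p.2 ^ 2 * Γ (p.2 - p.1)) (by fun_prop)
      _ = M * ∫⁻ z, K z ^ 2 * M := by
          congr 1
          refine lintegral_congr fun z => ?_
          rw [lintegral_const_mul _ (by fun_prop), hsub']
      _ = _ := by rw [lintegral_mul_const _ (by fun_prop)]; ring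
  unfold lnorm
  calc _ ≤ (M ^ 2 * ∫⁻ z, K z ^ 2) ^ (1 / 2 : ℝ) := ENNReal.rpow_le_rpow key (by norm_num)
    _ = _ := by
      rw [ENNReal.mul_rpow_of_nonneg _ _ (by norm_num), ← ENNReal.rpow_natCast, ← ENNReal.rpow_mul]
      norm_num

theorem lintegral_kernel_le {Q : Type*} [MeasureSpace Q] [SFinite (volume : Measure Q)]
    {w : Q → ℝ≥0∞} {P : Q → SpaceTime} {Γ : SpaceTime → ℝ≥0∞} {A B : ℝ≥0∞} (hw : Measurable w)
    (hP : Measurable P) (hΓ : Measurable Γ) (hwi : ∫⁻ q, w q ≠ ∞) (hΓi : ∫⁻ z, Γ z ≠ ∞)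
    (hB : B ≠ ∞) (hΓB : ∀ z, Γ z ≤ B)
    (hA : ∀ K : SpaceTime → ℝ≥0∞, Measurable K → ∫⁻ q, w q * K (P q) ≤ A * lnorm K) :
    ∫⁻ q, w q * ∫⁻ q', w q' * Γ (P q - P q') ≤ A ^ 2 * ∫⁻ z, Γ z := by
  set M := ∫⁻ z, Γ z with hM
  have := isAddHaarMeasure_volume_spaceTime
  set K : SpaceTime → ℝ≥0∞ := fun z => ∫⁻ q', w q' * Γ (z - P q') with hK
  have hKm : Measurable K := Measurable.lintegral_prod_right' (f := fun p : SpaceTime × Q =>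
    w p.2 * Γ (p.1 - P p.2)) (by fun_prop)
  have hKw : ∀ h : SpaceTime → ℝ≥0∞, Measurable h →
      ∫⁻ z, h z * K z = ∫⁻ q, w q * ∫⁻ z, h z * Γ (z - P q) := by
    intro h hh
    calc ∫⁻ z, h z * K z = ∫⁻ z, ∫⁻ q, h z * (w q * Γ (z - P q)) := by
          refine lintegral_congr fun z => ?_
          rw [lintegral_const_mul _ (by fun_prop)]
      _ = ∫⁻ q, ∫⁻ z, h z * (w q * Γ (z - P q)) := by
          rw [lintegral_lintegral_swap (f := fun z q => h z * (w q * Γ (z - P q)))]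
          exact Measurable.aemeasurable (f := fun p : SpaceTime × Q =>
            h p.1 * (w p.2 * Γ (p.1 - P p.2))) (by fun_prop)
      _ = _ := by
          refine lintegral_congr fun q => ?_
          rw [← lintegral_const_mul _ (by fun_prop)]
          exact lintegral_congr fun z => by ring
  have hK1 : ∫⁻ z, K z = (∫⁻ q, w q) * M := by
    have := hKw (fun _ => 1) measurable_const
    simp only [one_mul, lintegral_sub_right_eq_self] at this
    rw [this, lintegral_mul_const _ hw]
  have hKB : ∀ z, K z ≤ (∫⁻ q, w q) * B := fun z => by
    rw [← lintegral_mul_const _ hw]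
    exact lintegral_mono fun q => mul_le_mul_right (hΓB _) _
  have hKfin : ∫⁻ z, K z ^ 2 ≠ ∞ := by
    refine ne_top_of_le_ne_top (b := ((∫⁻ q, w q) * B) * ((∫⁻ q, w q) * M)) ?_ ?_
    · exact ENNReal.mul_ne_top (ENNReal.mul_ne_top hwi hB) (ENNReal.mul_ne_top hwi hΓi)
    · rw [← hK1, ← lintegral_const_mul _ hKm]
      refine lintegral_mono fun z => ?_
      simp only [sq]
      exact mul_le_mul_left (hKB z) _
  have hln : lnorm K ≠ ∞ := ENNReal.rpow_ne_top_of_nonneg (by norm_num) hKfin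
  have hsq : lnorm K * lnorm K ≤ (A * M) * lnorm K := by
    rw [← sq, lnorm_sq]
    calc ∫⁻ z, K z ^ 2 = ∫⁻ z, K z * K z := by simp only [sq]
      _ = ∫⁻ q, w q * ∫⁻ z, K z * Γ (z - P q) := hKw K hKm
      _ ≤ A * lnorm (fun y => ∫⁻ z, K z * Γ (z - y)) := by
        refine hA (fun y => ∫⁻ z, K z * Γ (z - y)) ?_
        exact Measurable.lintegral_prod_right' (f := fun p : SpaceTime × SpaceTime =>
          K p.2 * Γ (p.2 - p.1)) (by fun_prop)
      _ ≤ A * (M * lnorm K) := mul_le_mul_right (lnorm_convolution_le hKm hΓ) _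
      _ = _ := by ring
  have hKA : lnorm K ≤ A * M := by
    rcases eq_or_ne (lnorm K) 0 with h0 | h0
    · rw [h0]; exact zero_le
    · exact (ENNReal.mul_le_mul_iff_left h0 hln).1 hsq
  calc _ ≤ A * lnorm K := hA K hKm
    _ ≤ A * (A * M) := mul_le_mul_right hKA _
    _ = _ := by ring

section GaussianKernel

variable {V : Type*} [NormedAddCommGroup V] [InnerProductSpace ℝ V]

/-- The integral of `v ↦ exp (-ε ‖v‖ ^ 2 + i ⟪w, v⟫)`. -/
def gaussKernel (ε : ℝ) (w : V) : ℝ :=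
  (Real.pi / ε) ^ (Module.finrank ℝ V / 2 : ℝ) * Real.exp (-(1 / (4 * ε)) * ‖w‖ ^ 2)

theorem gaussKernel_nonneg {ε : ℝ} (hε : 0 < ε) (w : V) : 0 ≤ gaussKernel ε w := by
  have := Real.pi_pos
  unfold gaussKernel
  positivity

theorem gaussKernel_le {ε : ℝ} (hε : 0 < ε) (w : V) : gaussKernel ε w ≤ gaussKernel ε (0 : V) := by
  have := Real.pi_pos
  unfold gaussKernel
  refine mul_le_mul_of_nonneg_left (Real.exp_le_exp.2 ?_) (by positivity)
  have : 0 ≤ 1 / (4 * ε) * ‖w‖ ^ 2 := by positivity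
  simp only [norm_zero]
  linarith

@[fun_prop]
theorem continuous_gaussKernel (ε : ℝ) : Continuous (gaussKernel ε : V → ℝ) := by
  unfold gaussKernel
  fun_prop

variable [FiniteDimensional ℝ V] [MeasurableSpace V] [BorelSpace V]

theorem integral_cexp_eq_gaussKernel {ε : ℝ} (hε : 0 < ε) (w : V) :
    ∫ v : V, cexp (I * (⟪v, w⟫ : ℝ)) * (Real.exp (-ε * ‖v‖ ^ 2) : ℝ) = (gaussKernel ε w : ℝ) := by
  have h := GaussianFourier.integral_cexp_neg_mul_sq_norm_add (V := V) (b := (ε : ℂ))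
    (by simpa using hε) I w
  have e : ∀ v : V, cexp (I * (⟪v, w⟫ : ℝ)) * (Real.exp (-ε * ‖v‖ ^ 2) : ℝ) =
      cexp (-(ε : ℂ) * ‖v‖ ^ 2 + I * ⟪w, v⟫) := fun v => by
    rw [ofReal_exp, ← Complex.exp_add, real_inner_comm]
    push_cast
    ring_nf
  simp_rw [e]
  rw [h, gaussKernel, ofReal_mul, ofReal_cpow (by have := Real.pi_pos; positivity), ofReal_exp]
  push_cast
  rw [I_sq]
  ring_nf

theorem integrable_gauss {ε : ℝ} (hε : 0 < ε) :
    Integrable fun v : V => Real.exp (-ε * ‖v‖ ^ 2) := by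
  have h := (GaussianFourier.integrable_cexp_neg_mul_sq_norm_add (V := V) (b := (ε : ℂ))
    (by simpa using hε) 0 0).norm
  refine h.congr (ae_of_all _ fun v => ?_)
  simp only [Complex.norm_exp]
  congr 1
  norm_cast
  simp

theorem lintegral_gaussKernel {ε : ℝ} (hε : 0 < ε) :
    ∫⁻ w : V, ENNReal.ofReal (gaussKernel ε w) =
      ENNReal.ofReal ((2 * Real.pi) ^ Module.finrank ℝ V) := by
  have hpi := Real.pi_pos
  have h4 : 0 < 1 / (4 * ε) := by positivity
  have hi : Integrable (gaussKernel ε : V → ℝ) := (integrable_gauss h4).const_mul _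
  rw [← ofReal_integral_eq_lintegral_ofReal hi
    (ae_of_all _ (gaussKernel_nonneg hε))]
  congr 1
  unfold gaussKernel
  rw [integral_const_mul, GaussianFourier.integral_rexp_neg_mul_sq_norm h4,
    ← Real.mul_rpow (by positivity) (by positivity), ← Real.rpow_natCast]
  have : Real.pi / ε * (Real.pi / (1 / (4 * ε))) = (2 * Real.pi) ^ (2 : ℝ) := by
    rw [Real.rpow_two]
    field_simp
    norm_num
  rw [this, ← Real.rpow_mul (by positivity)]
  congr 1
  ring

end GaussianKernel

/-- The pairing of `z` and `ζ` in space-time. -/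
def stPair (z ζ : SpaceTime) : ℝ := z.1 * ζ.1 + ⟪z.2, ζ.2⟫

@[fun_prop]
theorem measurable_stPair {α : Type*} [MeasurableSpace α] {f g : α → SpaceTime}
    (hf : Measurable f) (hg : Measurable g) : Measurable fun a => stPair (f a) (g a) := by
  unfold stPair
  fun_prop

theorem stPair_sub (z ζ ζ' : SpaceTime) : stPair z (ζ - ζ') = stPair z ζ - stPair z ζ' := by
  simp only [stPair, Prod.fst_sub, Prod.snd_sub, inner_sub_right]
  ring

/-- The Gaussian weight `exp (-ε (t ^ 2 + ‖x‖ ^ 2))`. -/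
def stGauss (ε : ℝ) (z : SpaceTime) : ℝ := Real.exp (-ε * ‖z.1‖ ^ 2) * Real.exp (-ε * ‖z.2‖ ^ 2)

/-- The space-time Gaussian kernel. -/
def stKernel (ε : ℝ) (ζ : SpaceTime) : ℝ := gaussKernel ε ζ.1 * gaussKernel ε ζ.2

theorem measurable_stGauss (ε : ℝ) : Measurable (stGauss ε) := by
  unfold stGauss
  fun_prop

theorem measurable_stKernel (ε : ℝ) : Measurable (stKernel ε) := by
  unfold stKernel
  fun_prop

theorem stGauss_nonneg (ε : ℝ) (z : SpaceTime) : 0 ≤ stGauss ε z := by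
  unfold stGauss
  positivity

theorem stKernel_nonneg {ε : ℝ} (hε : 0 < ε) (z : SpaceTime) : 0 ≤ stKernel ε z :=
  mul_nonneg (gaussKernel_nonneg hε _) (gaussKernel_nonneg hε _)

theorem stKernel_le {ε : ℝ} (hε : 0 < ε) (z : SpaceTime) : stKernel ε z ≤ stKernel ε 0 :=
  mul_le_mul (gaussKernel_le hε _) (gaussKernel_le hε _) (gaussKernel_nonneg hε _)
    (gaussKernel_nonneg hε _)

theorem integrable_stGauss {ε : ℝ} (hε : 0 < ε) : Integrable (stGauss ε) :=
  (integrable_gauss (V := ℝ) hε).mul_prod (integrable_gauss (V := E2) hε)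

theorem integral_stGauss {ε : ℝ} (hε : 0 < ε) (ζ : SpaceTime) :
    ∫ z, cexp (I * (stPair z ζ : ℝ)) * (stGauss ε z : ℝ) = (stKernel ε ζ : ℝ) := by
  have h := integral_prod_mul (μ := (volume : Measure ℝ)) (ν := (volume : Measure E2))
    (fun t : ℝ => cexp (I * (⟪t, ζ.1⟫ : ℝ)) * (Real.exp (-ε * ‖t‖ ^ 2) : ℝ))
    (fun x : E2 => cexp (I * (⟪x, ζ.2⟫ : ℝ)) * (Real.exp (-ε * ‖x‖ ^ 2) : ℝ))
  rw [integral_cexp_eq_gaussKernel hε, integral_cexp_eq_gaussKernel hε] at h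
  rw [stKernel, ofReal_mul, ← h]
  refine integral_congr_ae (ae_of_all _ fun z => ?_)
  simp only [stPair, stGauss, ofReal_add, ofReal_mul, mul_add, Complex.exp_add]
  have : (⟪z.1, ζ.1⟫ : ℝ) = z.1 * ζ.1 := by simp [mul_comm]
  rw [this]
  push_cast
  ring

theorem lintegral_stKernel {ε : ℝ} (hε : 0 < ε) :
    ∫⁻ ζ, ENNReal.ofReal (stKernel ε ζ) = ENNReal.ofReal ((2 * Real.pi) ^ 3) := by
  have hpi := Real.pi_pos
  have h := lintegral_prod_mul (μ := (volume : Measure ℝ)) (ν := (volume : Measure E2))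
    (f := fun t => ENNReal.ofReal (gaussKernel ε t)) (g := fun x => ENNReal.ofReal (gaussKernel ε x))
    (by fun_prop) (by fun_prop)
  rw [lintegral_gaussKernel hε, lintegral_gaussKernel hε, ← ENNReal.ofReal_mul (by positivity)] at h
  simp only [Module.finrank_self, finrank_euclideanSpace, Fintype.card_fin] at h
  rw [show (2 * Real.pi) ^ 3 = (2 * Real.pi) ^ 1 * (2 * Real.pi) ^ 2 by ring, ← h]
  refine lintegral_congr fun ζ => ?_
  rw [stKernel, ENNReal.ofReal_mul (gaussKernel_nonneg hε _)]

section Extension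

variable {Q : Type*} [MeasureSpace Q] [SFinite (volume : Measure Q)]

/-- The extension operator `z ↦ ∫ a(q) e^{i z · P(q)} dq`. -/
def extOp (P : Q → SpaceTime) (a : Q → ℂ) (z : SpaceTime) : ℂ :=
  ∫ q, cexp (I * (stPair z (P q) : ℝ)) * a q

theorem measurable_extOp {P : Q → SpaceTime} {a : Q → ℂ} (hP : Measurable P) (ha : Measurable a) :
    Measurable (extOp P a) := by
  have : Measurable fun p : SpaceTime × Q => cexp (I * (stPair p.1 (P p.2) : ℝ)) * a p.2 := by
    fun_prop
  exact this.stronglyMeasurable.integral_prod_right'.measurable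

theorem norm_cexp_I_mul_ofReal (x : ℝ) : ‖cexp (I * (x : ℝ))‖ = 1 := by
  rw [mul_comm]
  exact norm_exp_ofReal_mul_I x

theorem extOp_mul_conj {P : Q → SpaceTime} {a : Q → ℂ} (hP : Measurable P) (ha : Measurable a)
    (hai : Integrable a) {ε : ℝ} (hε : 0 < ε) :
    ∫ z, (stGauss ε z : ℂ) * (extOp P a z * starRingEnd ℂ (extOp P a z)) =
      ∫ p : Q × Q, a p.1 * starRingEnd ℂ (a p.2) * (stKernel ε (P p.1 - P p.2) : ℝ) := by
  have hm := measurable_stGauss ε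
  have e1 : ∀ z, extOp P a z * starRingEnd ℂ (extOp P a z) =
      ∫ p : Q × Q, cexp (I * (stPair z (P p.1 - P p.2) : ℝ)) *
        (a p.1 * starRingEnd ℂ (a p.2)) := by
    intro z
    rw [extOp, ← integral_conj]
    have := integral_prod_mul (μ := (volume : Measure Q)) (ν := (volume : Measure Q))
      (fun q => cexp (I * (stPair z (P q) : ℝ)) * a q)
      (fun q => starRingEnd ℂ (cexp (I * (stPair z (P q) : ℝ)) * a q))
    rw [← this]
    refine integral_congr_ae (ae_of_all _ fun p => ?_)
    simp only [map_mul, ← Complex.exp_conj, conj_I, conj_ofReal, stPair_sub, ofReal_sub, mul_sub,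
      Complex.exp_sub, neg_mul, Complex.exp_neg]
    ring
  have haa : Integrable fun p : Q × Q => a p.1 * starRingEnd ℂ (a p.2) :=
    hai.mul_prod (conjLIE.integrable_comp_iff.2 hai)
  have hint : Integrable (Function.uncurry fun (z : SpaceTime) (p : Q × Q) => (stGauss ε z : ℂ) *
      (cexp (I * (stPair z (P p.1 - P p.2) : ℝ)) * (a p.1 * starRingEnd ℂ (a p.2))))
      ((volume : Measure SpaceTime).prod (volume : Measure (Q × Q))) := by
    refine Integrable.mono ((integrable_stGauss hε).ofReal (𝕜 := ℂ) |>.mul_prod haa) ?_ ?_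
    · refine Measurable.aestronglyMeasurable ?_
      simp only [Function.uncurry_def]
      fun_prop
    · refine ae_of_all _ fun p => ?_
      simp only [Function.uncurry_def, norm_mul, norm_cexp_I_mul_ofReal, one_mul]
      rfl
  simp_rw [e1, ← integral_const_mul]
  rw [integral_integral_swap hint]
  refine integral_congr_ae (ae_of_all _ fun p => ?_)
  simp only
  rw [← integral_stGauss hε, ← integral_const_mul]
  refine integral_congr_ae (ae_of_all _ fun z => ?_)
  ring

theorem lintegral_stGauss_mul_extOp_le {P : Q → SpaceTime} {a : Q → ℂ} (hP : Measurable P)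
    (ha : Measurable a) (hai : Integrable a) {ε : ℝ} (hε : 0 < ε) {A : ℝ≥0∞}
    (hA : ∀ K : SpaceTime → ℝ≥0∞, Measurable K → ∫⁻ q, ‖a q‖ₑ * K (P q) ≤ A * lnorm K) :
    ∫⁻ z, ENNReal.ofReal (stGauss ε z) * ‖extOp P a z‖ₑ ^ 2 ≤
      A ^ 2 * ENNReal.ofReal ((2 * Real.pi) ^ 3) := by
  have hE := measurable_extOp hP ha
  have hm := measurable_stGauss ε
  have hk := measurable_stKernel ε
  have hker := lintegral_kernel_le (w := fun q => ‖a q‖ₑ) (P := P)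
    (Γ := fun ζ => ENNReal.ofReal (stKernel ε ζ)) (A := A) (B := ENNReal.ofReal (stKernel ε 0))
    (by fun_prop) hP (by fun_prop) hai.2.ne (by rw [lintegral_stKernel hε]; simp) (by simp)
    (fun z => ENNReal.ofReal_le_ofReal (stKernel_le hε z)) hA
  rw [lintegral_stKernel hε] at hker
  have hbd : ∀ z, ‖extOp P a z‖ ≤ ∫ q, ‖a q‖ := fun z => by
    refine (norm_integral_le_integral_norm _).trans (le_of_eq ?_)
    simp only [norm_mul, norm_cexp_I_mul_ofReal, one_mul]
  have hint : Integrable fun z => stGauss ε z * ‖extOp P a z‖ ^ 2 := by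
    refine (integrable_stGauss hε).mul_bdd (c := (∫ q, ‖a q‖) ^ 2) (by fun_prop)
      (ae_of_all _ fun z => ?_)
    rw [norm_pow, norm_norm]
    exact pow_le_pow_left₀ (norm_nonneg _) (hbd z) 2
  have hL : ∫⁻ z, ENNReal.ofReal (stGauss ε z) * ‖extOp P a z‖ₑ ^ 2 =
      ENNReal.ofReal (∫ z, stGauss ε z * ‖extOp P a z‖ ^ 2) := by
    rw [ofReal_integral_eq_lintegral_ofReal hint
      (ae_of_all _ fun z => mul_nonneg (stGauss_nonneg ε z) (by positivity))]
    refine lintegral_congr fun z => ?_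
    rw [ENNReal.ofReal_mul (stGauss_nonneg ε z), ENNReal.ofReal_pow (norm_nonneg _),
      ofReal_norm]
  have hC : ((∫ z, stGauss ε z * ‖extOp P a z‖ ^ 2 : ℝ) : ℂ) =
      ∫ p : Q × Q, a p.1 * starRingEnd ℂ (a p.2) * (stKernel ε (P p.1 - P p.2) : ℝ) := by
    rw [← extOp_mul_conj hP ha hai hε, ← integral_complex_ofReal]
    refine integral_congr_ae (ae_of_all _ fun z => ?_)
    simp only
    rw [mul_conj, normSq_eq_norm_sq]
    push_cast
    rfl
  rw [hL]
  calc _ ≤ ENNReal.ofReal ‖(∫ z, stGauss ε z * ‖extOp P a z‖ ^ 2 : ℝ)‖ :=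
        ENNReal.ofReal_le_ofReal (le_abs_self _)
    _ = ‖∫ p : Q × Q, a p.1 * starRingEnd ℂ (a p.2) * (stKernel ε (P p.1 - P p.2) : ℝ)‖ₑ := by
        rw [← hC, ← ofReal_norm, norm_real]
    _ ≤ ∫⁻ p : Q × Q, ‖a p.1 * starRingEnd ℂ (a p.2) * (stKernel ε (P p.1 - P p.2) : ℝ)‖ₑ :=
        enorm_integral_le_lintegral_enorm _
    _ = ∫⁻ p : Q × Q, ‖a p.1‖ₑ * (‖a p.2‖ₑ * ENNReal.ofReal (stKernel ε (P p.1 - P p.2))) := by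
        refine lintegral_congr fun p => ?_
        rw [enorm_mul, enorm_mul, RCLike.enorm_conj, mul_assoc, ← ofReal_norm (ofReal _),
          norm_real, Real.norm_of_nonneg (stKernel_nonneg hε _)]
    _ ≤ ∫⁻ q, ∫⁻ q', ‖a q‖ₑ * (‖a q'‖ₑ * ENNReal.ofReal (stKernel ε (P q - P q'))) :=
        lintegral_prod_le _
    _ = ∫⁻ q, ‖a q‖ₑ * ∫⁻ q', ‖a q'‖ₑ * ENNReal.ofReal (stKernel ε (P q - P q')) := by
        refine lintegral_congr fun q => ?_
        rw [lintegral_const_mul _ (by fun_prop)]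
    _ ≤ _ := hker

theorem lintegral_extOp_sq_le {P : Q → SpaceTime} {a : Q → ℂ} (hP : Measurable P)
    (ha : Measurable a) (hai : Integrable a) {A : ℝ≥0∞}
    (hA : ∀ K : SpaceTime → ℝ≥0∞, Measurable K → ∫⁻ q, ‖a q‖ₑ * K (P q) ≤ A * lnorm K) :
    ∫⁻ z, ‖extOp P a z‖ₑ ^ 2 ≤ A ^ 2 * ENNReal.ofReal ((2 * Real.pi) ^ 3) := by
  have hE := measurable_extOp hP ha
  have hm := measurable_stGauss
  have hlim : ∀ z, Filter.Tendsto (fun n : ℕ => ENNReal.ofReal (stGauss (1 / ((n : ℝ) + 1)) z) *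
      ‖extOp P a z‖ₑ ^ 2) Filter.atTop (nhds (‖extOp P a z‖ₑ ^ 2)) := by
    intro z
    have hg : Filter.Tendsto (fun n : ℕ => stGauss (1 / ((n : ℝ) + 1)) z) Filter.atTop
        (nhds 1) := by
      have hc : Continuous fun ε : ℝ => stGauss ε z := by
        unfold stGauss
        fun_prop
      have := (hc.tendsto 0).comp tendsto_one_div_add_atTop_nhds_zero_nat
      simpa [stGauss, Function.comp_def] using this
    have := ENNReal.Tendsto.mul_const (b := ‖extOp P a z‖ₑ ^ 2) (ENNReal.tendsto_ofReal hg)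
      (Or.inl (by simp))
    simpa using this
  calc _ = ∫⁻ z, Filter.liminf (fun n : ℕ => ENNReal.ofReal (stGauss (1 / ((n : ℝ) + 1)) z) *
      ‖extOp P a z‖ₑ ^ 2) Filter.atTop := lintegral_congr fun z => (hlim z).liminf_eq.symm
    _ ≤ Filter.liminf (fun n : ℕ => ∫⁻ z, ENNReal.ofReal (stGauss (1 / ((n : ℝ) + 1)) z) *
      ‖extOp P a z‖ₑ ^ 2) Filter.atTop := lintegral_liminf_le fun n => by
        have := hm (1 / ((n : ℝ) + 1))
        fun_prop
    _ ≤ _ := by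
        refine Filter.liminf_le_of_le (by isBoundedDefault) fun b hb => ?_
        obtain ⟨n, hn⟩ := hb.exists
        exact hn.trans (lintegral_stGauss_mul_extOp_le hP ha hai (by positivity) hA)

end Extension

open scoped FourierTransform in
theorem ftX_eq_fourier (f : E2 → ℂ) (ξ : E2) : ftX f ξ = 𝓕 f ((2 * Real.pi)⁻¹ • ξ) := by
  rw [Real.fourier_eq', ftX]
  refine integral_congr_ae (ae_of_all _ fun x => ?_)
  have hpi : (Real.pi : ℂ) ≠ 0 := by exact_mod_cast Real.pi_ne_zero
  simp only [inner_smul_right, smul_eq_mul]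
  congr 2
  push_cast
  field_simp

@[fun_prop]
theorem continuous_ftX_schwartz (f : SchwartzMap E2 ℂ) : Continuous (ftX fun y => f y) := by
  have : (ftX fun y => f y) =
      fun ξ => (FourierTransform.fourier f) ((2 * Real.pi)⁻¹ • ξ) := by
    ext ξ
    rw [ftX_eq_fourier, SchwartzMap.fourier_coe]
  rw [this]
  exact (FourierTransform.fourier f).continuous.comp (by fun_prop)

theorem exists_ftX_schwartz_decay (f : SchwartzMap E2 ℂ) (k : ℕ) :
    ∃ C : ℝ, 0 ≤ C ∧ ∀ ξ, (1 + ‖ξ‖) ^ k * ‖ftX (fun y => f y) ξ‖ ≤ C := by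
  have hpi := Real.pi_gt_three
  set D := 2 ^ k * (Finset.Iic (k, 0)).sup (fun m => SchwartzMap.seminorm ℝ m.1 m.2)
    (FourierTransform.fourier f) with hD
  have hbound : ∀ ζ, (1 + ‖ζ‖) ^ k * ‖FourierTransform.fourier f ζ‖ ≤ D := fun ζ => by
    have := SchwartzMap.one_add_le_sup_seminorm_apply (𝕜 := ℝ) (m := (k, 0)) (k := k) (n := 0)
      le_rfl le_rfl (FourierTransform.fourier f) ζ
    simpa using this
  refine ⟨(2 * Real.pi) ^ k * D, ?_, fun ξ => ?_⟩
  · have : 0 ≤ D := le_trans (by positivity) (hbound 0)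
    positivity
  · rw [ftX_eq_fourier, ← SchwartzMap.fourier_coe]
    set ζ := (2 * Real.pi)⁻¹ • ξ with hζ
    have hn : 1 + ‖ξ‖ ≤ 2 * Real.pi * (1 + ‖ζ‖) := by
      rw [hζ, norm_smul, norm_inv, Real.norm_of_nonneg (by positivity), mul_add,
        mul_inv_cancel_left₀ (by positivity)]
      linarith
    calc _ ≤ (2 * Real.pi * (1 + ‖ζ‖)) ^ k * ‖FourierTransform.fourier f ζ‖ := by gcongr
      _ = (2 * Real.pi) ^ k * ((1 + ‖ζ‖) ^ k * ‖FourierTransform.fourier f ζ‖) := by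
        rw [mul_pow, mul_assoc]
      _ ≤ _ := by
        have := hbound ζ
        gcongr

theorem integrable_one_add_norm_rpow_neg_four : Integrable fun ξ : E2 => (1 + ‖ξ‖) ^ (-4 : ℝ) :=
  integrable_one_add_norm (by simp; norm_num)

theorem integrable_norm_rpow_mul : Integrable fun ξ : E2 =>
    ‖ξ‖ ^ (-5 / 4 : ℝ) * (1 + ‖ξ‖) ^ (-4 : ℝ) := by
  rw [integrable_fun_norm_addHaar volume (E := E2)
    (f := fun y : ℝ => y ^ (-5 / 4 : ℝ) * (1 + y) ^ (-4 : ℝ))]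
  have hset : Set.Ioi (0 : ℝ) = Set.Ioc 0 1 ∪ Set.Ioi 1 := by
    rw [Set.Ioc_union_Ioi_eq_Ioi zero_le_one]
  have hsimp : ∀ y : ℝ, 0 < y → y * (y ^ (-5 / 4 : ℝ) * (1 + y) ^ (-4 : ℝ)) =
      y ^ (-1 / 4 : ℝ) * (1 + y) ^ (-4 : ℝ) := fun y hy => by
    rw [← mul_assoc]
    congr 1
    nth_rewrite 1 [← Real.rpow_one y]
    rw [← Real.rpow_add hy]
    norm_num
  simp only [finrank_euclideanSpace, Fintype.card_fin, Nat.add_one_sub_one, pow_one, smul_eq_mul]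
  rw [hset]
  refine IntegrableOn.union ?_ ?_
  · have h : IntegrableOn (fun y : ℝ => y ^ (-1 / 4 : ℝ)) (Set.Ioc 0 1) :=
      (intervalIntegrable_iff_integrableOn_Ioc_of_le zero_le_one).1
        (intervalIntegral.intervalIntegrable_rpow' (by norm_num))
    refine Integrable.mono' h (Measurable.aestronglyMeasurable (by fun_prop)) ?_
    filter_upwards [ae_restrict_mem measurableSet_Ioc] with y hy
    have hy0 : 0 < y := hy.1
    rw [hsimp y hy0, Real.norm_of_nonneg (by positivity)]
    exact mul_le_of_le_one_right (by positivity)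
      (Real.rpow_le_one_of_one_le_of_nonpos (by linarith) (by norm_num))
  · have h : IntegrableOn (fun y : ℝ => y ^ (-4 : ℝ)) (Set.Ioi 1) :=
      integrableOn_Ioi_rpow_of_lt (by norm_num) one_pos
    refine Integrable.mono' h (Measurable.aestronglyMeasurable (by fun_prop)) ?_
    filter_upwards [ae_restrict_mem measurableSet_Ioi] with y hy
    have hy1 : 1 < y := hy
    have hy0 : 0 < y := by linarith
    rw [hsimp y hy0, Real.norm_of_nonneg (by positivity)]
    refine (mul_le_of_le_one_left (by positivity)
      (Real.rpow_le_one_of_one_le_of_nonpos hy1.le (by norm_num))).trans ?_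
    exact Real.rpow_le_rpow_of_nonpos hy0 (by linarith) (by norm_num)

theorem rpow_two_mul_le {σ : ℝ} (hσ : -(5 / 8) < σ) (hσ' : σ < 5 / 8) {r : ℝ} (hr : 0 ≤ r) :
    (r ^ σ) ^ 2 ≤ (r ^ (-5 / 4 : ℝ) + 1) * (1 + r) ^ 2 := by
  have h0 : 0 ≤ r ^ (-5 / 4 : ℝ) := by positivity
  have h2 : (r ^ (-5 / 4 : ℝ) + 1) * (1 + r ^ 2) ≤ (r ^ (-5 / 4 : ℝ) + 1) * (1 + r) ^ 2 := by
    gcongr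
    nlinarith
  refine le_trans ?_ h2
  rcases hr.eq_or_lt with rfl | hr0
  · have : ((0 : ℝ) ^ σ) ≤ 1 := Real.zero_rpow_le_one σ
    have h' : 0 ≤ (0 : ℝ) ^ σ := Real.zero_rpow_nonneg σ
    nlinarith
  rw [← Real.rpow_natCast (r ^ σ), ← Real.rpow_mul hr]
  rcases le_total r 1 with h1 | h1
  · have : r ^ (σ * (2 : ℕ)) ≤ r ^ (-5 / 4 : ℝ) :=
      Real.rpow_le_rpow_of_exponent_ge hr0 h1 (by push_cast; linarith)
    nlinarith
  · have : r ^ (σ * (2 : ℕ)) ≤ r ^ (2 : ℝ) :=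
      Real.rpow_le_rpow_of_exponent_le h1 (by push_cast; linarith)
    rw [Real.rpow_two] at this
    refine this.trans ?_
    nlinarith [mul_nonneg h0 (sq_nonneg r)]

theorem lnorm_ofReal_ne_top {α : Type*} [MeasureSpace α] {f : α → ℝ} (hf : ∀ x, 0 ≤ f x)
    (hi : Integrable fun x => f x ^ 2) : lnorm (fun x => ENNReal.ofReal (f x)) ≠ ∞ := by
  refine ENNReal.rpow_ne_top_of_nonneg (by norm_num) ?_
  have : ∀ x, ENNReal.ofReal (f x) ^ 2 = ENNReal.ofReal (f x ^ 2) := fun x =>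
    (ENNReal.ofReal_pow (hf x) 2).symm
  simp_rw [this]
  rw [← ofReal_integral_eq_lintegral_ofReal hi (ae_of_all _ fun x => by positivity)]
  exact ENNReal.ofReal_ne_top

theorem integrable_weighted_ftX_sq (f : SchwartzMap E2 ℂ) {σ : ℝ} (hσ : -(5 / 8) < σ)
    (hσ' : σ < 5 / 8) (k : ℕ) :
    Integrable fun ξ => (‖ξ‖ ^ σ * ((1 + ‖ξ‖) ^ k * ‖ftX (fun y => f y) ξ‖)) ^ 2 := by
  obtain ⟨C, hC0, hC⟩ := exists_ftX_schwartz_decay f (k + 3)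
  have hcont := continuous_ftX_schwartz f
  have hi := (integrable_norm_rpow_mul.add integrable_one_add_norm_rpow_neg_four).const_mul (C ^ 2)
  refine Integrable.mono' hi (Measurable.aestronglyMeasurable (by fun_prop))
    (ae_of_all _ fun ξ => ?_)
  rw [Real.norm_of_nonneg (by positivity)]
  simp only [Pi.add_apply]
  set r := ‖ξ‖ with hr
  have hr0 : 0 ≤ r := norm_nonneg ξ
  have hr1 : 0 < 1 + r := by linarith
  have h1 := rpow_two_mul_le hσ hσ' hr0
  have h2 : ((1 + r) ^ k * ‖ftX (fun y => f y) ξ‖) * (1 + r) ^ 3 ≤ C := by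
    calc _ = (1 + r) ^ (k + 3) * ‖ftX (fun y => f y) ξ‖ := by ring
      _ ≤ C := hC ξ
  have h3 : (((1 + r) ^ k * ‖ftX (fun y => f y) ξ‖) * (1 + r) ^ 3) ^ 2 ≤ C ^ 2 := by gcongr
  have h4 : (1 + r) ^ (-4 : ℝ) = (1 + r) ^ 2 * ((1 + r) ^ 6)⁻¹ := by
    rw [Real.rpow_neg hr1.le, show (4 : ℝ) = (4 : ℕ) by norm_num, Real.rpow_natCast]
    field_simp
  rw [← add_one_mul, h4, mul_pow]
  calc _ ≤ ((r ^ (-5 / 4 : ℝ) + 1) * (1 + r) ^ 2) *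
        ((1 + r) ^ k * ‖ftX (fun y => f y) ξ‖) ^ 2 := by gcongr
    _ = ((r ^ (-5 / 4 : ℝ) + 1) * (1 + r) ^ 2) * ((1 + r) ^ 6)⁻¹ *
        (((1 + r) ^ k * ‖ftX (fun y => f y) ξ‖) * (1 + r) ^ 3) ^ 2 := by
      field_simp
    _ ≤ ((r ^ (-5 / 4 : ℝ) + 1) * (1 + r) ^ 2) * ((1 + r) ^ 6)⁻¹ * C ^ 2 := by gcongr
    _ = _ := by ring

theorem ofReal_homSob (f : SchwartzMap E2 ℂ) {σ : ℝ} (hσ : -(5 / 8) < σ) (hσ' : σ < 5 / 8) :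
    ENNReal.ofReal (homSob σ fun y => f y) =
      lnorm fun η => ENNReal.ofReal (‖η‖ ^ σ) * ‖ftX (fun y => f y) η‖ₑ := by
  have hi := integrable_weighted_ftX_sq f hσ hσ' 0
  simp only [pow_zero, one_mul] at hi
  rw [homSob, Real.sqrt_eq_rpow, ← ENNReal.ofReal_rpow_of_nonneg
    (integral_nonneg fun _ => by positivity) (by norm_num),
    ofReal_integral_eq_lintegral_ofReal hi (ae_of_all _ fun _ => by positivity), lnorm]
  congr 1
  refine lintegral_congr fun ξ => ?_
  rw [ENNReal.ofReal_pow (by positivity), ENNReal.ofReal_mul (by positivity), ofReal_norm]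

theorem integrable_ftX_schwartz (f : SchwartzMap E2 ℂ) : Integrable (ftX fun y => f y) := by
  obtain ⟨C, hC0, hC⟩ := exists_ftX_schwartz_decay f 4
  refine Integrable.mono' (integrable_one_add_norm_rpow_neg_four.const_mul C)
    (continuous_ftX_schwartz f).aestronglyMeasurable (ae_of_all _ fun ξ => ?_)
  have hr1 : 0 < 1 + ‖ξ‖ := by positivity
  rw [Real.rpow_neg hr1.le, show (4 : ℝ) = (4 : ℕ) by norm_num, Real.rpow_natCast,
    ← div_eq_mul_inv, le_div_iff₀ (by positivity), mul_comm]
  exact hC ξ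

open scoped FourierTransform in
theorem halfWave_eq_fourierInv (s : ℝ) (f : E2 → ℂ) (t : ℝ) (x : E2) :
    halfWave s f t x = 𝓕⁻ (fun ζ : E2 => cexp (I * ((s * t * ‖(2 * Real.pi) • ζ‖ : ℝ) : ℂ)) *
      ftX f ((2 * Real.pi) • ζ)) x := by
  have hpi := Real.pi_pos
  rw [Real.fourierInv_eq', halfWave]
  have h := Measure.integral_comp_smul (volume : Measure E2)
    (fun ξ : E2 => cexp (I * ((s * t * ‖ξ‖ + ⟪x, ξ⟫ : ℝ) : ℂ)) * ftX f ξ) (2 * Real.pi)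
  have e : |((2 * Real.pi) ^ Module.finrank ℝ E2)⁻¹| = (2 * Real.pi) ^ (-2 : ℝ) := by
    rw [abs_of_nonneg (by positivity), Real.rpow_neg (by positivity), Real.rpow_two]
    simp
  rw [e] at h
  rw [← h]
  refine integral_congr_ae (ae_of_all _ fun ζ => ?_)
  simp only [smul_eq_mul]
  rw [← mul_assoc, ← Complex.exp_add, inner_smul_right, real_inner_comm]
  congr 2
  push_cast
  ring

theorem ftX_halfWave_of_integrable (s : ℝ) (f : SchwartzMap E2 ℂ) (t : ℝ)
    (hu : Integrable (halfWave s (fun y => f y) t)) (ξ : E2) :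
    ftX (halfWave s (fun y => f y) t) ξ =
      cexp (I * ((s * t * ‖ξ‖ : ℝ) : ℂ)) * ftX (fun y => f y) ξ := by
  open scoped FourierTransform in
  have hpi := Real.pi_pos
  set h : E2 → ℂ := fun ζ => cexp (I * ((s * t * ‖(2 * Real.pi) • ζ‖ : ℝ) : ℂ)) *
      ftX (fun y => f y) ((2 * Real.pi) • ζ) with hh
  have hcont : Continuous h := by
    have := continuous_ftX_schwartz f
    fun_prop
  have hint : Integrable h := by
    have := (integrable_ftX_schwartz f).comp_smul (R := 2 * Real.pi) (by positivity)
    refine this.mono hcont.aestronglyMeasurable (ae_of_all _ fun ζ => ?_)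
    rw [hh]
    simp only [norm_mul, norm_cexp_I_mul_ofReal, one_mul]
    exact le_rfl
  have heq : halfWave s (fun y => f y) t = 𝓕⁻ h := by
    ext x
    exact halfWave_eq_fourierInv s _ t x
  have hint' : Integrable (𝓕 h) := by
    have : 𝓕 h = fun x => (halfWave s (fun y => f y) t) (-x) := by
      ext x
      rw [heq, Real.fourierInv_eq_fourier_neg, neg_neg]
    rw [this]
    exact hu.comp_neg
  rw [ftX_eq_fourier, heq, hcont.fourier_fourierInv_eq hint hint', hh]
  simp only [smul_inv_smul₀ (show (2 * Real.pi) ≠ 0 by positivity)]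

theorem ftX_of_not_integrable {u : E2 → ℂ} (hu : ¬ Integrable u) (ξ : E2) : ftX u ξ = 0 := by
  refine integral_undef fun h => hu ?_
  have hc : Continuous fun x : E2 => cexp (I * ((⟪x, ξ⟫ : ℝ) : ℂ)) := by fun_prop
  have := h.bdd_mul (c := 1) hc.aestronglyMeasurable
    (ae_of_all _ fun x => (norm_cexp_I_mul_ofReal _).le)
  refine this.congr (ae_of_all _ fun x => ?_)
  simp only
  rw [← mul_assoc, ← Complex.exp_add]
  simp

/-- The amplitude of the interaction in the frequency variables. -/
def hhlAmplitude (s₃ : ℝ) (F G : E2 → ℂ) (p : E2 × E2) : ℂ :=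
  hhlRegion.indicator (fun p => ((‖p.1‖ ^ (-s₃) : ℝ) : ℂ) * (F p.2 * G (p.1 - p.2))) p

/-- The space-time frequency of the interaction. -/
def hhlFrequency (s : ℝ) (p : E2 × E2) : SpaceTime := (s * phase p.1 p.2, p.1)

theorem measurable_hhlFrequency (s : ℝ) : Measurable (hhlFrequency s) := by
  have := measurable_phase
  unfold hhlFrequency
  fun_prop

theorem measurable_hhlAmplitude (s₃ : ℝ) {F G : E2 → ℂ} (hF : Measurable F) (hG : Measurable G) :
    Measurable (hhlAmplitude s₃ F G) := by
  unfold hhlAmplitude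
  exact Measurable.indicator (by fun_prop) measurableSet_hhlRegion

theorem lintegral_hhlAmplitude_mul (s s₃ : ℝ) (F G : E2 → ℂ) (K : SpaceTime → ℝ≥0∞) :
    ∫⁻ p, ‖hhlAmplitude s₃ F G p‖ₑ * K (hhlFrequency s p) =
      ∫⁻ p in hhlRegion, K (s * phase p.1 p.2, p.1) * ENNReal.ofReal (‖p.1‖ ^ (-s₃)) *
        (‖F p.2‖ₑ * ‖G (p.1 - p.2)‖ₑ) := by
  rw [← lintegral_indicator measurableSet_hhlRegion]
  refine lintegral_congr fun p => ?_
  by_cases hp : p ∈ hhlRegion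
  · simp only [hhlAmplitude, hhlFrequency, Set.indicator_of_mem hp, enorm_mul]
    rw [← ofReal_norm (ofReal _), norm_real, Real.norm_of_nonneg (by positivity)]
    ring
  · simp [hhlAmplitude, Set.indicator_of_notMem hp]

/-- A weight in `L²` of space-time. -/
def decayWeight (z : SpaceTime) : ℝ := (1 + ‖z.1‖) ^ (-1 : ℝ) * (1 + ‖z.2‖) ^ (-2 : ℝ)

theorem lnorm_decayWeight_ne_top : lnorm (fun z => ENNReal.ofReal (decayWeight z)) ≠ ∞ := by
  refine lnorm_ofReal_ne_top (fun z => by unfold decayWeight; positivity) ?_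
  have h1 : Integrable fun t : ℝ => (1 + ‖t‖) ^ (-2 : ℝ) := integrable_one_add_norm (by simp)
  refine (h1.mul_prod integrable_one_add_norm_rpow_neg_four).congr (ae_of_all _ fun z => ?_)
  simp only [decayWeight]
  rw [mul_pow, ← Real.rpow_natCast, ← Real.rpow_natCast, ← Real.rpow_mul (by positivity),
    ← Real.rpow_mul (by positivity)]
  norm_num

theorem one_le_decayWeight_mul {s : ℝ} (hs : |s| = 1) (ξ η : E2) :
    1 ≤ decayWeight (s * phase ξ η, ξ) * ((1 + ‖η‖) ^ 3 * (1 + ‖ξ - η‖) ^ 3) := by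
  have hη := norm_nonneg η
  have hζ := norm_nonneg (ξ - η)
  have hp : ‖s * phase ξ η‖ = ‖η‖ + ‖ξ - η‖ := by
    rw [norm_mul, Real.norm_eq_abs, hs, one_mul, phase, Real.norm_of_nonneg (by positivity)]
  have hξ : ‖ξ‖ ≤ ‖η‖ + ‖ξ - η‖ := by
    simpa using norm_add_le η (ξ - η)
  set W := (1 + ‖η‖) * (1 + ‖ξ - η‖) with hW
  have h1 : 1 + ‖s * phase ξ η‖ ≤ W := by rw [hp]; nlinarith
  have h2 : 1 + ‖ξ‖ ≤ W := by nlinarith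
  have hW0 : 0 < W := by positivity
  have hx := norm_nonneg ξ
  have hy := norm_nonneg (s * phase ξ η)
  rw [decayWeight, ← mul_pow, Real.rpow_neg (by positivity), Real.rpow_neg (by positivity),
    Real.rpow_one, Real.rpow_two, ← hW, ← mul_inv, ← div_eq_inv_mul, le_div_iff₀ (by positivity),
    one_mul]
  calc _ ≤ W * W ^ 2 := by
        dsimp only
        gcongr
    _ = W ^ 3 := by ring

theorem integrable_hhlAmplitude {s₁ s₂ s₃ : ℝ} (hsum : s₁ + s₂ + s₃ = 1 / 2) (h₁ : s₁ < 5 / 8)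
    (h₂ : s₂ < 5 / 8) (h₁₂ : 0 < s₁ + s₂) (f g : SchwartzMap E2 ℂ) :
    Integrable (hhlAmplitude s₃ (ftX fun y => f y) (ftX fun y => g y)) := by
  obtain ⟨C, hC, hbound⟩ := exists_trilinear_bound hsum h₁₂
  have hf := continuous_ftX_schwartz f
  have hg := continuous_ftX_schwartz g
  have hweight : ∀ (k : SchwartzMap E2 ℂ) {σ : ℝ}, -(5 / 8) < σ → σ < 5 / 8 →
      lnorm (fun η => ENNReal.ofReal (‖η‖ ^ σ) *
        ENNReal.ofReal ((1 + ‖η‖) ^ 3 * ‖ftX (fun y => k y) η‖)) ≠ ∞ := by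
    intro k σ hσ hσ'
    have h := lnorm_ofReal_ne_top (fun _ => by positivity)
      (integrable_weighted_ftX_sq k hσ hσ' 3)
    simpa only [ENNReal.ofReal_mul (Real.rpow_nonneg (norm_nonneg _) _)] using h
  refine ⟨(measurable_hhlAmplitude s₃ hf.measurable hg.measurable).aestronglyMeasurable, ?_⟩
  have h := hbound 1 (by simp) (fun z => ENNReal.ofReal (decayWeight z))
    (fun η => ENNReal.ofReal ((1 + ‖η‖) ^ 3 * ‖ftX (fun y => f y) η‖))
    (fun η => ENNReal.ofReal ((1 + ‖η‖) ^ 3 * ‖ftX (fun y => g y) η‖))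
    (by unfold decayWeight; fun_prop) (by fun_prop) (by fun_prop)
  refine lt_of_le_of_lt ?_ (h.trans_lt (ENNReal.mul_ne_top hC
    (ENNReal.mul_ne_top lnorm_decayWeight_ne_top
      (ENNReal.mul_ne_top (hweight f (by linarith) h₁) (hweight g (by linarith) h₂)))).lt_top)
  have e := lintegral_hhlAmplitude_mul 1 s₃ (ftX fun y => f y) (ftX fun y => g y) (fun _ => 1)
  simp only [mul_one, one_mul] at e
  rw [e]
  refine lintegral_mono fun p => ?_
  have hw := one_le_decayWeight_mul (s := 1) (by simp) p.1 p.2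
  rw [← ofReal_norm, ← ofReal_norm, ← ENNReal.ofReal_mul (by positivity),
    ← ENNReal.ofReal_mul (by positivity), ← ENNReal.ofReal_mul (by unfold decayWeight; positivity),
    ← ENNReal.ofReal_mul (by positivity),
    ← ENNReal.ofReal_mul (by unfold decayWeight; positivity)]
  refine ENNReal.ofReal_le_ofReal ?_
  set X := ‖p.1‖ ^ (-s₃) * (‖ftX (fun y => f y) p.2‖ * ‖ftX (fun y => g y) (p.1 - p.2)‖) with hX
  have hX0 : 0 ≤ X := by positivity
  calc X ≤ decayWeight (1 * phase p.1 p.2, p.1) * ((1 + ‖p.2‖) ^ 3 * (1 + ‖p.1 - p.2‖) ^ 3) * X :=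
        le_mul_of_one_le_left hX0 hw
    _ = _ := by rw [hX]; ring

theorem bilinHHL_eq_extOp {s₃ : ℝ} {f g : SchwartzMap E2 ℂ}
    (ha : Integrable (hhlAmplitude s₃ (ftX fun y => f y) (ftX fun y => g y))) (s t : ℝ)
    (hu : Integrable (halfWave s (fun y => f y) t))
    (hv : Integrable (halfWave s (fun y => g y) t)) (x : E2) :
    bilinHHL s₃ (halfWave s (fun y => f y)) (halfWave s (fun y => g y)) t x =
      ((2 * Real.pi) ^ (-2 : ℝ) : ℝ) •
        extOp (hhlFrequency s) (hhlAmplitude s₃ (ftX fun y => f y) (ftX fun y => g y)) (t, x) := by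
  rw [bilinHHL, extOp]
  congr 1
  have hint : Integrable (fun p : E2 × E2 =>
      cexp (I * (stPair (t, x) (hhlFrequency s p) : ℝ)) *
        hhlAmplitude s₃ (ftX fun y => f y) (ftX fun y => g y) p)
      ((volume : Measure E2).prod (volume : Measure E2)) := by
    have hm := measurable_hhlFrequency s
    refine ha.bdd_mul (c := 1) (Measurable.aestronglyMeasurable (by fun_prop))
      (ae_of_all _ fun p => (norm_cexp_I_mul_ofReal _).le)
  have hp := integral_prod _ hint
  refine Eq.trans ?_ hp.symm
  refine integral_congr_ae (ae_of_all _ fun ξ => ?_)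
  simp only [hhLowX]
  rw [← integral_const_mul]
  refine integral_congr_ae (ae_of_all _ fun η => ?_)
  simp only [ftX_halfWave_of_integrable s f t hu, ftX_halfWave_of_integrable s g t hv]
  by_cases h : 2 * ‖ξ‖ ≤ ‖η‖ + ‖ξ - η‖
  · have hmem : (ξ, η) ∈ hhlRegion := h
    have e : cexp (I * (stPair (t, x) (hhlFrequency s (ξ, η)) : ℝ)) =
        cexp (I * ((⟪x, ξ⟫ : ℝ) : ℂ)) * (cexp (I * ((s * t * ‖η‖ : ℝ) : ℂ)) *
          cexp (I * ((s * t * ‖ξ - η‖ : ℝ) : ℂ))) := by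
      rw [← Complex.exp_add, ← Complex.exp_add]
      congr 1
      simp only [stPair, hhlFrequency, phase]
      push_cast
      ring
    rw [if_pos h, hhlAmplitude, Set.indicator_of_mem hmem, e]
    ring
  · have hmem : (ξ, η) ∉ hhlRegion := h
    rw [if_neg h, hhlAmplitude, Set.indicator_of_notMem hmem]
    simp

theorem norm_bilinHHL_le {s₃ : ℝ} {f g : SchwartzMap E2 ℂ}
    (ha : Integrable (hhlAmplitude s₃ (ftX fun y => f y) (ftX fun y => g y))) (s t : ℝ) (x : E2) :
    ‖bilinHHL s₃ (halfWave s (fun y => f y)) (halfWave s (fun y => g y)) t x‖ ≤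
      ‖extOp (hhlFrequency s) (hhlAmplitude s₃ (ftX fun y => f y) (ftX fun y => g y)) (t, x)‖ := by
  have hpi := Real.pi_gt_three
  by_cases hu : Integrable (halfWave s (fun y => f y) t)
  · by_cases hv : Integrable (halfWave s (fun y => g y) t)
    · rw [bilinHHL_eq_extOp ha s t hu hv, norm_smul, Real.norm_of_nonneg (by positivity)]
      exact mul_le_of_le_one_left (norm_nonneg _)
        (Real.rpow_le_one_of_one_le_of_nonpos (by linarith) (by norm_num))
    · simp [bilinHHL, hhLowX, ftX_of_not_integrable hv]
  · simp [bilinHHL, hhLowX, ftX_of_not_integrable hu]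

theorem integral_integral_sq_le {u U : ℝ → E2 → ℂ} {B : ℝ} (hB : 0 ≤ B)
    (hU : Measurable fun z : SpaceTime => U z.1 z.2) (hle : ∀ t x, ‖u t x‖ ≤ ‖U t x‖)
    (hbound : ∫⁻ z : SpaceTime, ‖U z.1 z.2‖ₑ ^ 2 ≤ ENNReal.ofReal B) :
    ∫ t, ∫ x, ‖u t x‖ ^ 2 ≤ B := by
  have he : ∀ z : SpaceTime, ENNReal.ofReal (‖U z.1 z.2‖ ^ 2) = ‖U z.1 z.2‖ₑ ^ 2 := fun z => by
    rw [ENNReal.ofReal_pow (norm_nonneg _), ofReal_norm]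
  have hm : Measurable fun z : SpaceTime => ‖U z.1 z.2‖ ^ 2 := by fun_prop
  have hint : Integrable (fun z : SpaceTime => ‖U z.1 z.2‖ ^ 2)
      ((volume : Measure ℝ).prod (volume : Measure E2)) := by
    refine ⟨hm.aestronglyMeasurable, ?_⟩
    rw [hasFiniteIntegral_iff_ofReal (ae_of_all _ fun z => by positivity)]
    simp_rw [he]
    exact hbound.trans_lt ENNReal.ofReal_lt_top
  calc ∫ t, ∫ x, ‖u t x‖ ^ 2 ≤ ∫ t, ∫ x, ‖U t x‖ ^ 2 := by
        refine integral_mono_of_nonneg (ae_of_all _ fun t => integral_nonneg fun x => by positivity)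
          hint.integral_prod_left ?_
        filter_upwards [hint.prod_right_ae] with t ht
        refine integral_mono_of_nonneg (ae_of_all _ fun x => by positivity) ht
          (ae_of_all _ fun x => ?_)
        exact pow_le_pow_left₀ (norm_nonneg _) (hle t x) 2
    _ = ∫ z : SpaceTime, ‖U z.1 z.2‖ ^ 2 := (integral_prod _ hint).symm
    _ ≤ B := by
        refine (ENNReal.ofReal_le_ofReal_iff hB).1 ?_
        refine le_trans (le_of_eq ?_) hbound
        rw [← lintegral_congr he]
        exact ofReal_integral_eq_lintegral_ofReal hint (ae_of_all _ fun z => by positivity)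

/-- Bilinear Strichartz estimate for equal signs: if s₁+s₂+s₃ = 1/2, s₁,s₂ < 5/8 and
    s₁+s₂ > 0, then ‖|D|^{−s₃}(e^{s it|D|}f, e^{s it|D|}g)_{HH→L}‖_{L²_{tx}} ≤
    c ‖f‖_{Ḣ^{s₁}} ‖g‖_{Ḣ^{s₂}}. -/
theorem bilinear_strichartz (s₁ s₂ s₃ : ℝ) (hsum : s₁ + s₂ + s₃ = 1 / 2)
    (h₁ : s₁ < 5 / 8) (h₂ : s₂ < 5 / 8) (h₁₂ : 0 < s₁ + s₂) :
    ∃ c : ℝ,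
      ∀ s : ℝ, (s = 1 ∨ s = -1) →
        ∀ f g : SchwartzMap E2 ℂ,
          Real.sqrt (∫ t : ℝ, ∫ x : E2,
              ‖bilinHHL s₃ (halfWave s (fun y => f y)) (halfWave s (fun y => g y)) t x‖ ^ 2) ≤
            c * homSob s₁ (fun y => f y) * homSob s₂ (fun y => g y) := by
  obtain ⟨C, hC, hbound⟩ := exists_trilinear_bound hsum h₁₂
  have hpi := Real.pi_pos
  refine ⟨C.toReal * Real.sqrt ((2 * Real.pi) ^ 3), fun s hs f g => ?_⟩
  have hs1 : |s| = 1 := by rcases hs with rfl | rfl <;> simp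
  have hf := (continuous_ftX_schwartz f).measurable
  have hg := (continuous_ftX_schwartz g).measurable
  have ha := integrable_hhlAmplitude hsum h₁ h₂ h₁₂ f g
  have ham := measurable_hhlAmplitude s₃ hf hg
  have hPm := measurable_hhlFrequency s
  have hN₁ : 0 ≤ homSob s₁ fun y => f y := Real.sqrt_nonneg _
  have hN₂ : 0 ≤ homSob s₂ fun y => g y := Real.sqrt_nonneg _
  set A : ℝ := C.toReal * (homSob s₁ (fun y => f y) * homSob s₂ (fun y => g y)) with hA
  have hA0 : 0 ≤ A := by positivity
  have hext := lintegral_extOp_sq_le hPm ham ha (A := ENNReal.ofReal A) fun K hK => by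
    rw [lintegral_hhlAmplitude_mul]
    refine (hbound s hs1 K (fun η => ‖ftX (fun y => f y) η‖ₑ) (fun η => ‖ftX (fun y => g y) η‖ₑ)
      hK (by fun_prop) (by fun_prop)).trans (le_of_eq ?_)
    rw [← ofReal_homSob f (by linarith) h₁, ← ofReal_homSob g (by linarith) h₂, hA,
      ENNReal.ofReal_mul (by positivity), ENNReal.ofReal_mul hN₁, ENNReal.ofReal_toReal hC]
    ring
  rw [← ENNReal.ofReal_pow hA0, ← ENNReal.ofReal_mul (by positivity)] at hext
  have hfin := integral_integral_sq_le
    (U := fun t x => extOp (hhlFrequency s)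
      (hhlAmplitude s₃ (ftX fun y => f y) (ftX fun y => g y)) (t, x))
    (by positivity) (measurable_extOp hPm ham) (norm_bilinHHL_le ha s) hext
  refine (Real.sqrt_le_sqrt hfin).trans (le_of_eq ?_)
  rw [Real.sqrt_mul (by positivity), Real.sqrt_sq hA0, hA]
  ring
end
end

section
/- There is a constant c > 0 such that for every sign s ∈ {+1,−1} and all Schwartz functions u, v on ℝ×ℝ², ‖⟨D⟩^{−1/2} (u,v)_{HH→L}‖_{L²(ℝ_t×ℝ²_x)} ≤ c ‖u‖_{X^{1/6,1/3,1}_s} ‖v‖_{X^{1/6,1/3,1}_s}, where it is essential that both factors on the right-hand side carry the same sign s. -/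
open MeasureTheory Complex
open scoped RealInnerProductSpace

noncomputable section

/-- Space–time Fourier transform of the high-high-to-low interaction (u,v)_{HH→L}. -/
def hhLowST (u v : SpaceTime → ℂ) (τ : ℝ) (ξ : E2) : ℂ :=
  ∫ lam : ℝ, ∫ η : E2,
    (if 2 * ‖ξ‖ ≤ ‖η‖ + ‖ξ - η‖ then (1 : ℂ) else 0) * ftST u lam η * ftST v (τ - lam) (ξ - η)

/-- The function ⟨D⟩^{−1/2}(u,v)_{HH→L} of (t,x). -/
def bilinHHLST (u v : SpaceTime → ℂ) (p : SpaceTime) : ℂ :=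
  ((2 * Real.pi) ^ (-3 : ℝ) : ℝ) •
    ∫ τ : ℝ, ∫ ξ : E2, Complex.exp (Complex.I * ((p.1 * τ + ⟪p.2, ξ⟫ : ℝ) : ℂ)) *
      ((jap ‖ξ‖ ^ (-(1 : ℝ) / 2) : ℝ) : ℂ) * hhLowST u v τ ξ

open scoped FourierTransform SchwartzMap ENNReal

theorem lintegral_enorm_sq_fourier_le {V : Type*} [NormedAddCommGroup V] [InnerProductSpace ℝ V]
    [FiniteDimensional ℝ V] [MeasurableSpace V] [BorelSpace V] {h : V → ℂ} (hi : Integrable h) :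
    ∫⁻ w, ‖𝓕 h w‖ₑ ^ 2 ≤ ∫⁻ v, ‖h v‖ₑ ^ 2 := by
  by_cases hfin : ∫⁻ v, ‖h v‖ₑ ^ 2 = ⊤
  · simp [hfin]
  have hsq : ∀ f : V → ℂ, eLpNorm f 2 volume ^ 2 = ∫⁻ v, ‖f v‖ₑ ^ 2 := by
    intro f
    rw [eLpNorm_eq_lintegral_rpow_enorm_toReal (by norm_num) (by norm_num), ← ENNReal.rpow_natCast,
      ← ENNReal.rpow_mul]
    norm_num
  have hL2 : MemLp h 2 volume := by
    refine ⟨hi.1, lt_top_iff_ne_top.2 fun H => hfin ?_⟩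
    rw [← hsq, H]; rfl
  set g : Lp ℂ 2 (volume : Measure V) := hL2.toLp h
  have hcont : Continuous (𝓕 h) :=
    VectorFourier.fourierIntegral_continuous Real.continuous_fourierChar
      (innerSL ℝ).continuous₂ hi
  have hS : ∀ Ψ : 𝓢(V, ℂ), ∫ x, Ψ x • 𝓕 h x
      = ∫ x, Ψ x • (𝓕 g : Lp ℂ 2 (volume : Measure V)) x := by
    intro Ψ
    have h1 := congrArg (fun T => T Ψ) (Lp.fourier_toTemperedDistribution_eq g)
    simp only [TemperedDistribution.fourier_apply, Lp.toTemperedDistribution_apply] at h1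
    have h2 : ∫ x, (𝓕 Ψ : 𝓢(V, ℂ)) x • g x = ∫ x, (𝓕 Ψ : 𝓢(V, ℂ)) x • h x := by
      refine integral_congr_ae ?_
      filter_upwards [hL2.coeFn_toLp] with x hx
      rw [hx]
    have h3 : ∫ x, 𝓕 (Ψ : V → ℂ) x • h x = ∫ x, Ψ x • 𝓕 h x := by
      simpa using! (VectorFourier.integral_fourierIntegral_smul_eq_flip (L := innerₗ V)
        Real.continuous_fourierChar (by exact (innerSL ℝ).continuous₂) Ψ.integrable hi)
    rw [← h1, h2, ← h3]
    rfl
  have hae : 𝓕 h =ᵐ[volume] (𝓕 g : Lp ℂ 2 (volume : Measure V)) := by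
    refine ae_eq_of_integral_contDiff_smul_eq hcont.locallyIntegrable
      ((Lp.memLp (𝓕 g)).locallyIntegrable (by norm_num)) fun ψ hψ hψc => ?_
    have hψ' : ContDiff ℝ (⊤ : ℕ∞) (fun x => (ψ x : ℂ)) := ofRealCLM.contDiff.comp hψ
    have hψc' : HasCompactSupport (fun x => (ψ x : ℂ)) := hψc.comp_left (g := ((↑) : ℝ → ℂ)) rfl
    obtain ⟨Ψ, hΨ⟩ : ∃ Ψ : 𝓢(V, ℂ), ∀ x, Ψ x = (ψ x : ℂ) :=
      ⟨hψc'.toSchwartzMap hψ', fun x => rfl⟩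
    simpa only [hΨ, smul_eq_mul, real_smul] using hS Ψ
  calc ∫⁻ w, ‖𝓕 h w‖ₑ ^ 2 = ∫⁻ w, ‖(𝓕 g : Lp ℂ 2 (volume : Measure V)) w‖ₑ ^ 2 :=
        lintegral_congr_ae (hae.mono fun x hx => by simp [hx])
    _ = ∫⁻ v, ‖g v‖ₑ ^ 2 := by
        rw [← hsq, ← hsq, ← Lp.enorm_def, ← Lp.enorm_def, ← ofReal_norm, ← ofReal_norm,
          Lp.norm_fourier_eq]
    _ ≤ ∫⁻ v, ‖h v‖ₑ ^ 2 := le_of_eq (lintegral_congr_ae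
        (hL2.coeFn_toLp.mono fun x hx => by simp only [g, hx]))

instance : (volume : Measure SpaceTime).IsAddHaarMeasure :=
  inferInstanceAs ((volume : Measure ℝ).prod (volume : Measure E2)).IsAddHaarMeasure

theorem fourier_toLp_spaceTime (H : SpaceTime → ℂ) (w : WithLp 2 SpaceTime) :
    𝓕 (fun v : WithLp 2 SpaceTime => H (WithLp.ofLp v)) w =
      ∫ q : SpaceTime, Complex.exp (-Complex.I * ((2 * Real.pi *
        (q.1 * w.fst + ⟪q.2, w.snd⟫) : ℝ) : ℂ)) * H q := by
  rw [Real.fourier_eq',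
    ← (WithLp.volume_preserving_toLp (U := ℝ) (V := E2)).integral_comp
      (MeasurableEquiv.toLp 2 SpaceTime).measurableEmbedding]
  refine integral_congr_ae (Filter.Eventually.of_forall fun q => ?_)
  simp only [smul_eq_mul, WithLp.prod_inner_apply]
  congr 2
  simp
  ring

theorem lintegral_enorm_sq_fourier_spaceTime_le {H : SpaceTime → ℂ} (hH : Integrable H) :
    ∫⁻ p : SpaceTime, ‖∫ q : SpaceTime,
        Complex.exp (Complex.I * ((p.1 * q.1 + ⟪p.2, q.2⟫ : ℝ) : ℂ)) * H q‖ₑ ^ 2 ≤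
      ENNReal.ofReal ((2 * Real.pi) ^ 3) * ∫⁻ q, ‖H q‖ₑ ^ 2 := by
  have hmp := WithLp.volume_preserving_toLp (U := ℝ) (V := E2)
  have hmo := WithLp.volume_preserving_ofLp (U := ℝ) (V := E2)
  have hint : Integrable (fun v : WithLp 2 SpaceTime => H (WithLp.ofLp v)) :=
    (hmo.integrable_comp_emb (MeasurableEquiv.toLp 2 SpaceTime).symm.measurableEmbedding).2 hH
  have hP := lintegral_enorm_sq_fourier_le hint
  rw [hmo.lintegral_comp_emb (MeasurableEquiv.toLp 2 SpaceTime).symm.measurableEmbedding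
      (fun q => ‖H q‖ₑ ^ 2),
    ← hmp.lintegral_comp_emb (MeasurableEquiv.toLp 2 SpaceTime).measurableEmbedding] at hP
  set r : ℝ := -(2 * Real.pi)⁻¹ with hr
  have hr0 : r ≠ 0 := by rw [hr]; have := Real.pi_pos; simp [this.ne']
  have hkey : ∀ p : SpaceTime, (∫ q : SpaceTime,
        Complex.exp (Complex.I * ((p.1 * q.1 + ⟪p.2, q.2⟫ : ℝ) : ℂ)) * H q) =
      𝓕 (fun v : WithLp 2 SpaceTime => H (WithLp.ofLp v)) (WithLp.toLp 2 (r • p)) := by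
    intro p
    rw [fourier_toLp_spaceTime]
    refine integral_congr_ae (Filter.Eventually.of_forall fun q => ?_)
    simp only [WithLp.toLp_fst, WithLp.toLp_snd, Prod.smul_fst, Prod.smul_snd, inner_smul_right,
      smul_eq_mul]
    have : 2 * Real.pi * (q.1 * (r * p.1) + r * ⟪q.2, p.2⟫) =
        -(p.1 * q.1 + ⟪p.2, q.2⟫) := by
      rw [hr, real_inner_comm]
      field_simp [Real.pi_pos.ne']
      ring
    rw [this]
    push_cast
    congr 2
    ring
  simp_rw [hkey]
  have hmeas := Measure.map_addHaar_smul (volume : Measure SpaceTime) hr0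
  have hemb : MeasurableEmbedding (fun p : SpaceTime => r • p) :=
    measurableEmbedding_const_smul₀ hr0
  calc _ = ∫⁻ p, ‖𝓕 (fun v : WithLp 2 SpaceTime => H (WithLp.ofLp v)) (WithLp.toLp 2 p)‖ₑ ^ 2
        ∂(Measure.map (fun p : SpaceTime => r • p) volume) := (hemb.lintegral_map _).symm
    _ = ENNReal.ofReal ((2 * Real.pi) ^ 3) * ∫⁻ p : SpaceTime,
        ‖𝓕 (fun v : WithLp 2 SpaceTime => H (WithLp.ofLp v)) (WithLp.toLp 2 p)‖ₑ ^ 2 := by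
        rw [show (fun p : SpaceTime => r • p) = (r • ·) from rfl, hmeas, lintegral_smul_measure]
        congr 2
        simp [hr, abs_inv, abs_of_pos Real.pi_pos]
        field_simp
    _ ≤ _ := by gcongr

theorem exists_schwartz_ftST (u : 𝓢(SpaceTime, ℂ)) :
    ∃ U : 𝓢(SpaceTime, ℂ), ∀ τ ξ, ftST (fun q => u q) τ ξ = U (τ, ξ) := by
  have h2 : (2 * Real.pi)⁻¹ ≠ 0 := by have := Real.pi_pos; positivity
  let e := WithLp.prodContinuousLinearEquiv 2 ℝ ℝ E2
  let u₁ : 𝓢(WithLp 2 SpaceTime, ℂ) := SchwartzMap.compCLMOfContinuousLinearEquiv ℂ e u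
  let d : SpaceTime ≃L[ℝ] WithLp 2 SpaceTime :=
    (ContinuousLinearEquiv.smulLeft (Units.mk0 _ h2)).trans e.symm
  refine ⟨SchwartzMap.compCLMOfContinuousLinearEquiv ℂ d (𝓕 u₁), fun τ ξ => ?_⟩
  have : (𝓕 u₁ : 𝓢(WithLp 2 SpaceTime, ℂ)) (d (τ, ξ)) =
      𝓕 (fun v : WithLp 2 SpaceTime => u (WithLp.ofLp v)) (d (τ, ξ)) := by
    rw [SchwartzMap.fourier_coe]; rfl
  simp only [SchwartzMap.compCLMOfContinuousLinearEquiv_apply, Function.comp_apply]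
  rw [this, fourier_toLp_spaceTime, ftST]
  refine integral_congr_ae (Filter.Eventually.of_forall fun q => ?_)
  have hd : d (τ, ξ) = WithLp.toLp 2 ((2 * Real.pi)⁻¹ • (τ, ξ)) := rfl
  simp only [hd, WithLp.toLp_fst, WithLp.toLp_snd, Prod.smul_fst, Prod.smul_snd, inner_smul_right,
      smul_eq_mul]
  congr 4
  field_simp

theorem lintegral_le_of_forall_ray_le {h : E2 → ℝ≥0∞} (hh : Measurable h) {B : ℝ≥0∞}
    (hB : ∀ ω : E2, ‖ω‖ = 1 → ∫⁻ r in Set.Ioi (0 : ℝ), ENNReal.ofReal r * h (r • ω) ≤ B) :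
    ∫⁻ x, h x ≤ (volume : Measure E2).toSphere Set.univ * B := by
  have h0 : ∫⁻ x, h x = ∫⁻ x : ({0}ᶜ : Set E2), h x ∂(Measure.comap Subtype.val volume) := by
    rw [lintegral_subtype_comap (measurableSet_singleton _).compl,
      restrict_compl_singleton]
  have hmp := (volume : Measure E2).measurePreserving_homeomorphUnitSphereProd
  have hm : Measurable (fun p : Metric.sphere (0 : E2) 1 × Set.Ioi (0 : ℝ) =>
      h (p.2.1 • p.1.1)) := by
    fun_prop
  have h1 : ∀ x : ({0}ᶜ : Set E2), h x =
      (fun p : Metric.sphere (0 : E2) 1 × Set.Ioi (0 : ℝ) => h (p.2.1 • p.1.1))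
        (homeomorphUnitSphereProd E2 x) := by
    intro x
    have hx : ‖(x : E2)‖ ≠ 0 := norm_ne_zero_iff.2 x.2
    simp [smul_smul, hx]
  rw [h0]
  simp_rw [h1]
  rw [hmp.lintegral_comp hm, lintegral_prod _ hm.aemeasurable]
  calc _ ≤ ∫⁻ _ω : Metric.sphere (0 : E2) 1, B ∂(volume : Measure E2).toSphere := by
        refine lintegral_mono fun ω => ?_
        refine le_trans (le_of_eq ?_) (hB ω.1 (by simp))
        rw [Measure.volumeIoiPow, lintegral_withDensity_eq_lintegral_mul _ (by fun_prop)
          (by fun_prop), ← lintegral_subtype_comap measurableSet_Ioi]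
        simp
    _ = _ := by simp [mul_comm]

theorem jap_pos (x : ℝ) : 0 < jap x := Real.sqrt_pos.2 (by positivity)

theorem le_jap (x : ℝ) : x ≤ jap x := Real.le_sqrt_of_sq_le (by linarith)

theorem one_le_jap (x : ℝ) : 1 ≤ jap x := Real.one_le_sqrt.2 (by nlinarith [sq_nonneg x])

@[fun_prop]
theorem measurable_jap : Measurable jap := by unfold jap; fun_prop

/-- The square of the weight `⟨ξ⟩^{-1/2} ⟨η⟩^{-1/6} ⟨ξ - η⟩^{-1/6}`. -/
def weightSq (ξ η : E2) : ℝ :=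
  jap ‖ξ‖ ^ (-1 : ℝ) * jap ‖η‖ ^ (-(1 / 3) : ℝ) * jap ‖ξ - η‖ ^ (-(1 / 3) : ℝ)

theorem weightSq_nonneg (ξ η : E2) : 0 ≤ weightSq ξ η := by
  have := jap_pos ‖ξ‖; have := jap_pos ‖η‖; have := jap_pos ‖ξ - η‖
  unfold weightSq; positivity

theorem weightSq_le {ξ η : E2} (hξ : ξ ≠ 0) (h : 2 * ‖ξ‖ ≤ ‖η‖ + ‖ξ - η‖) :
    weightSq ξ η ≤ 4 * (‖ξ‖⁻¹ * (‖η‖ + ‖ξ - η‖) ^ (-(2 / 3) : ℝ)) := by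
  have hN : 0 < ‖ξ‖ := norm_pos_iff.2 hξ
  set S := ‖η‖ + ‖ξ - η‖ with hS
  have hSpos : 0 < S := by linarith
  have h1 : ‖ξ - η‖ ≤ ‖ξ‖ + ‖η‖ := norm_sub_le _ _
  have h2 : ‖η‖ ≤ ‖ξ‖ + ‖ξ - η‖ := by
    calc ‖η‖ = ‖ξ - (ξ - η)‖ := by congr 1; abel
      _ ≤ _ := norm_sub_le _ _
  have hp : S / 4 ≤ jap ‖η‖ := le_trans (by linarith) (le_jap _)
  have hq : S / 4 ≤ jap ‖ξ - η‖ := le_trans (by linarith) (le_jap _)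
  have a1 : jap ‖ξ‖ ^ (-1 : ℝ) ≤ ‖ξ‖⁻¹ := by
    rw [Real.rpow_neg_one]; exact inv_anti₀ hN (le_jap _)
  have a2 : jap ‖η‖ ^ (-(1 / 3) : ℝ) ≤ (S / 4) ^ (-(1 / 3) : ℝ) :=
    Real.rpow_le_rpow_of_nonpos (by positivity) hp (by norm_num)
  have a3 : jap ‖ξ - η‖ ^ (-(1 / 3) : ℝ) ≤ (S / 4) ^ (-(1 / 3) : ℝ) :=
    Real.rpow_le_rpow_of_nonpos (by positivity) hq (by norm_num)
  have b := jap_pos ‖ξ‖; have b2 := jap_pos ‖η‖; have b3 := jap_pos ‖ξ - η‖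
  calc weightSq ξ η ≤ ‖ξ‖⁻¹ * (S / 4) ^ (-(1 / 3) : ℝ) * (S / 4) ^ (-(1 / 3) : ℝ) := by
        unfold weightSq; gcongr
    _ = ‖ξ‖⁻¹ * ((4 : ℝ) ^ (2 / 3 : ℝ) * S ^ (-(2 / 3) : ℝ)) := by
        rw [mul_assoc, ← Real.rpow_add (by positivity), Real.div_rpow hSpos.le (by norm_num),
          div_eq_mul_inv, ← Real.rpow_neg (by norm_num)]
        norm_num [mul_comm]
    _ ≤ ‖ξ‖⁻¹ * (4 * S ^ (-(2 / 3) : ℝ)) := by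
        gcongr
        calc (4 : ℝ) ^ (2 / 3 : ℝ) ≤ 4 ^ (1 : ℝ) :=
              Real.rpow_le_rpow_of_exponent_le (by norm_num) (by norm_num)
          _ = 4 := by norm_num
    _ = _ := by ring

theorem measurable_weightSq : Measurable (fun p : E2 × E2 => weightSq p.1 p.2) := by
  unfold weightSq; fun_prop

/-- Along a ray, `‖η‖ + ‖ξ - η‖` grows at least as fast as `‖η‖` where it exceeds `2 ‖ξ‖`. -/
theorem norm_sub_smul_mono {ξ ω : E2} (hω : ‖ω‖ = 1) {r₁ r₂ : ℝ} (h1 : 0 < r₁)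
    (h12 : r₁ ≤ r₂) (hS : 2 * ‖ξ‖ ≤ r₁ + ‖ξ - r₁ • ω‖) :
    ‖ξ - r₁ • ω‖ ≤ ‖ξ - r₂ • ω‖ := by
  have e : ∀ r : ℝ, ‖ξ - r • ω‖ ^ 2 = ‖ξ‖ ^ 2 - 2 * r * ⟪ξ, ω⟫ + r ^ 2 := by
    intro r
    rw [norm_sub_sq_real, inner_smul_right, norm_smul, hω]
    simp
    ring
  have hc : ⟪ξ, ω⟫ ≤ ‖ξ‖ := by simpa [hω] using real_inner_le_norm ξ ω
  have hN := norm_nonneg ξ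
  have hr : ⟪ξ, ω⟫ ≤ r₁ := by
    by_contra! hlt
    have hq : (2 * ‖ξ‖ - r₁) ^ 2 ≤ ‖ξ - r₁ • ω‖ ^ 2 :=
      pow_le_pow_left₀ (by linarith) (by linarith) 2
    rw [e] at hq
    nlinarith [mul_pos h1 (h1.trans hlt), sq_nonneg (‖ξ‖ - ⟪ξ, ω⟫)]
  refine (sq_le_sq₀ (norm_nonneg _) (norm_nonneg _)).1 ?_
  rw [e, e]
  nlinarith

theorem volume_le_of_forall_sub_le {s : Set ℝ} {d : ℝ}
    (h : ∀ x ∈ s, ∀ y ∈ s, x ≤ y → y - x ≤ d) : volume s ≤ ENNReal.ofReal d := by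
  refine (Real.volume_le_diam s).trans (Metric.ediam_le fun x hx y hy => ?_)
  rw [edist_dist, Real.dist_eq]
  refine ENNReal.ofReal_le_ofReal ?_
  rcases le_total x y with hxy | hxy
  · rw [abs_sub_comm, abs_of_nonneg (by linarith)]; exact h x hx y hy hxy
  · rw [abs_of_nonneg (by linarith)]; exact h y hy x hx hxy

/-- The set of `η` in an elliptical annulus on which `‖η‖ + ‖ξ - η‖` is at most `‖ξ‖² / M`. -/
def annulus (ξ : E2) (T M : ℝ) : Set E2 :=
  {η | 2 * ‖ξ‖ ≤ ‖η‖ + ‖ξ - η‖ ∧ M * (‖η‖ + ‖ξ - η‖) ≤ ‖ξ‖ ^ 2 ∧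
    |‖η‖ + ‖ξ - η‖ - T| ≤ 2 * M}

theorem measurableSet_annulus (ξ : E2) (T M : ℝ) : MeasurableSet (annulus ξ T M) := by
  unfold annulus
  measurability

theorem lintegral_annulus_weightSq_le (ξ : E2) (T : ℝ) {M : ℝ} (hM : 0 < M) :
    ∫⁻ η in annulus ξ T M, ENNReal.ofReal (weightSq ξ η) ≤
      (volume : Measure E2).toSphere Set.univ * ENNReal.ofReal (24 * M ^ (1 / 3 : ℝ)) := by
  have hmw : Measurable (fun η => ENNReal.ofReal (weightSq ξ η)) :=
    (measurable_weightSq.comp measurable_prodMk_left).ennreal_ofReal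
  rw [← lintegral_indicator (measurableSet_annulus ξ T M)]
  refine lintegral_le_of_forall_ray_le (hmw.indicator (measurableSet_annulus ξ T M))
    fun ω hω => ?_
  set R : Set ℝ := {r | 0 < r ∧ r • ω ∈ annulus ξ T M}
  have hnorm : ∀ r : ℝ, 0 < r → ‖r • ω‖ = r := fun r hr => by
    rw [norm_smul, hω, Real.norm_of_nonneg hr.le, mul_one]
  have hpt : ∀ r ∈ Set.Ioi (0 : ℝ), ENNReal.ofReal r *
      (annulus ξ T M).indicator (fun η => ENNReal.ofReal (weightSq ξ η)) (r • ω) ≤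
      R.indicator (fun _ => ENNReal.ofReal (4 * M ^ (-(2 / 3) : ℝ))) r := by
    intro r hr
    by_cases hmem : r • ω ∈ annulus ξ T M
    · rw [Set.indicator_of_mem hmem, Set.indicator_of_mem (show r ∈ R from ⟨hr, hmem⟩),
        ← ENNReal.ofReal_mul (le_of_lt hr)]
      refine ENNReal.ofReal_le_ofReal ?_
      obtain ⟨h1, h2, -⟩ := hmem
      have hr' : 0 < r := hr
      have hξ : ξ ≠ 0 := by
        rintro rfl
        rw [hnorm r hr'] at h2
        have := norm_nonneg (0 - r • ω)
        have : 0 < M * (r + ‖0 - r • ω‖) := by positivity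
        simp at h2
        simp at this
        linarith
      have hw := weightSq_le hξ h1
      rw [hnorm r hr'] at h1 h2 hw
      set S := r + ‖ξ - r • ω‖ with hS
      have hN : 0 < ‖ξ‖ := norm_pos_iff.2 hξ
      have hrS : r ≤ S := by have := norm_nonneg (ξ - r • ω); linarith
      have hSpos : 0 < S := by linarith
      have hMN : M ≤ ‖ξ‖ := by
        by_contra! hlt
        nlinarith
      have hSle : S ≤ ‖ξ‖ ^ 2 / M := by rw [le_div_iff₀ hM]; linarith
      calc r * weightSq ξ (r • ω) ≤ S * (4 * (‖ξ‖⁻¹ * S ^ (-(2 / 3) : ℝ))) := by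
            gcongr
            exact weightSq_nonneg _ _
        _ = 4 * (‖ξ‖⁻¹ * S ^ (1 / 3 : ℝ)) := by
            have : S ^ (1 / 3 : ℝ) = S * S ^ (-(2 / 3) : ℝ) := by
              nth_rewrite 2 [← Real.rpow_one S]
              rw [← Real.rpow_add hSpos]; norm_num
            rw [this]; ring
        _ ≤ 4 * (‖ξ‖⁻¹ * (‖ξ‖ ^ 2 / M) ^ (1 / 3 : ℝ)) := by gcongr
        _ = 4 * (‖ξ‖ ^ (-(1 / 3) : ℝ) * M ^ (-(1 / 3) : ℝ)) := by
            have : ‖ξ‖ ^ (-(1 / 3) : ℝ) = ‖ξ‖⁻¹ * ‖ξ‖ ^ (2 / 3 : ℝ) := by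
              rw [← Real.rpow_neg_one, ← Real.rpow_add hN]; norm_num
            rw [Real.div_rpow (by positivity) hM.le, div_eq_mul_inv, ← Real.rpow_neg hM.le,
              ← Real.rpow_natCast, ← Real.rpow_mul hN.le, this]
            norm_num
            ring
        _ ≤ 4 * (M ^ (-(1 / 3) : ℝ) * M ^ (-(1 / 3) : ℝ)) := by
            gcongr 4 * (?_ * _)
            exact Real.rpow_le_rpow_of_nonpos hM hMN (by norm_num)
        _ = _ := by rw [← Real.rpow_add hM]; norm_num
    · rw [Set.indicator_of_notMem hmem]; simp
  have hRm : MeasurableSet R := by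
    refine (measurableSet_lt measurable_const measurable_id).inter ?_
    exact (measurableSet_annulus ξ T M).preimage (by fun_prop)
  have hvol : volume R ≤ ENNReal.ofReal (4 * M) := by
    refine volume_le_of_forall_sub_le fun r₁ h₁ r₂ h₂ h12 => ?_
    obtain ⟨hr₁, h₁, -, h₁'⟩ := h₁
    obtain ⟨hr₂, -, -, h₂'⟩ := h₂
    rw [hnorm _ hr₁] at h₁ h₁'
    rw [hnorm _ hr₂] at h₂'
    have := norm_sub_smul_mono hω hr₁ h12 h₁
    have a := abs_le.1 h₁'
    have b := abs_le.1 h₂'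
    linarith [a.1, b.2]
  calc _ ≤ ∫⁻ r in Set.Ioi (0 : ℝ),
        R.indicator (fun _ => ENNReal.ofReal (4 * M ^ (-(2 / 3) : ℝ))) r :=
        setLIntegral_mono' measurableSet_Ioi hpt
    _ ≤ ∫⁻ r, R.indicator (fun _ => ENNReal.ofReal (4 * M ^ (-(2 / 3) : ℝ))) r :=
        setLIntegral_le_lintegral _ _
    _ = ENNReal.ofReal (4 * M ^ (-(2 / 3) : ℝ)) * volume R := by
        rw [lintegral_indicator hRm, setLIntegral_const]
    _ ≤ ENNReal.ofReal (4 * M ^ (-(2 / 3) : ℝ)) * ENNReal.ofReal (4 * M) := by gcongr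
    _ = ENNReal.ofReal (16 * M ^ (1 / 3 : ℝ)) := by
        rw [← ENNReal.ofReal_mul (by positivity)]
        congr 1
        have : M ^ (1 / 3 : ℝ) = M * M ^ (-(2 / 3) : ℝ) := by
          nth_rewrite 2 [← Real.rpow_one M]
          rw [← Real.rpow_add hM]; norm_num
        rw [this]; ring
    _ ≤ _ := by gcongr; norm_num

/-- The low output frequencies `ξ` that are compatible with a high frequency `η`. -/
def lowRegion (η : E2) (M : ℝ) : Set E2 :=
  {ξ | 2 * ‖ξ‖ ≤ ‖η‖ + ‖ξ - η‖ ∧ ‖ξ‖ ^ 2 ≤ M * (‖η‖ + ‖ξ - η‖)}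

theorem measurableSet_lowRegion (η : E2) (M : ℝ) : MeasurableSet (lowRegion η M) := by
  unfold lowRegion
  measurability

theorem setLIntegral_Ioc_rpow {M : ℝ} (hM : 0 < M) :
    ∫⁻ r in Set.Ioc 0 M, ENNReal.ofReal (r ^ (-(2 / 3) : ℝ)) =
      ENNReal.ofReal (3 * M ^ (1 / 3 : ℝ)) := by
  have hi := intervalIntegral.intervalIntegrable_rpow' (a := 0) (b := M)
    (r := (-(2 / 3) : ℝ)) (by norm_num)
  rw [← ofReal_integral_eq_lintegral_ofReal
      ((intervalIntegrable_iff_integrableOn_Ioc_of_le hM.le).1 hi)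
      ((ae_restrict_mem measurableSet_Ioc).mono fun r hr => Real.rpow_nonneg hr.1.le _),
    ← intervalIntegral.integral_of_le hM.le, integral_rpow (Or.inl (by norm_num))]
  congr 1
  norm_num
  ring

theorem setLIntegral_Ioi_rpow {M : ℝ} (hM : 0 < M) :
    ∫⁻ r in Set.Ioi M, ENNReal.ofReal (r ^ (-(4 / 3) : ℝ)) =
      ENNReal.ofReal (3 * M ^ (-(1 / 3) : ℝ)) := by
  rw [← ofReal_integral_eq_lintegral_ofReal
      (integrableOn_Ioi_rpow_of_lt (by norm_num) hM)
      ((ae_restrict_mem measurableSet_Ioi).mono fun r hr =>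
        Real.rpow_nonneg (hM.trans hr).le _),
    integral_Ioi_rpow_of_lt (by norm_num) hM]
  congr 1
  norm_num
  ring

theorem lintegral_lowRegion_weightSq_le (η : E2) {M : ℝ} (hM : 0 < M) :
    ∫⁻ ξ in lowRegion η M, ENNReal.ofReal (weightSq ξ η) ≤
      (volume : Measure E2).toSphere Set.univ * ENNReal.ofReal (24 * M ^ (1 / 3 : ℝ)) := by
  have hmw : Measurable (fun ξ => ENNReal.ofReal (weightSq ξ η)) :=
    (measurable_weightSq.comp measurable_prodMk_right).ennreal_ofReal
  rw [← lintegral_indicator (measurableSet_lowRegion η M)]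
  refine lintegral_le_of_forall_ray_le (hmw.indicator (measurableSet_lowRegion η M))
    fun ω hω => ?_
  have hpt : ∀ r ∈ Set.Ioi (0 : ℝ), ∀ b : ℝ, 0 < b → (r • ω ∈ lowRegion η M →
      b ≤ ‖η‖ + ‖r • ω - η‖) → ENNReal.ofReal r *
      (lowRegion η M).indicator (fun ξ => ENNReal.ofReal (weightSq ξ η)) (r • ω) ≤
      ENNReal.ofReal (4 * b ^ (-(2 / 3) : ℝ)) := by
    intro r hr b hb hbS
    by_cases hmem : r • ω ∈ lowRegion η M
    · rw [Set.indicator_of_mem hmem, ← ENNReal.ofReal_mul (le_of_lt hr)]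
      refine ENNReal.ofReal_le_ofReal ?_
      specialize hbS hmem
      have hr' : 0 < r := hr
      have hnorm : ‖r • ω‖ = r := by
        rw [norm_smul, hω, Real.norm_of_nonneg hr'.le, mul_one]
      have hξ : r • ω ≠ 0 := by rw [← norm_pos_iff, hnorm]; exact hr'
      have hw := weightSq_le hξ hmem.1
      rw [hnorm] at hw
      calc r * weightSq (r • ω) η ≤ r * (4 * (r⁻¹ * (‖η‖ + ‖r • ω - η‖) ^ (-(2 / 3) : ℝ))) := by
            gcongr
        _ = 4 * (‖η‖ + ‖r • ω - η‖) ^ (-(2 / 3) : ℝ) := by field_simp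
        _ ≤ _ := by
            gcongr 4 * ?_
            exact Real.rpow_le_rpow_of_nonpos hb hbS (by norm_num)
    · rw [Set.indicator_of_notMem hmem]; simp
  have hnorm : ∀ r : ℝ, 0 < r → ‖r • ω‖ = r := fun r hr => by
    rw [norm_smul, hω, Real.norm_of_nonneg hr.le, mul_one]
  rw [← Set.Ioc_union_Ioi_eq_Ioi hM.le, lintegral_union measurableSet_Ioi
    Set.Ioc_disjoint_Ioi_same]
  have hA : ∫⁻ r in Set.Ioc 0 M, ENNReal.ofReal r *
      (lowRegion η M).indicator (fun ξ => ENNReal.ofReal (weightSq ξ η)) (r • ω) ≤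
      ENNReal.ofReal (12 * M ^ (1 / 3 : ℝ)) := by
    calc _ ≤ ∫⁻ r in Set.Ioc 0 M, ENNReal.ofReal 4 * ENNReal.ofReal (r ^ (-(2 / 3) : ℝ)) := by
          refine setLIntegral_mono' measurableSet_Ioc fun r hr => ?_
          rw [← ENNReal.ofReal_mul (by norm_num)]
          refine hpt r hr.1 r hr.1 fun hmem => ?_
          have := hmem.1
          rw [hnorm r hr.1] at this
          linarith [hr.1]
      _ = _ := by
          rw [lintegral_const_mul' _ _ ENNReal.ofReal_ne_top, setLIntegral_Ioc_rpow hM,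
            ← ENNReal.ofReal_mul (by norm_num)]
          congr 1
          ring
  have hB : ∫⁻ r in Set.Ioi M, ENNReal.ofReal r *
      (lowRegion η M).indicator (fun ξ => ENNReal.ofReal (weightSq ξ η)) (r • ω) ≤
      ENNReal.ofReal (12 * M ^ (1 / 3 : ℝ)) := by
    calc _ ≤ ∫⁻ r in Set.Ioi M, ENNReal.ofReal (4 * M ^ (2 / 3 : ℝ)) *
            ENNReal.ofReal (r ^ (-(4 / 3) : ℝ)) := by
          refine setLIntegral_mono' measurableSet_Ioi fun r hr => ?_
          have hr0 : 0 < r := hM.trans hr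
          rw [← ENNReal.ofReal_mul (by positivity)]
          refine (hpt r hr0 (r ^ 2 / M) (by positivity) fun hmem => ?_).trans (le_of_eq ?_)
          · have := hmem.2
            rw [hnorm r hr0] at this
            rw [div_le_iff₀ hM]
            linarith
          · congr 1
            rw [Real.div_rpow (by positivity) hM.le, div_eq_mul_inv, ← Real.rpow_neg hM.le,
              ← Real.rpow_natCast, ← Real.rpow_mul hr0.le]
            norm_num
            ring
      _ = _ := by
          rw [lintegral_const_mul' _ _ ENNReal.ofReal_ne_top, setLIntegral_Ioi_rpow hM,
            ← ENNReal.ofReal_mul (by positivity)]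
          congr 1
          have : M ^ (1 / 3 : ℝ) = M ^ (2 / 3 : ℝ) * M ^ (-(1 / 3) : ℝ) := by
            rw [← Real.rpow_add hM]; norm_num
          rw [this]; ring
  calc _ ≤ _ := add_le_add hA hB
    _ = _ := by
      rw [← ENNReal.ofReal_add (by positivity) (by positivity)]
      congr 1
      ring

/-- The pairs `(ζ, z)` with `ζ` the output frequency and `z`, `ζ - z` the input frequencies of a
high-high-to-low interaction with modulations at most `K` and `L`. -/
def interaction (s K L : ℝ) : Set (SpaceTime × SpaceTime) :=
  {p | 2 * ‖p.1.2‖ ≤ ‖p.2.2‖ + ‖p.1.2 - p.2.2‖ ∧ |p.2.1 + s * ‖p.2.2‖| ≤ K ∧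
    |p.1.1 - p.2.1 + s * ‖p.1.2 - p.2.2‖| ≤ L}

theorem measurableSet_interaction (s K L : ℝ) : MeasurableSet (interaction s K L) := by
  unfold interaction
  measurability

/-- The part of the interaction in which the input frequencies are at most `‖ξ‖² / K`. -/
def highOutput (K : ℝ) : Set (SpaceTime × SpaceTime) :=
  {p | K * (‖p.2.2‖ + ‖p.1.2 - p.2.2‖) ≤ ‖p.1.2‖ ^ 2}

theorem measurableSet_highOutput (K : ℝ) : MeasurableSet (highOutput K) := by
  unfold highOutput
  measurability

theorem volume_abs_sub_add_le (a b L : ℝ) :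
    volume {x : ℝ | |a - x + b| ≤ L} = ENNReal.ofReal (2 * L) := by
  have : {x : ℝ | |a - x + b| ≤ L} = Set.Icc (a + b - L) (a + b + L) := by
    ext x
    simp only [Set.mem_ofPred_eq, Set.mem_Icc, abs_le]
    constructor <;> rintro ⟨h, h'⟩ <;> constructor <;> linarith
  rw [this, Real.volume_Icc]
  congr 1
  ring

theorem volume_abs_add_add_le (a b L : ℝ) :
    volume {x : ℝ | |x - a + b| ≤ L} = ENNReal.ofReal (2 * L) := by
  have : {x : ℝ | |x - a + b| ≤ L} = Set.Icc (a - b - L) (a - b + L) := by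
    ext x
    simp only [Set.mem_ofPred_eq, Set.mem_Icc, abs_le]
    constructor <;> rintro ⟨h, h'⟩ <;> constructor <;> linarith
  rw [this, Real.volume_Icc]
  congr 1
  ring

/-- A slab of thickness `2 L` in time over each point `x` in `A` contributes `2 L ∫_A f`. -/
theorem lintegral_slab_le {A : Set E2} (hA : MeasurableSet A) {f : E2 → ℝ≥0∞}
    (hf : Measurable f) {F : SpaceTime → ℝ≥0∞} {E : E2 → Set ℝ} {c : ℝ≥0∞}
    (hE : MeasurableSet {p : SpaceTime | p.1 ∈ E p.2}) (hEc : ∀ x, volume (E x) = c)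
    (hF : ∀ t x, F (t, x) ≤ A.indicator f x * (E x).indicator 1 t) :
    ∫⁻ p, F p ≤ (∫⁻ x in A, f x) * c := by
  have hm : Measurable (fun p : SpaceTime => A.indicator f p.2 *
      {p : SpaceTime | p.1 ∈ E p.2}.indicator 1 p) :=
    ((hf.indicator hA).comp measurable_snd).mul (measurable_one.indicator hE)
  calc ∫⁻ p, F p ≤ ∫⁻ p : SpaceTime, A.indicator f p.2 *
        {p : SpaceTime | p.1 ∈ E p.2}.indicator 1 p := lintegral_mono fun p => hF p.1 p.2
    _ = ∫⁻ x, ∫⁻ t, A.indicator f x * (E x).indicator 1 t :=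
        lintegral_prod_symm' (μ := (volume : Measure ℝ)) (ν := (volume : Measure E2)) _ hm
    _ = ∫⁻ x, A.indicator f x * c := by
        refine lintegral_congr fun x => ?_
        have hEx : MeasurableSet (E x) := hE.preimage (measurable_prodMk_right (y := x))
        rw [lintegral_const_mul _ (measurable_one.indicator hEx), lintegral_indicator_one hEx,
          hEc]
    _ = _ := by
        rw [lintegral_mul_const _ (hf.indicator hA), lintegral_indicator hA]

/-- The constant in the two geometric estimates. -/
def geomConst : ℝ≥0∞ := (volume : Measure E2).toSphere Set.univ * 48

theorem geomConst_ne_top : geomConst ≠ ⊤ :=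
  ENNReal.mul_ne_top (measure_ne_top _ _) (by norm_num)

theorem geomConst_mul (L x : ℝ) (hx : 0 ≤ x) :
    (volume : Measure E2).toSphere Set.univ * ENNReal.ofReal (24 * x) * ENNReal.ofReal (2 * L) =
      geomConst * ENNReal.ofReal (L * x) := by
  rw [geomConst, mul_assoc, mul_assoc, ← ENNReal.ofReal_mul (by positivity),
    show (48 : ℝ≥0∞) = ENNReal.ofReal 48 by norm_num, ← ENNReal.ofReal_mul (by norm_num)]
  congr 2
  ring

theorem lintegral_highOutput_le {s K L : ℝ} (hs : s = 1 ∨ s = -1) (hK : 0 < K) (hLK : L ≤ K)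
    (ζ : SpaceTime) :
    ∫⁻ z, (interaction s K L ∩ highOutput K).indicator
      (fun p => ENNReal.ofReal (weightSq p.1.2 p.2.2)) (ζ, z) ≤
        geomConst * ENNReal.ofReal (L * K ^ (1 / 3 : ℝ)) := by
  have hmw : Measurable (fun η => ENNReal.ofReal (weightSq ζ.2 η)) :=
    (measurable_weightSq.comp measurable_prodMk_left).ennreal_ofReal
  rw [← geomConst_mul _ _ (by positivity)]
  refine (lintegral_slab_le (measurableSet_annulus ζ.2 (-s * ζ.1) K) hmw
    (E := fun η => {t | |ζ.1 - t + s * ‖ζ.2 - η‖| ≤ L}) (by measurability)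
    (fun η => volume_abs_sub_add_le _ _ _) fun t η => ?_).trans
    (mul_le_mul_left (lintegral_annulus_weightSq_le ζ.2 (-s * ζ.1) hK) _)
  by_cases hmem : (ζ, ((t, η) : SpaceTime)) ∈ interaction s K L ∩ highOutput K
  · obtain ⟨⟨h1, h2, h3⟩, h4⟩ := id hmem
    simp only [highOutput, Set.mem_ofPred_eq] at h1 h2 h3 h4
    have hη : η ∈ annulus ζ.2 (-s * ζ.1) K := by
      refine ⟨h1, h4, ?_⟩
      rw [abs_le] at h2 h3 ⊢
      rcases hs with rfl | rfl <;> constructor <;> linarith [h2.1, h2.2, h3.1, h3.2]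
    rw [Set.indicator_of_mem hmem, Set.indicator_of_mem hη,
      Set.indicator_of_mem (show t ∈ {t | |ζ.1 - t + s * ‖ζ.2 - η‖| ≤ L} from h3)]
    simp
  · rw [Set.indicator_of_notMem hmem]; exact zero_le

theorem lintegral_lowOutput_le {s K L : ℝ} (hK : 0 < K) (z : SpaceTime) :
    ∫⁻ ζ, (interaction s K L ∩ (highOutput K)ᶜ).indicator
      (fun p => ENNReal.ofReal (weightSq p.1.2 p.2.2)) (ζ, z) ≤
        geomConst * ENNReal.ofReal (L * K ^ (1 / 3 : ℝ)) := by
  have hmw : Measurable (fun ξ => ENNReal.ofReal (weightSq ξ z.2)) :=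
    (measurable_weightSq.comp measurable_prodMk_right).ennreal_ofReal
  rw [← geomConst_mul _ _ (by positivity)]
  refine (lintegral_slab_le (measurableSet_lowRegion z.2 K) hmw
    (E := fun ξ => {t | |t - z.1 + s * ‖ξ - z.2‖| ≤ L}) (by measurability)
    (fun ξ => volume_abs_add_add_le _ _ _) fun t ξ => ?_).trans
    (mul_le_mul_left (lintegral_lowRegion_weightSq_le z.2 hK) _)
  by_cases hmem : (((t, ξ) : SpaceTime), z) ∈ interaction s K L ∩ (highOutput K)ᶜ
  · obtain ⟨⟨h1, h2, h3⟩, h4⟩ := id hmem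
    simp only [highOutput, Set.mem_ofPred_eq, Set.mem_compl_iff, not_le] at h1 h2 h3 h4
    rw [Set.indicator_of_mem hmem, Set.indicator_of_mem (show ξ ∈ lowRegion z.2 K from ⟨h1, h4.le⟩),
      Set.indicator_of_mem (show t ∈ {t | |t - z.1 + s * ‖ξ - z.2‖| ≤ L} from h3)]
    simp
  · rw [Set.indicator_of_notMem hmem]; exact zero_le

/-- The `L²` norm of a nonnegative function. -/
def l2N {α : Type*} [MeasurableSpace α] (μ : Measure α) (f : α → ℝ≥0∞) : ℝ≥0∞ :=
  (∫⁻ x, f x ^ 2 ∂μ) ^ (1 / 2 : ℝ)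

theorem l2N_sq {α : Type*} [MeasurableSpace α] (μ : Measure α) (f : α → ℝ≥0∞) :
    l2N μ f ^ 2 = ∫⁻ x, f x ^ 2 ∂μ := by
  rw [l2N, ← ENNReal.rpow_natCast, ← ENNReal.rpow_mul]
  norm_num

theorem lintegral_mul_le_l2N_mul_l2N {α : Type*} [MeasurableSpace α] {μ : Measure α}
    {f g : α → ℝ≥0∞} (hf : Measurable f) (hg : Measurable g) :
    ∫⁻ x, f x * g x ∂μ ≤ l2N μ f * l2N μ g := by
  have := ENNReal.lintegral_mul_le_Lp_mul_Lq μ Real.HolderConjugate.two_two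
    hf.aemeasurable hg.aemeasurable
  simp only [ENNReal.rpow_two] at this
  exact this

theorem l2N_le_of_lintegral_le {α : Type*} [MeasurableSpace α] {μ : Measure α}
    {f : α → ℝ≥0∞} {c d : ℝ≥0∞} (h : ∫⁻ x, f x ^ 2 ∂μ ≤ c * d ^ 2) :
    l2N μ f ≤ c ^ (1 / 2 : ℝ) * d := by
  calc l2N μ f ≤ (c * d ^ 2) ^ (1 / 2 : ℝ) := ENNReal.rpow_le_rpow h (by norm_num)
    _ = _ := by
      rw [ENNReal.mul_rpow_of_nonneg _ _ (by norm_num), ← ENNReal.rpow_natCast,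
        ← ENNReal.rpow_mul]
      norm_num

section Trilinear

variable {X : Type*} [AddCommGroup X] [MeasurableSpace X] [MeasurableAdd₂ X] [MeasurableNeg X]
  {μ : Measure X} [SFinite μ]

theorem lintegral_kernel_le_of_left [μ.IsAddLeftInvariant] {k : X × X → ℝ≥0∞}
    (hk : Measurable k) {W F G : X → ℝ≥0∞}
    (hW : Measurable W) (hF : Measurable F) (hG : Measurable G) {B : ℝ≥0∞}
    (hB : ∀ ζ, ∫⁻ z, k (ζ, z) ^ 2 ∂μ ≤ B) :
    ∫⁻ p, k p * (W p.1 * (F p.2 * G (p.1 - p.2))) ∂(μ.prod μ) ≤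
      B ^ (1 / 2 : ℝ) * (l2N μ W * (l2N μ F * l2N μ G)) := by
  have h1 : l2N (μ.prod μ) (fun p => k p * W p.1) ≤ B ^ (1 / 2 : ℝ) * l2N μ W := by
    refine l2N_le_of_lintegral_le ?_
    rw [lintegral_prod _ (by fun_prop), l2N_sq, ← lintegral_const_mul _ (by fun_prop)]
    refine lintegral_mono fun ζ => ?_
    simp only [mul_pow]
    rw [lintegral_mul_const _ (by fun_prop)]
    gcongr
    exact hB ζ
  have h2 : l2N (μ.prod μ) (fun p => F p.2 * G (p.1 - p.2)) ≤ 1 ^ (1 / 2 : ℝ) *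
      (l2N μ F * l2N μ G) := by
    refine l2N_le_of_lintegral_le (le_of_eq ?_)
    rw [lintegral_prod_symm _ (by fun_prop), mul_pow, l2N_sq, l2N_sq, one_mul,
      ← lintegral_mul_const _ (by fun_prop)]
    refine lintegral_congr fun z => ?_
    simp only [mul_pow]
    rw [lintegral_const_mul _ (by fun_prop), lintegral_sub_right_eq_self (fun x => G x ^ 2)]
  rw [ENNReal.one_rpow, one_mul] at h2
  calc _ = ∫⁻ p, (k p * W p.1) * (F p.2 * G (p.1 - p.2)) ∂(μ.prod μ) := by simp only [mul_assoc]
    _ ≤ _ := lintegral_mul_le_l2N_mul_l2N (by fun_prop) (by fun_prop)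
    _ ≤ (B ^ (1 / 2 : ℝ) * l2N μ W) * (l2N μ F * l2N μ G) := mul_le_mul' h1 h2
    _ = _ := by ring

theorem lintegral_kernel_le_of_right [μ.IsAddLeftInvariant] [μ.IsNegInvariant]
    {k : X × X → ℝ≥0∞} (hk : Measurable k) {W F G : X → ℝ≥0∞}
    (hW : Measurable W) (hF : Measurable F) (hG : Measurable G) {B : ℝ≥0∞}
    (hB : ∀ z, ∫⁻ ζ, k (ζ, z) ^ 2 ∂μ ≤ B) :
    ∫⁻ p, k p * (W p.1 * (F p.2 * G (p.1 - p.2))) ∂(μ.prod μ) ≤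
      B ^ (1 / 2 : ℝ) * (l2N μ W * (l2N μ F * l2N μ G)) := by
  have h1 : l2N (μ.prod μ) (fun p => k p * F p.2) ≤ B ^ (1 / 2 : ℝ) * l2N μ F := by
    refine l2N_le_of_lintegral_le ?_
    rw [lintegral_prod_symm _ (by fun_prop), l2N_sq, ← lintegral_const_mul _ (by fun_prop)]
    refine lintegral_mono fun z => ?_
    simp only [mul_pow]
    rw [lintegral_mul_const _ (by fun_prop)]
    gcongr
    exact hB z
  have h2 : l2N (μ.prod μ) (fun p => W p.1 * G (p.1 - p.2)) ≤ 1 ^ (1 / 2 : ℝ) *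
      (l2N μ W * l2N μ G) := by
    refine l2N_le_of_lintegral_le (le_of_eq ?_)
    rw [lintegral_prod _ (by fun_prop), mul_pow, l2N_sq, l2N_sq, one_mul,
      ← lintegral_mul_const _ (by fun_prop)]
    refine lintegral_congr fun ζ => ?_
    simp only [mul_pow]
    rw [lintegral_const_mul _ (by fun_prop), lintegral_sub_left_eq_self (fun x => G x ^ 2)]
  rw [ENNReal.one_rpow, one_mul] at h2
  calc _ = ∫⁻ p, (k p * F p.2) * (W p.1 * G (p.1 - p.2)) ∂(μ.prod μ) := by
        refine lintegral_congr fun p => by ring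
    _ ≤ _ := lintegral_mul_le_l2N_mul_l2N (by fun_prop) (by fun_prop)
    _ ≤ (B ^ (1 / 2 : ℝ) * l2N μ F) * (l2N μ W * l2N μ G) := mul_le_mul' h1 h2
    _ = _ := by ring

end Trilinear

/-- The weight `⟨ξ⟩^{-1/2} ⟨η⟩^{-1/6} ⟨ξ - η⟩^{-1/6}` at the output `ζ` and the input `z`. -/
def weight (p : SpaceTime × SpaceTime) : ℝ≥0∞ :=
  ENNReal.ofReal (weightSq p.1.2 p.2.2) ^ (1 / 2 : ℝ)

@[fun_prop]
theorem measurable_weight : Measurable weight := by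
  unfold weight
  exact (measurable_weightSq.comp (by fun_prop : Measurable
    fun p : SpaceTime × SpaceTime => (p.1.2, p.2.2))).ennreal_ofReal.pow_const _

theorem indicator_weight_sq (A : Set (SpaceTime × SpaceTime)) (p : SpaceTime × SpaceTime) :
    A.indicator weight p ^ 2 =
      A.indicator (fun p => ENNReal.ofReal (weightSq p.1.2 p.2.2)) p := by
  by_cases h : p ∈ A
  · rw [Set.indicator_of_mem h, Set.indicator_of_mem h, weight, ← ENNReal.rpow_natCast,
      ← ENNReal.rpow_mul]
    norm_num
  · rw [Set.indicator_of_notMem h, Set.indicator_of_notMem h]; simp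

theorem lintegral_interaction_le_of_le {s K L : ℝ} (hs : s = 1 ∨ s = -1) (hL : 0 < L)
    (hLK : L ≤ K) {W F G : SpaceTime → ℝ≥0∞}
    (hW : Measurable W) (hF : Measurable F) (hG : Measurable G) :
    ∫⁻ p, (interaction s K L).indicator weight p * (W p.1 * (F p.2 * G (p.1 - p.2))) ≤
      2 * (geomConst * ENNReal.ofReal ((K * L) ^ (2 / 3 : ℝ))) ^ (1 / 2 : ℝ) *
        (l2N volume W * (l2N volume F * l2N volume G)) := by
  have hK : 0 < K := hL.trans_le hLK
  have hle : geomConst * ENNReal.ofReal (L * K ^ (1 / 3 : ℝ)) ≤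
      geomConst * ENNReal.ofReal ((K * L) ^ (2 / 3 : ℝ)) := by
    gcongr
    calc L * K ^ (1 / 3 : ℝ) = L ^ (2 / 3 : ℝ) * L ^ (1 / 3 : ℝ) * K ^ (1 / 3 : ℝ) := by
          rw [← Real.rpow_add hL]; norm_num
      _ ≤ L ^ (2 / 3 : ℝ) * K ^ (1 / 3 : ℝ) * K ^ (1 / 3 : ℝ) := by gcongr
      _ = L ^ (2 / 3 : ℝ) * K ^ (2 / 3 : ℝ) := by
          rw [mul_assoc, ← Real.rpow_add hK]; norm_num
      _ = _ := by rw [mul_comm, Real.mul_rpow hK.le hL.le]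
  have hI := measurableSet_interaction s K L
  have hH := measurableSet_highOutput K
  have h1 := lintegral_kernel_le_of_left (μ := (volume : Measure SpaceTime))
    (measurable_weight.indicator (hI.inter hH)) hW hF hG
    (fun ζ => by
      simp only [indicator_weight_sq]
      exact (lintegral_highOutput_le hs hK hLK ζ).trans hle)
  have h2 := lintegral_kernel_le_of_right (μ := (volume : Measure SpaceTime))
    (measurable_weight.indicator (hI.inter hH.compl)) hW hF hG
    (fun ζ => by
      simp only [indicator_weight_sq]
      exact (lintegral_lowOutput_le (s := s) (L := L) hK ζ).trans hle)
  have hsplit : ∀ p, (interaction s K L).indicator weight p =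
      (interaction s K L ∩ highOutput K).indicator weight p +
      (interaction s K L ∩ (highOutput K)ᶜ).indicator weight p := by
    intro p
    by_cases h : p ∈ interaction s K L <;> by_cases h' : p ∈ highOutput K <;> simp [h, h']
  calc _ = _ := by
        simp only [hsplit, add_mul]
        exact lintegral_add_left ((measurable_weight.indicator (hI.inter hH)).mul
          (by fun_prop)) _
    _ ≤ _ := add_le_add h1 h2
    _ = _ := by ring

theorem interaction_swap {s K L : ℝ} (ζ z : SpaceTime) :
    (interaction s K L).indicator weight (ζ, ζ - z) =
      (interaction s L K).indicator weight (ζ, z) := by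
  have hiff : (ζ, ζ - z) ∈ interaction s K L ↔ (ζ, z) ∈ interaction s L K := by
    simp only [interaction, Set.mem_ofPred_eq, Prod.fst_sub, Prod.snd_sub, sub_sub_cancel,
      add_comm ‖ζ.2 - z.2‖]
    tauto
  have hw : weight (ζ, ζ - z) = weight (ζ, z) := by
    simp only [weight, weightSq, Prod.snd_sub, sub_sub_cancel]
    congr 2
    ring
  by_cases h : (ζ, z) ∈ interaction s L K
  · rw [Set.indicator_of_mem h, Set.indicator_of_mem (hiff.2 h), hw]
  · rw [Set.indicator_of_notMem h, Set.indicator_of_notMem (mt hiff.1 h)]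

theorem lintegral_interaction_le {s K L : ℝ} (hs : s = 1 ∨ s = -1) (hK : 0 < K) (hL : 0 < L)
    {W F G : SpaceTime → ℝ≥0∞}
    (hW : Measurable W) (hF : Measurable F) (hG : Measurable G) :
    ∫⁻ p, (interaction s K L).indicator weight p * (W p.1 * (F p.2 * G (p.1 - p.2))) ≤
      2 * (geomConst * ENNReal.ofReal ((K * L) ^ (2 / 3 : ℝ))) ^ (1 / 2 : ℝ) *
        (l2N volume W * (l2N volume F * l2N volume G)) := by
  rcases le_total L K with hLK | hLK
  · exact lintegral_interaction_le_of_le hs hL hLK hW hF hG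
  · have h := lintegral_interaction_le_of_le hs hK hLK hW hG hF
    have hm : ∀ {K L : ℝ} {F G : SpaceTime → ℝ≥0∞}, Measurable F → Measurable G →
        Measurable (fun p : SpaceTime × SpaceTime =>
          (interaction s K L).indicator weight p * (W p.1 * (F p.2 * G (p.1 - p.2)))) :=
      fun hF hG => (measurable_weight.indicator (measurableSet_interaction s _ _)).mul
        (by fun_prop)
    rw [mul_comm K L, mul_comm (l2N volume F)]
    refine le_trans (le_of_eq ?_) h
    rw [Measure.volume_eq_prod, lintegral_prod _ (hm hF hG).aemeasurable,
      lintegral_prod _ (hm hG hF).aemeasurable]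
    refine lintegral_congr fun ζ => ?_
    rw [← lintegral_sub_left_eq_self _ ζ]
    refine lintegral_congr fun z => ?_
    rw [interaction_swap, sub_sub_cancel, mul_comm (F _)]

namespace IsLPBump

variable {φ : ℝ → ℝ}

theorem abs_bounds (hφ : IsLPBump φ) {τ : ℝ} {j : ℤ} (h : φ (τ / 2 ^ j) ≠ 0) :
    2 ^ j ≤ 2 * |τ| ∧ |τ| ≤ 2 * 2 ^ j := by
  obtain ⟨h1, h2⟩ := hφ.support_subset _ h
  have hp : (0 : ℝ) < 2 ^ j := by positivity
  rw [abs_div, abs_of_pos hp] at h1 h2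
  rw [le_div_iff₀ hp] at h1
  rw [div_le_iff₀ hp] at h2
  exact ⟨by linarith, h2⟩

theorem summable_dilates (hφ : IsLPBump φ) (τ : ℝ) : Summable fun j : ℤ => φ (τ / 2 ^ j) := by
  refine summable_of_hasFiniteSupport ?_
  rcases eq_or_ne τ 0 with rfl | hτ
  · refine Set.finite_empty.subset fun j hj => ?_
    have := (hφ.abs_bounds hj).1
    have hp : (0 : ℝ) < 2 ^ j := by positivity
    simp at this
    linarith
  · obtain ⟨n, hn1, hn2⟩ := exists_mem_Ico_zpow (abs_pos.2 hτ) (one_lt_two : (1 : ℝ) < 2)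
    refine (Finset.Icc (n - 1) (n + 1)).finite_toSet.subset fun j hj => ?_
    obtain ⟨h1, h2⟩ := hφ.abs_bounds hj
    have e1 : (2 : ℝ) ^ j < 2 ^ (n + 2) := by
      rw [zpow_add₀ two_ne_zero] at hn2 ⊢
      norm_num at hn2 ⊢
      linarith
    have e2 : (2 : ℝ) ^ n ≤ 2 ^ (j + 1) := by
      rw [zpow_add₀ two_ne_zero]
      norm_num
      linarith
    rw [zpow_lt_zpow_iff_right₀ one_lt_two] at e1
    rw [zpow_le_zpow_iff_right₀ one_lt_two] at e2
    simp only [Finset.coe_Icc, Set.mem_Icc]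
    omega

theorem lpSum_pos (hφ : IsLPBump φ) {τ : ℝ} (hτ : τ ≠ 0) : 0 < lpSum φ τ := by
  obtain ⟨j, hj⟩ : ∃ j : ℤ, 0 < φ (τ / 2 ^ j) := by
    obtain ⟨n, hn1, hn2⟩ := exists_mem_Ico_zpow (abs_pos.2 hτ) (one_lt_two : (1 : ℝ) < 2)
    have hs : (0 : ℝ) < √2 := by positivity
    have hs2 : √2 * √2 = 2 := Real.mul_self_sqrt (by norm_num)
    have hs1 : 1 ≤ √2 := Real.one_le_sqrt.2 (by norm_num)
    have hp : (0 : ℝ) < 2 ^ n := by positivity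
    have hn3 : |τ| < 2 ^ n * 2 := by simpa [zpow_add₀] using hn2
    have hinv : 1 / √2 ≤ 1 := by rw [div_le_iff₀ hs]; linarith
    by_cases h : |τ| ≤ √2 * 2 ^ n
    · refine ⟨n, hφ.pos _ ?_ ?_⟩ <;> rw [abs_div, abs_of_pos hp]
      · refine hinv.trans ?_
        rw [le_div_iff₀ hp]; linarith
      · rwa [div_le_iff₀ hp]
    · have hq : (2 : ℝ) ^ (n + 1) = 2 ^ n * 2 := by simp [zpow_add₀]
      refine ⟨n + 1, hφ.pos _ ?_ ?_⟩ <;>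
        rw [abs_div, abs_of_pos (by positivity : (0 : ℝ) < 2 ^ (n + 1)), hq]
      · rw [div_le_div_iff₀ hs (by positivity)]
        nlinarith
      · rw [div_le_iff₀ (by positivity)]
        nlinarith
  exact (hφ.summable_dilates τ).tsum_pos (fun i => hφ.nonneg _) j hj

theorem lpSum_nonneg (hφ : IsLPBump φ) (τ : ℝ) : 0 ≤ lpSum φ τ := tsum_nonneg fun _ => hφ.nonneg _

theorem injective_natCast_succ : Function.Injective fun k : ℕ => ((k + 1 : ℕ) : ℤ) :=
  fun a b h => by simpa using h

theorem summable_succ (hφ : IsLPBump φ) (τ : ℝ) : Summable fun k : ℕ => φ (τ / 2 ^ (k + 1)) := by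
  simpa only [Function.comp_def, zpow_natCast] using
    (hφ.summable_dilates τ).comp_injective injective_natCast_succ

theorem tsum_succ_le (hφ : IsLPBump φ) (τ : ℝ) : ∑' k : ℕ, φ (τ / 2 ^ (k + 1)) ≤ lpSum φ τ := by
  simpa only [Function.comp_def, zpow_natCast, lpSum] using
    tsum_comp_le_tsum_of_inj (hφ.summable_dilates τ) (fun _ => hφ.nonneg _)
      injective_natCast_succ

theorem tsum_succ_eq (hφ : IsLPBump φ) {τ : ℝ} (hτ : 2 < |τ|) :
    ∑' k : ℕ, φ (τ / 2 ^ (k + 1)) = lpSum φ τ := by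
  have := injective_natCast_succ.tsum_eq (f := fun j : ℤ => φ (τ / 2 ^ j)) fun j hj => by
    have h2 := (hφ.abs_bounds hj).2
    have h3 : (2 : ℝ) ^ (0 : ℤ) < 2 ^ j := by rw [zpow_zero]; linarith
    rw [zpow_lt_zpow_iff_right₀ one_lt_two] at h3
    exact ⟨(j - 1).toNat, by simp; omega⟩
  simpa only [zpow_natCast, lpSum] using this

theorem hasSum_lpPiece (hφ : IsLPBump φ) (τ : ℝ) : HasSum (fun k => lpPiece φ k τ) 1 := by
  rw [← hasSum_nat_add_iff' 1]
  have := ((hφ.summable_succ τ).div_const (lpSum φ τ)).hasSum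
  simpa [lpPiece] using this

theorem lpPiece_nonneg (hφ : IsLPBump φ) (k : ℕ) (τ : ℝ) : 0 ≤ lpPiece φ k τ := by
  cases k with
  | zero =>
    simp only [lpPiece, tsum_div_const, sub_nonneg]
    exact div_le_one_of_le₀ (hφ.tsum_succ_le τ) (hφ.lpSum_nonneg τ)
  | succ k => exact div_nonneg (hφ.nonneg _) (hφ.lpSum_nonneg τ)

theorem lpPiece_le_one (hφ : IsLPBump φ) (k : ℕ) (τ : ℝ) : lpPiece φ k τ ≤ 1 :=
  le_hasSum (hφ.hasSum_lpPiece τ) k fun _ _ => hφ.lpPiece_nonneg _ τ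

theorem abs_le_of_lpPiece_ne_zero (hφ : IsLPBump φ) {k : ℕ} {τ : ℝ} (h : lpPiece φ k τ ≠ 0) :
    |τ| ≤ 2 ^ (k + 1) := by
  cases k with
  | zero =>
    by_contra! h'
    norm_num at h'
    apply h
    have h0 : τ ≠ 0 := by rintro rfl; norm_num at h'
    simp only [lpPiece, tsum_div_const]
    rw [hφ.tsum_succ_eq h', div_self (hφ.lpSum_pos h0).ne', sub_self]
  | succ k =>
    have h1 : φ (τ / 2 ^ ((k + 1 : ℕ) : ℤ)) ≠ 0 := by
      rw [zpow_natCast]; rintro h1; exact h (by simp [lpPiece, h1])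
    have := (hφ.abs_bounds h1).2
    rw [zpow_natCast] at this
    rw [pow_succ 2 (k + 1)]; linarith

theorem le_abs_of_lpPiece_succ_ne_zero (hφ : IsLPBump φ) {k : ℕ} {τ : ℝ}
    (h : lpPiece φ (k + 1) τ ≠ 0) :
    2 ^ k ≤ |τ| := by
  have h1 : φ (τ / 2 ^ ((k + 1 : ℕ) : ℤ)) ≠ 0 := by
    rw [zpow_natCast]; rintro h1; exact h (by simp [lpPiece, h1])
  have := (hφ.abs_bounds h1).1
  rw [zpow_natCast, pow_succ] at this
  linarith

theorem measurable_lpPiece (hφ : IsLPBump φ) (k : ℕ) : Measurable (lpPiece φ k) := by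
  have hm := hφ.smooth.continuous.measurable
  have h1 : Measurable (lpSum φ) := Measurable.tsum fun j => by fun_prop
  cases k with
  | zero => exact measurable_const.sub (Measurable.tsum fun j => by fun_prop)
  | succ k =>
    change Measurable fun τ => φ (τ / 2 ^ (k + 1)) / lpSum φ τ
    fun_prop

end IsLPBump

/-- The modulus of the `k`-th Besov piece of `U`, weighted by `⟨ξ⟩^{1/6}`. -/
def besovPiece (φ : ℝ → ℝ) (s : ℝ) (U : SpaceTime → ℂ) (k : ℕ) (z : SpaceTime) : ℝ :=
  jap ‖z.2‖ ^ (1 / 6 : ℝ) * lpPiece φ k (z.1 + s * ‖z.2‖) * ‖U z‖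

theorem jap_le_one_add {x : ℝ} (hx : 0 ≤ x) : jap x ≤ 1 + x :=
  Real.sqrt_le_iff.2 ⟨by linarith, by nlinarith⟩

section

variable {φ : ℝ → ℝ} {s : ℝ}

theorem besovPiece_nonneg (hφ : IsLPBump φ) (U : SpaceTime → ℂ) (k : ℕ) (z : SpaceTime) :
    0 ≤ besovPiece φ s U k z :=
  mul_nonneg (mul_nonneg (Real.rpow_nonneg (jap_pos _).le _) (hφ.lpPiece_nonneg _ _))
    (norm_nonneg _)

theorem measurable_besovPiece (hφ : IsLPBump φ) {U : SpaceTime → ℂ} (hU : Measurable U) (k : ℕ) :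
    Measurable (besovPiece φ s U k) := by
  have := hφ.measurable_lpPiece k
  unfold besovPiece
  fun_prop

theorem IsLPBump.lpPiece_le (hφ : IsLPBump φ) (hs : s = 1 ∨ s = -1) (k : ℕ) (z : SpaceTime) :
    lpPiece φ k (z.1 + s * ‖z.2‖) ≤ 4 * (1 / 2) ^ k * (1 + ‖z‖) := by
  have hz := norm_nonneg z
  by_cases h0 : lpPiece φ k (z.1 + s * ‖z.2‖) = 0
  · rw [h0]; positivity
  have h1 := hφ.lpPiece_le_one k (z.1 + s * ‖z.2‖)
  refine h1.trans ?_
  cases k with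
  | zero => norm_num; linarith
  | succ k =>
    have h2 := hφ.le_abs_of_lpPiece_succ_ne_zero h0
    have h3 : |z.1 + s * ‖z.2‖| ≤ 2 * ‖z‖ := by
      have hs1 : |s| = 1 := by rcases hs with rfl | rfl <;> simp
      calc |z.1 + s * ‖z.2‖| ≤ |z.1| + |s * ‖z.2‖| := abs_add_le _ _
        _ = ‖z.1‖ + ‖z.2‖ := by rw [abs_mul, hs1, abs_norm, one_mul, Real.norm_eq_abs]
        _ ≤ 2 * ‖z‖ := by linarith [norm_fst_le z, norm_snd_le z]
    have h4 : (1 / 2 : ℝ) ^ k * 2 ^ k = 1 := by rw [← mul_pow]; norm_num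
    have h5 : (0 : ℝ) < (1 / 2) ^ k := by positivity
    rw [pow_succ]
    nlinarith

theorem besovPiece_le (hφ : IsLPBump φ) (hs : s = 1 ∨ s = -1) (U : SpaceTime → ℂ) (k : ℕ)
    (z : SpaceTime) :
    besovPiece φ s U k z ≤ 4 * (1 / 2) ^ k * ((1 + ‖z‖) ^ 2 * ‖U z‖) := by
  have hz := norm_nonneg z
  have h1 : jap ‖z.2‖ ^ (1 / 6 : ℝ) ≤ 1 + ‖z‖ := by
    calc jap ‖z.2‖ ^ (1 / 6 : ℝ) ≤ jap ‖z.2‖ ^ (1 : ℝ) :=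
          Real.rpow_le_rpow_of_exponent_le (one_le_jap _) (by norm_num)
      _ ≤ 1 + ‖z.2‖ := by rw [Real.rpow_one]; exact jap_le_one_add (norm_nonneg _)
      _ ≤ 1 + ‖z‖ := by linarith [norm_snd_le z]
  have h2 := hφ.lpPiece_le hs k z
  have h3 := hφ.lpPiece_nonneg k (z.1 + s * ‖z.2‖)
  calc besovPiece φ s U k z ≤ (1 + ‖z‖) * (4 * (1 / 2) ^ k * (1 + ‖z‖)) * ‖U z‖ := by
        unfold besovPiece; gcongr
    _ = _ := by ring

theorem exists_besovPiece_sq_le (hφ : IsLPBump φ) (hs : s = 1 ∨ s = -1) (U : 𝓢(SpaceTime, ℂ)) :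
    ∃ C : ℝ, 0 ≤ C ∧ ∀ k z,
      besovPiece φ s U k z ^ 2 ≤ (4 * (1 / 2) ^ k) ^ 2 * (C * ‖U z‖) := by
  obtain ⟨C, hC⟩ : ∃ C, ∀ z, (1 + ‖z‖) ^ 4 * ‖U z‖ ≤ C :=
    ⟨_, fun z => by
      simpa using SchwartzMap.one_add_le_sup_seminorm_apply (𝕜 := ℂ) (m := (4, 0)) le_rfl le_rfl
        U z⟩
  refine ⟨C, le_trans (by positivity) (hC 0), fun k z => ?_⟩
  calc besovPiece φ s U k z ^ 2
      ≤ (4 * (1 / 2) ^ k * ((1 + ‖z‖) ^ 2 * ‖U z‖)) ^ 2 := by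
        gcongr
        · exact besovPiece_nonneg hφ _ _ _
        · exact besovPiece_le hφ hs _ _ _
    _ = (4 * (1 / 2) ^ k) ^ 2 * ((1 + ‖z‖) ^ 4 * ‖U z‖ * ‖U z‖) := by ring
    _ ≤ _ := by gcongr; exact hC z

theorem integrable_besovPiece_sq (hφ : IsLPBump φ) (hs : s = 1 ∨ s = -1) (U : 𝓢(SpaceTime, ℂ))
    (k : ℕ) : Integrable fun z => besovPiece φ s U k z ^ 2 := by
  obtain ⟨C, -, hC⟩ := exists_besovPiece_sq_le hφ hs U
  refine ((U.integrable.norm.const_mul C).const_mul ((4 * (1 / 2) ^ k) ^ 2)).mono'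
    ((measurable_besovPiece hφ U.continuous.measurable k).pow_const 2).aestronglyMeasurable
    (.of_forall fun z => ?_)
  rw [Real.norm_of_nonneg (sq_nonneg _)]
  exact hC k z

theorem l2F_eq_sqrt_integral_besovPiece (hφ : IsLPBump φ) (hs : s = 1 ∨ s = -1)
    {u : SpaceTime → ℂ} {U : 𝓢(SpaceTime, ℂ)} (hU : ∀ τ ξ, ftST u τ ξ = U (τ, ξ)) (k : ℕ) :
    l2F (fun τ ξ => ((jap ‖ξ‖ ^ (1 / 6 : ℝ) * lpPiece φ k (τ + s * ‖ξ‖) : ℝ) : ℂ) * ftST u τ ξ) =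
      √(∫ z, besovPiece φ s U k z ^ 2) := by
  have h := integral_prod _ (integrable_besovPiece_sq hφ hs U k)
  rw [l2F, show (∫ z, besovPiece φ s U k z ^ 2) = _ from h]
  congr! 6 with τ ξ
  rw [hU, norm_mul, Complex.norm_real, Real.norm_of_nonneg, besovPiece]
  exact mul_nonneg (Real.rpow_nonneg (jap_pos _).le _) (hφ.lpPiece_nonneg _ _)

theorem ofReal_sqrt_integral_sq {f : SpaceTime → ℝ} (hf : ∀ z, 0 ≤ f z)
    (hi : Integrable fun z => f z ^ 2) :
    ENNReal.ofReal √(∫ z, f z ^ 2) = l2N volume fun z => ENNReal.ofReal (f z) := by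
  rw [Real.sqrt_eq_rpow, ← ENNReal.ofReal_rpow_of_nonneg (integral_nonneg fun _ => sq_nonneg _)
    (by norm_num), ofReal_integral_eq_lintegral_ofReal hi (.of_forall fun _ => sq_nonneg _), l2N]
  simp_rw [ENNReal.ofReal_pow (hf _)]

theorem ofReal_XnormB (hφ : IsLPBump φ) (hs : s = 1 ∨ s = -1)
    {u : SpaceTime → ℂ} {U : 𝓢(SpaceTime, ℂ)} (hU : ∀ τ ξ, ftST u τ ξ = U (τ, ξ)) :
    ENNReal.ofReal (XnormB φ (1 / 6) (1 / 3) s u) =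
      ∑' k : ℕ, ENNReal.ofReal ((2 : ℝ) ^ ((1 / 3 : ℝ) * k)) *
        l2N volume fun z => ENNReal.ofReal (besovPiece φ s U k z) := by
  have hnn : ∀ k : ℕ, 0 ≤ (2 : ℝ) ^ ((1 / 3 : ℝ) * k) * √(∫ z, besovPiece φ s U k z ^ 2) :=
    fun k => by positivity
  simp_rw [XnormB, l2F_eq_sqrt_integral_besovPiece hφ hs hU]
  rw [ENNReal.ofReal_tsum_of_nonneg hnn]
  · congr 1 with k
    rw [ENNReal.ofReal_mul (by positivity), ofReal_sqrt_integral_sq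
      (besovPiece_nonneg hφ U k) (integrable_besovPiece_sq hφ hs U k)]
  obtain ⟨C, hC0, hC⟩ := exists_besovPiece_sq_le hφ hs U
  set D := ∫ z, C * ‖U z‖
  have hr0 : (0 : ℝ) < 2 ^ (1 / 3 : ℝ) * (1 / 2) := by positivity
  have hr1 : (2 : ℝ) ^ (1 / 3 : ℝ) * (1 / 2) < 1 := by
    have : (2 : ℝ) ^ (1 / 3 : ℝ) < 2 ^ (1 : ℝ) :=
      Real.rpow_lt_rpow_of_exponent_lt (by norm_num) (by norm_num)
    rw [Real.rpow_one] at this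
    linarith
  refine .of_nonneg_of_le hnn (fun k => ?_)
    ((summable_geometric_of_lt_one hr0.le hr1).mul_right (4 * √D))
  have h1 : √(∫ z, besovPiece φ s U k z ^ 2) ≤ 4 * (1 / 2) ^ k * √D := by
    have : ∫ z, besovPiece φ s U k z ^ 2 ≤ (4 * (1 / 2) ^ k) ^ 2 * D := by
      rw [← integral_const_mul]
      exact integral_mono (integrable_besovPiece_sq hφ hs U k)
        ((U.integrable.norm.const_mul C).const_mul _) (hC k)
    calc _ ≤ √((4 * (1 / 2) ^ k) ^ 2 * D) := Real.sqrt_le_sqrt this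
      _ = _ := by rw [Real.sqrt_mul (sq_nonneg _), Real.sqrt_sq (by positivity)]
  rw [Real.rpow_mul two_pos.le, Real.rpow_natCast, mul_pow]
  calc _ ≤ ((2 : ℝ) ^ (1 / 3 : ℝ)) ^ k * (4 * (1 / 2) ^ k * √D) := by gcongr
    _ = _ := by ring

end

theorem l2N_le_of_forall_lintegral_mul_le {α : Type*} [MeasurableSpace α] {μ : Measure α}
    {h : α → ℝ≥0∞} {D : ℝ≥0∞} (hfin : ∫⁻ x, h x ^ 2 ∂μ ≠ ∞)
    (hD : ∫⁻ x, h x * h x ∂μ ≤ D * l2N μ h) : l2N μ h ≤ D := by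
  have h1 : l2N μ h ≠ ∞ := (ENNReal.rpow_lt_top_of_nonneg (by norm_num) hfin).ne
  rcases eq_or_ne (l2N μ h) 0 with h0 | h0
  · rw [h0]; exact zero_le
  rw [← ENNReal.mul_le_mul_iff_left h0 h1]
  refine le_of_eq_of_le ?_ hD
  rw [← sq, l2N_sq]
  simp_rw [sq]

/-- Pairs of an output and an input frequency subject to high-high-to-low interaction. -/
def highHighLow : Set (SpaceTime × SpaceTime) :=
  {p | 2 * ‖p.1.2‖ ≤ ‖p.2.2‖ + ‖p.1.2 - p.2.2‖}

theorem measurableSet_highHighLow : MeasurableSet highHighLow :=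
  measurableSet_le (by fun_prop) (by fun_prop)

/-- The integrand bounding `⟨ξ⟩^{-1/2}` times the high-high-to-low interaction. -/
def hhIntegrand (U V : SpaceTime → ℂ) (p : SpaceTime × SpaceTime) : ℝ≥0∞ :=
  highHighLow.indicator (fun p => ENNReal.ofReal (jap ‖p.1.2‖ ^ (-(1 / 2) : ℝ))) p *
    (‖U p.2‖ₑ * ‖V (p.1 - p.2)‖ₑ)

@[fun_prop]
theorem measurable_hhIntegrand {U V : SpaceTime → ℂ} (hU : Measurable U) (hV : Measurable V) :
    Measurable (hhIntegrand U V) := by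
  unfold hhIntegrand
  refine (Measurable.indicator ?_ measurableSet_highHighLow).mul ?_ <;> fun_prop

theorem hhIntegrand_le (U V : SpaceTime → ℂ) (p : SpaceTime × SpaceTime) :
    hhIntegrand U V p ≤ ‖U p.2‖ₑ * ‖V (p.1 - p.2)‖ₑ := by
  refine mul_le_of_le_one_left zero_le ?_
  refine Set.indicator_le (g := fun _ => 1) (fun p _ => ?_) p
  rw [← ENNReal.ofReal_one]
  exact ENNReal.ofReal_le_ofReal
    (Real.rpow_le_one_of_one_le_of_nonpos (one_le_jap _) (by norm_num))

theorem weight_eq (p : SpaceTime × SpaceTime) :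
    weight p = ENNReal.ofReal (jap ‖p.1.2‖ ^ (-(1 / 2) : ℝ)) *
      (ENNReal.ofReal (jap ‖p.2.2‖ ^ (-(1 / 6) : ℝ)) *
        ENNReal.ofReal (jap ‖p.1.2 - p.2.2‖ ^ (-(1 / 6) : ℝ))) := by
  have h1 := jap_pos ‖p.1.2‖
  have h2 := jap_pos ‖p.2.2‖
  have h3 := jap_pos ‖p.1.2 - p.2.2‖
  rw [weight, weightSq, ENNReal.ofReal_rpow_of_nonneg (by positivity) (by norm_num),
    ← ENNReal.ofReal_mul (by positivity), ← ENNReal.ofReal_mul (by positivity),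
    Real.mul_rpow (by positivity) (by positivity), Real.mul_rpow (by positivity) (by positivity),
    ← Real.rpow_mul h1.le, ← Real.rpow_mul h2.le, ← Real.rpow_mul h3.le, mul_assoc]
  norm_num

section

variable {φ : ℝ → ℝ} {s : ℝ}

theorem enorm_eq_tsum_besovPiece (hφ : IsLPBump φ) (U : SpaceTime → ℂ) (z : SpaceTime) :
    ‖U z‖ₑ = ENNReal.ofReal (jap ‖z.2‖ ^ (-(1 / 6) : ℝ)) *
      ∑' k, ENNReal.ofReal (besovPiece φ s U k z) := by
  have hj := jap_pos ‖z.2‖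
  have h1 := hφ.hasSum_lpPiece (z.1 + s * ‖z.2‖)
  have h2 := (h1.mul_left (jap ‖z.2‖ ^ (1 / 6 : ℝ))).mul_right ‖U z‖
  rw [← ENNReal.ofReal_tsum_of_nonneg (fun k => besovPiece_nonneg hφ U k z) h2.summable]
  change _ = _ * ENNReal.ofReal (∑' k, jap ‖z.2‖ ^ (1 / 6 : ℝ) *
    lpPiece φ k (z.1 + s * ‖z.2‖) * ‖U z‖)
  rw [h2.tsum_eq, ← ENNReal.ofReal_mul (by positivity), mul_one, ← mul_assoc,
    ← Real.rpow_add hj]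
  norm_num

theorem hhIntegrand_le_tsum (hφ : IsLPBump φ) (U V : SpaceTime → ℂ) (p : SpaceTime × SpaceTime) :
    hhIntegrand U V p ≤ ∑' k : ℕ, ∑' l : ℕ,
      (interaction s (2 ^ (k + 1)) (2 ^ (l + 1))).indicator weight p *
        (ENNReal.ofReal (besovPiece φ s U k p.2) *
          ENNReal.ofReal (besovPiece φ s V l (p.1 - p.2))) := by
  by_cases hp : p ∈ highHighLow
  swap
  · rw [hhIntegrand, Set.indicator_of_notMem hp, zero_mul]; exact zero_le
  have h1 : hhIntegrand U V p = ∑' k : ℕ, ∑' l : ℕ, weight p *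
      (ENNReal.ofReal (besovPiece φ s U k p.2) *
        ENNReal.ofReal (besovPiece φ s V l (p.1 - p.2))) := by
    rw [hhIntegrand, Set.indicator_of_mem hp, enorm_eq_tsum_besovPiece (s := s) hφ U,
      enorm_eq_tsum_besovPiece (s := s) hφ V]
    simp_rw [ENNReal.tsum_mul_left, ENNReal.tsum_mul_right, weight_eq]
    rw [Prod.snd_sub]
    ring
  rw [h1]
  refine ENNReal.tsum_le_tsum fun k => ENNReal.tsum_le_tsum fun l => ?_
  by_cases hU : besovPiece φ s U k p.2 = 0
  · simp [hU]
  by_cases hV : besovPiece φ s V l (p.1 - p.2) = 0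
  · simp [hV]
  have hU1 : lpPiece φ k (p.2.1 + s * ‖p.2.2‖) ≠ 0 := fun h => hU (by simp [besovPiece, h])
  have hV1 : lpPiece φ l (p.1.1 - p.2.1 + s * ‖p.1.2 - p.2.2‖) ≠ 0 := fun h =>
    hV (by simp [besovPiece, h])
  rw [Set.indicator_of_mem]
  exact ⟨hp, hφ.abs_le_of_lpPiece_ne_zero hU1, hφ.abs_le_of_lpPiece_ne_zero hV1⟩

/-- The constant in the trilinear estimate. -/
def trilinearConst : ℝ≥0∞ := 2 * geomConst ^ (1 / 2 : ℝ) * ENNReal.ofReal (4 ^ (1 / 3 : ℝ))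

theorem trilinearConst_ne_top : trilinearConst ≠ ∞ :=
  ENNReal.mul_ne_top (ENNReal.mul_ne_top (by norm_num)
    (ENNReal.rpow_lt_top_of_nonneg (by norm_num) geomConst_ne_top).ne) ENNReal.ofReal_ne_top

theorem dyadic_const_eq (k l : ℕ) :
    2 * (geomConst * ENNReal.ofReal (((2 : ℝ) ^ (k + 1) * 2 ^ (l + 1)) ^ (2 / 3 : ℝ))) ^
        (1 / 2 : ℝ) =
      trilinearConst * (ENNReal.ofReal ((2 : ℝ) ^ ((1 / 3 : ℝ) * k)) *
        ENNReal.ofReal ((2 : ℝ) ^ ((1 / 3 : ℝ) * l))) := by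
  have h1 : (((2 : ℝ) ^ (k + 1) * 2 ^ (l + 1)) ^ (2 / 3 : ℝ)) ^ (1 / 2 : ℝ) =
      4 ^ (1 / 3 : ℝ) * (2 ^ ((1 / 3 : ℝ) * k) * 2 ^ ((1 / 3 : ℝ) * l)) := by
    rw [← Real.rpow_mul (by positivity), mul_comm (1 / 3 : ℝ) k, mul_comm (1 / 3 : ℝ) l,
      Real.rpow_mul two_pos.le, Real.rpow_mul two_pos.le, Real.rpow_natCast, Real.rpow_natCast,
      ← Real.mul_rpow (by positivity) (by positivity),
      ← Real.mul_rpow (by positivity) (by positivity)]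
    congr 1
    · ring
    · norm_num
  rw [ENNReal.mul_rpow_of_nonneg _ _ (by norm_num),
    ENNReal.ofReal_rpow_of_nonneg (by positivity) (by norm_num), h1,
    ENNReal.ofReal_mul (by positivity), ENNReal.ofReal_mul (by positivity), trilinearConst]
  ring

theorem lintegral_mul_hhIntegrand_le (hφ : IsLPBump φ) (hs : s = 1 ∨ s = -1)
    {U V : SpaceTime → ℂ} (hU : Measurable U) (hV : Measurable V)
    {W : SpaceTime → ℝ≥0∞} (hW : Measurable W) :
    ∫⁻ p : SpaceTime × SpaceTime, W p.1 * hhIntegrand U V p ≤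
      trilinearConst *
        ((∑' k : ℕ, ENNReal.ofReal ((2 : ℝ) ^ ((1 / 3 : ℝ) * k)) *
          l2N volume fun z => ENNReal.ofReal (besovPiece φ s U k z)) *
        (∑' k : ℕ, ENNReal.ofReal ((2 : ℝ) ^ ((1 / 3 : ℝ) * k)) *
          l2N volume fun z => ENNReal.ofReal (besovPiece φ s V k z))) * l2N volume W := by
  have hmU : ∀ k, Measurable fun z => ENNReal.ofReal (besovPiece φ s U k z) :=
    fun k => (measurable_besovPiece hφ hU k).ennreal_ofReal
  have hmV : ∀ k, Measurable fun z => ENNReal.ofReal (besovPiece φ s V k z) :=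
    fun k => (measurable_besovPiece hφ hV k).ennreal_ofReal
  have hm : ∀ k l : ℕ, Measurable fun p : SpaceTime × SpaceTime =>
      (interaction s (2 ^ (k + 1)) (2 ^ (l + 1))).indicator weight p *
        (W p.1 * (ENNReal.ofReal (besovPiece φ s U k p.2) *
          ENNReal.ofReal (besovPiece φ s V l (p.1 - p.2)))) := fun k l =>
    (measurable_weight.indicator (measurableSet_interaction _ _ _)).mul
      ((hW.comp measurable_fst).mul (((hmU k).comp measurable_snd).mul
        ((hmV l).comp (measurable_fst.sub measurable_snd))))
  calc ∫⁻ p : SpaceTime × SpaceTime, W p.1 * hhIntegrand U V p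
      ≤ ∫⁻ p : SpaceTime × SpaceTime, ∑' k : ℕ, ∑' l : ℕ,
          (interaction s (2 ^ (k + 1)) (2 ^ (l + 1))).indicator weight p *
            (W p.1 * (ENNReal.ofReal (besovPiece φ s U k p.2) *
              ENNReal.ofReal (besovPiece φ s V l (p.1 - p.2)))) := by
        refine lintegral_mono fun p => ?_
        refine (mul_le_mul_right (hhIntegrand_le_tsum (s := s) hφ U V p) _).trans_eq ?_
        simp_rw [← ENNReal.tsum_mul_left, mul_left_comm (W p.1)]
    _ = ∑' k : ℕ, ∑' l : ℕ, ∫⁻ p : SpaceTime × SpaceTime,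
          (interaction s (2 ^ (k + 1)) (2 ^ (l + 1))).indicator weight p *
            (W p.1 * (ENNReal.ofReal (besovPiece φ s U k p.2) *
              ENNReal.ofReal (besovPiece φ s V l (p.1 - p.2)))) := by
        rw [lintegral_tsum fun k => (Measurable.tsum fun l => hm k l).aemeasurable]
        simp_rw [lintegral_tsum fun l => (hm _ l).aemeasurable]
    _ ≤ ∑' k : ℕ, ∑' l : ℕ, trilinearConst * (ENNReal.ofReal ((2 : ℝ) ^ ((1 / 3 : ℝ) * k)) *
          ENNReal.ofReal ((2 : ℝ) ^ ((1 / 3 : ℝ) * l))) *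
          (l2N volume W * ((l2N volume fun z => ENNReal.ofReal (besovPiece φ s U k z)) *
            l2N volume fun z => ENNReal.ofReal (besovPiece φ s V l z))) := by
        refine ENNReal.tsum_le_tsum fun k => ENNReal.tsum_le_tsum fun l => ?_
        rw [← dyadic_const_eq]
        exact lintegral_interaction_le hs (by positivity) (by positivity) hW (hmU k) (hmV l)
    _ = _ := by
        rw [← ENNReal.tsum_mul_right, ← ENNReal.tsum_mul_left, ← ENNReal.tsum_mul_right]
        congr 1 with k
        rw [← ENNReal.tsum_mul_left, ← ENNReal.tsum_mul_left, ← ENNReal.tsum_mul_right]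
        congr 1 with l
        ring

theorem lintegral_hhIntegrand_ne_top (U V : 𝓢(SpaceTime, ℂ)) :
    ∫⁻ ζ, ∫⁻ z, hhIntegrand U V (ζ, z) ≠ ∞ := by
  have hU := U.continuous.measurable
  have hV := V.continuous.measurable
  have h1 : ∫⁻ ζ, ∫⁻ z, hhIntegrand U V (ζ, z) ≤ (∫⁻ z, ‖U z‖ₑ) * ∫⁻ z, ‖V z‖ₑ := by
    calc ∫⁻ ζ, ∫⁻ z, hhIntegrand U V (ζ, z)
        ≤ ∫⁻ ζ, ∫⁻ z, ‖U z‖ₑ * ‖V (ζ - z)‖ₑ :=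
          lintegral_mono fun ζ => lintegral_mono fun z => hhIntegrand_le _ _ _
      _ = ∫⁻ z, ∫⁻ ζ, ‖U z‖ₑ * ‖V (ζ - z)‖ₑ := lintegral_lintegral_swap (by fun_prop)
      _ = ∫⁻ z, ‖U z‖ₑ * ∫⁻ ζ, ‖V ζ‖ₑ := by
          congr 1 with z
          rw [lintegral_const_mul _ (by fun_prop),
            lintegral_sub_right_eq_self (μ := (volume : Measure SpaceTime))
              (fun ζ => ‖V ζ‖ₑ) z]
      _ = _ := lintegral_mul_const _ hU.enorm
  exact (h1.trans_lt (ENNReal.mul_lt_top U.integrable.2 V.integrable.2)).ne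

theorem lintegral_sq_hhIntegrand_ne_top (U V : 𝓢(SpaceTime, ℂ)) :
    ∫⁻ ζ, (∫⁻ z, hhIntegrand U V (ζ, z)) ^ 2 ≠ ∞ := by
  have hU := U.continuous.measurable
  have hV := V.continuous.measurable
  obtain ⟨C, hC⟩ : ∃ C, ∀ z, ‖V z‖ ≤ C := ⟨_, fun z => V.norm_le_seminorm ℂ z⟩
  have h1 : ∀ ζ, ∫⁻ z, hhIntegrand U V (ζ, z) ≤ (∫⁻ z, ‖U z‖ₑ) * ENNReal.ofReal C := fun ζ => by
    rw [← lintegral_mul_const _ hU.enorm]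
    refine lintegral_mono fun z => (hhIntegrand_le _ _ _).trans ?_
    gcongr
    rw [← ofReal_norm]
    exact ENNReal.ofReal_le_ofReal (hC _)
  have h2 : (∫⁻ z, ‖U z‖ₑ) * ENNReal.ofReal C ≠ ∞ :=
    ENNReal.mul_ne_top U.integrable.2.ne ENNReal.ofReal_ne_top
  refine ne_top_of_le_ne_top (ENNReal.mul_ne_top h2 (lintegral_hhIntegrand_ne_top U V)) ?_
  rw [← lintegral_const_mul' _ _ h2]
  refine lintegral_mono fun ζ => ?_
  rw [sq]
  gcongr
  exact h1 ζ

theorem l2N_hhIntegrand_le (hφ : IsLPBump φ) (hs : s = 1 ∨ s = -1) (U V : 𝓢(SpaceTime, ℂ)) :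
    (l2N volume fun ζ => ∫⁻ z, hhIntegrand U V (ζ, z)) ≤
      trilinearConst *
        ((∑' k : ℕ, ENNReal.ofReal ((2 : ℝ) ^ ((1 / 3 : ℝ) * k)) *
          l2N volume fun z => ENNReal.ofReal (besovPiece φ s U k z)) *
        (∑' k : ℕ, ENNReal.ofReal ((2 : ℝ) ^ ((1 / 3 : ℝ) * k)) *
          l2N volume fun z => ENNReal.ofReal (besovPiece φ s V k z))) := by
  have hU := U.continuous.measurable
  have hV := V.continuous.measurable
  have hm := measurable_hhIntegrand hU hV
  refine l2N_le_of_forall_lintegral_mul_le (lintegral_sq_hhIntegrand_ne_top U V) ?_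
  refine le_of_eq_of_le ?_ (lintegral_mul_hhIntegrand_le hφ hs hU hV hm.lintegral_prod_right')
  rw [Measure.volume_eq_prod SpaceTime SpaceTime, lintegral_prod _ (by fun_prop)]
  congr 1 with ζ
  exact (lintegral_const_mul _ (by fun_prop)).symm

end

/-- The space–time Fourier transform of `⟨D⟩^{-1/2} (u,v)_{HH→L}`. -/
def hhSymbol (u v : SpaceTime → ℂ) (q : SpaceTime) : ℂ :=
  ((jap ‖q.2‖ ^ (-(1 : ℝ) / 2) : ℝ) : ℂ) * hhLowST u v q.1 q.2

section

variable {u v : SpaceTime → ℂ} {U V : 𝓢(SpaceTime, ℂ)}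

theorem enorm_hhSymbol_le (hU : ∀ τ ξ, ftST u τ ξ = U (τ, ξ)) (hV : ∀ τ ξ, ftST v τ ξ = V (τ, ξ))
    (q : SpaceTime) : ‖hhSymbol u v q‖ₑ ≤ ∫⁻ z, hhIntegrand U V (q, z) := by
  have hmU := U.continuous.measurable
  have hmV := V.continuous.measurable
  have hm := measurable_hhIntegrand hmU hmV
  have hj : 0 ≤ jap ‖q.2‖ ^ (-(1 / 2) : ℝ) := Real.rpow_nonneg (jap_pos _).le _
  rw [hhSymbol, hhLowST, enorm_mul, ← ofReal_norm, Complex.norm_real,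
    show (-(1 : ℝ) / 2) = -(1 / 2) by norm_num, Real.norm_of_nonneg hj,
    Measure.volume_eq_prod ℝ E2, lintegral_prod _ (by fun_prop)]
  refine (mul_le_mul_right ((enorm_integral_le_lintegral_enorm _).trans (lintegral_mono fun lam =>
    enorm_integral_le_lintegral_enorm _)) _).trans_eq ?_
  rw [← lintegral_const_mul' _ _ ENNReal.ofReal_ne_top]
  congr 1 with lam
  rw [← lintegral_const_mul' _ _ ENNReal.ofReal_ne_top]
  congr 1 with η
  by_cases h : 2 * ‖q.2‖ ≤ ‖η‖ + ‖q.2 - η‖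
  · rw [hhIntegrand, Set.indicator_of_mem (by exact h), if_pos h, hU, hV, one_mul, enorm_mul]
    rfl
  · rw [hhIntegrand, Set.indicator_of_notMem (by exact h), if_neg h]
    simp

theorem stronglyMeasurable_hhSymbol (hU : ∀ τ ξ, ftST u τ ξ = U (τ, ξ))
    (hV : ∀ τ ξ, ftST v τ ξ = V (τ, ξ)) : StronglyMeasurable (hhSymbol u v) := by
  have hmU := U.continuous.measurable
  have hmV := V.continuous.measurable
  refine StronglyMeasurable.mul (Measurable.stronglyMeasurable (by fun_prop)) ?_
  refine StronglyMeasurable.integral_prod_right (f := fun (q : SpaceTime) (lam : ℝ) =>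
    ∫ η : E2, (if 2 * ‖q.2‖ ≤ ‖η‖ + ‖q.2 - η‖ then (1 : ℂ) else 0) * ftST u lam η *
      ftST v (q.1 - lam) (q.2 - η)) ?_
  refine StronglyMeasurable.integral_prod_right (f := fun (r : SpaceTime × ℝ) (η : E2) =>
    (if 2 * ‖r.1.2‖ ≤ ‖η‖ + ‖r.1.2 - η‖ then (1 : ℂ) else 0) * ftST u r.2 η *
      ftST v (r.1.1 - r.2) (r.1.2 - η)) ?_
  simp_rw [hU, hV]
  refine Measurable.stronglyMeasurable (Measurable.mul (Measurable.mul ?_ ?_) ?_)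
  · exact Measurable.ite (measurableSet_le (by fun_prop) (by fun_prop)) measurable_const
      measurable_const
  · fun_prop
  · fun_prop

theorem integrable_hhSymbol (hU : ∀ τ ξ, ftST u τ ξ = U (τ, ξ))
    (hV : ∀ τ ξ, ftST v τ ξ = V (τ, ξ)) : Integrable (hhSymbol u v) :=
  ⟨(stronglyMeasurable_hhSymbol hU hV).aestronglyMeasurable,
    (lintegral_mono (enorm_hhSymbol_le hU hV)).trans_lt (lintegral_hhIntegrand_ne_top U V).lt_top⟩

theorem bilinHHLST_eq_integral_hhSymbol (h : Integrable (hhSymbol u v)) (p : SpaceTime) :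
    bilinHHLST u v p = ((2 * Real.pi) ^ (-3 : ℝ) : ℝ) •
      ∫ q : SpaceTime, Complex.exp (Complex.I * ((p.1 * q.1 + ⟪p.2, q.2⟫ : ℝ) : ℂ)) *
        hhSymbol u v q := by
  have hi : Integrable fun q : SpaceTime =>
      Complex.exp (Complex.I * ((p.1 * q.1 + ⟪p.2, q.2⟫ : ℝ) : ℂ)) * hhSymbol u v q := by
    refine h.bdd_mul (c := 1) (by fun_prop) (.of_forall fun q => ?_)
    rw [mul_comm, Complex.norm_exp_ofReal_mul_I]
  rw [bilinHHLST, show (∫ q : SpaceTime, _) = _ from integral_prod _ hi]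
  simp_rw [hhSymbol, mul_assoc]

end

theorem XnormB_nonneg (φ : ℝ → ℝ) (a b s : ℝ) (f : SpaceTime → ℂ) : 0 ≤ XnormB φ a b s f :=
  tsum_nonneg fun _ => mul_nonneg (by positivity) (Real.sqrt_nonneg _)

theorem ofReal_sqrt_integral_norm_sq_le (f : SpaceTime → ℂ) :
    ENNReal.ofReal √(∫ p, ‖f p‖ ^ 2) ≤ l2N volume fun p => ‖f p‖ₑ := by
  have h0 : 0 ≤ ∫ p, ‖f p‖ ^ 2 := integral_nonneg fun _ => sq_nonneg _
  rw [Real.sqrt_eq_rpow, ← ENNReal.ofReal_rpow_of_nonneg h0 (by norm_num), l2N,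
    ← Real.enorm_of_nonneg h0]
  refine ENNReal.rpow_le_rpow ((enorm_integral_le_lintegral_enorm _).trans_eq ?_) (by norm_num)
  simp_rw [enorm_pow, enorm_norm]

theorem l2N_mono {α : Type*} [MeasurableSpace α] {μ : Measure α} {f g : α → ℝ≥0∞}
    (h : ∀ x, f x ≤ g x) : l2N μ f ≤ l2N μ g :=
  ENNReal.rpow_le_rpow (lintegral_mono fun x => pow_le_pow_left' (h x) 2) (by norm_num)

/-- The constant relating the `L²` norm of `⟨D⟩^{-1/2} (u,v)_{HH→L}` to that of its symbol. -/
def plancherelConst : ℝ≥0∞ :=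
  ENNReal.ofReal ((2 * Real.pi) ^ (-3 : ℝ)) *
    ENNReal.ofReal ((2 * Real.pi) ^ 3) ^ (1 / 2 : ℝ)

theorem plancherelConst_ne_top : plancherelConst ≠ ∞ :=
  ENNReal.mul_ne_top ENNReal.ofReal_ne_top
    (ENNReal.rpow_lt_top_of_nonneg (by norm_num) ENNReal.ofReal_ne_top).ne

theorem l2N_bilinHHLST_le {u v : SpaceTime → ℂ} (h : Integrable (hhSymbol u v)) :
    (l2N volume fun p => ‖bilinHHLST u v p‖ₑ) ≤
      plancherelConst * l2N volume fun q => ‖hhSymbol u v q‖ₑ := by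
  have h0 : 0 ≤ (2 * Real.pi) ^ (-3 : ℝ) := by positivity
  have h1 : l2N volume (fun p : SpaceTime => ‖∫ q : SpaceTime,
      Complex.exp (Complex.I * ((p.1 * q.1 + ⟪p.2, q.2⟫ : ℝ) : ℂ)) * hhSymbol u v q‖ₑ) ≤
      ENNReal.ofReal ((2 * Real.pi) ^ 3) ^ (1 / 2 : ℝ) *
        l2N volume fun q => ‖hhSymbol u v q‖ₑ := by
    refine l2N_le_of_lintegral_le ?_
    rw [l2N_sq]
    exact lintegral_enorm_sq_fourier_spaceTime_le h
  simp_rw [bilinHHLST_eq_integral_hhSymbol h, enorm_smul, Real.enorm_of_nonneg h0]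
  rw [plancherelConst, mul_assoc]
  refine le_trans (le_of_eq ?_) (mul_le_mul_right h1 _)
  simp_rw [l2N, mul_pow]
  rw [lintegral_const_mul' _ _ (ENNReal.pow_ne_top ENNReal.ofReal_ne_top),
    ENNReal.mul_rpow_of_nonneg _ _ (by norm_num), ← ENNReal.rpow_natCast, ← ENNReal.rpow_mul]
  norm_num

/-- There is c > 0 such that for every sign s ∈ {+1,−1} and all Schwartz u, v on ℝ×ℝ²:
    ‖⟨D⟩^{−1/2}(u,v)_{HH→L}‖_{L²(ℝ_t×ℝ²_x)} ≤ c ‖u‖_{X^{1/6,1/3,1}_s} ‖v‖_{X^{1/6,1/3,1}_s},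
    with the same sign s in both factors. -/
theorem bilinear_strichartz_besov :
    ∀ φ : ℝ → ℝ, IsLPBump φ →
      ∃ c : ℝ, 0 < c ∧
        ∀ s : ℝ, (s = 1 ∨ s = -1) →
          ∀ u v : SchwartzMap SpaceTime ℂ,
            Real.sqrt (∫ p : SpaceTime, ‖bilinHHLST (fun q => u q) (fun q => v q) p‖ ^ 2) ≤
              c * XnormB φ (1 / 6) (1 / 3) s (fun q => u q) *
                XnormB φ (1 / 6) (1 / 3) s (fun q => v q) := by
  intro φ hφ
  have hK : plancherelConst * trilinearConst ≠ ∞ :=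
    ENNReal.mul_ne_top plancherelConst_ne_top trilinearConst_ne_top
  refine ⟨(plancherelConst * trilinearConst).toReal + 1, by positivity, fun s hs u v => ?_⟩
  obtain ⟨U, hU⟩ := exists_schwartz_ftST u
  obtain ⟨V, hV⟩ := exists_schwartz_ftST v
  have hXu := XnormB_nonneg φ (1 / 6) (1 / 3) s (fun q => u q)
  have hXv := XnormB_nonneg φ (1 / 6) (1 / 3) s (fun q => v q)
  refine le_trans ?_ (show (plancherelConst * trilinearConst).toReal *
    XnormB φ (1 / 6) (1 / 3) s (fun q => u q) * XnormB φ (1 / 6) (1 / 3) s (fun q => v q) ≤ _ by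
      gcongr; linarith)
  rw [← ENNReal.ofReal_le_ofReal_iff (by positivity), ENNReal.ofReal_mul (by positivity),
    ENNReal.ofReal_mul (by positivity), ENNReal.ofReal_toReal hK, ofReal_XnormB hφ hs hU,
    ofReal_XnormB hφ hs hV]
  calc _ ≤ _ := ofReal_sqrt_integral_norm_sq_le _
    _ ≤ _ := l2N_bilinHHLST_le (integrable_hhSymbol hU hV)
    _ ≤ _ := mul_le_mul_right (l2N_mono (enorm_hhSymbol_le hU hV)) _
    _ ≤ _ := mul_le_mul_right (l2N_hhIntegrand_le hφ hs U V) _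
    _ = _ := by ring
end
end
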